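/- For any constants a, b > 0 with a + b < 1/2 and any constant C₀ > 0, there exist ε > 0, C > 0 and N such that the following holds for all n ≥ N. Let d = (d_1,…,d_n) be a graphical degree sequence satisfying δ ≤ C₀ n^{1/2+ε} and min{d̄, n − d̄ − 1} ≥ n/(3a log n), and let h be a positive integer with h ≤ C₀ n^{2ε} and nh even; set m = nh/2. Then the expected number of h-regular spanning subgraphs of G ∼ 𝒢_d equals (√2 / (h!)^n) (2λm/e)^m exp( −(h²−1)/4 − ((1−λ)/(4λ)) h(h−2) − Rh/(2λ²n) + E ) for some real E with |E| ≤ C n^{−b}. -/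

import Mathlib

open scoped BigOperators Classical

namespace Stmt13

/-- The degree of vertex `j` in the graph `G`. -/
noncomputable def deg {n : ℕ} (G : SimpleGraph (Fin n)) (j : Fin n) : ℕ :=
  (Finset.univ.filter (fun k => G.Adj j k)).card

/-- The set of simple graphs on `{1,…,n}` with degree sequence `d`. -/
noncomputable def degFinset (n : ℕ) (d : Fin n → ℕ) : Finset (SimpleGraph (Fin n)) :=
  Finset.univ.filter (fun G => ∀ j, deg G j = d j)

/-- The average degree `d̄`. -/
noncomputable def dbar (n : ℕ) (d : Fin n → ℕ) : ℝ := (∑ j, (d j : ℝ)) / n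

/-- The edge density `λ = d̄ / (n-1)`. -/
noncomputable def lam (n : ℕ) (d : Fin n → ℕ) : ℝ := dbar n d / ((n : ℝ) - 1)

/-- `R = (1/n) Σ_j (d_j - d̄)²`. -/
noncomputable def Rpar (n : ℕ) (d : Fin n → ℕ) : ℝ :=
  (∑ j, ((d j : ℝ) - dbar n d) ^ 2) / n

/-- `δ = max_j |d_j - d̄|`. -/
noncomputable def deltaPar (n : ℕ) (d : Fin n → ℕ) : ℝ :=
  ⨆ j : Fin n, |(d j : ℝ) - dbar n d|

/-- The number of automorphisms of `H`: permutations of the vertices preserving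
the edge set. -/
noncomputable def autCard {k : ℕ} (H : SimpleGraph (Fin k)) : ℕ :=
  (Finset.univ.filter
    (fun π : Equiv.Perm (Fin k) => ∀ i j, H.Adj (π i) (π j) ↔ H.Adj i j)).card

/-- The number of `h`-regular spanning subgraphs of `G`. -/
noncomputable def regCount {n : ℕ} (h : ℕ) (G : SimpleGraph (Fin n)) : ℕ :=
  (Finset.univ.filter
    (fun K : SimpleGraph (Fin n) => K ≤ G ∧ ∀ j, deg K j = h)).card

/-- The expected number of `h`-regular spanning subgraphs of a uniformly random graph
with degree sequence `d`. -/
noncomputable def expReg (n : ℕ) (d : Fin n → ℕ) (h : ℕ) : ℝ :=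
  (∑ G ∈ degFinset n d, (regCount h G : ℝ)) / ((degFinset n d).card : ℝ)

section Switching

open Finset

variable {n : ℕ}

/-- Graphs with degree sequence `d` containing `Y`. -/
noncomputable def fam (d : Fin n → ℕ) (Y : SimpleGraph (Fin n)) :
    Finset (SimpleGraph (Fin n)) :=
  univ.filter (fun G => (∀ j, deg G j = d j) ∧ Y ≤ G)

/-- Real-valued indicator of a proposition. -/
noncomputable def ind (p : Prop) : ℝ := if p then 1 else 0

/-- Average of `f` over `fam d Y`. -/
noncomputable def mean (d : Fin n → ℕ) (Y : SimpleGraph (Fin n))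
    (f : SimpleGraph (Fin n) → ℝ) : ℝ :=
  (∑ G ∈ fam d Y, f G) / ((fam d Y).card : ℝ)

/-- Probability of the edge `xz` in a uniform element of `fam d Y`. -/
noncomputable def pr (d : Fin n → ℕ) (Y : SimpleGraph (Fin n)) (x z : Fin n) : ℝ :=
  mean d Y (fun G => ind (G.Adj x z))

lemma mem_fam {d : Fin n → ℕ} {Y G : SimpleGraph (Fin n)} :
    G ∈ fam d Y ↔ (∀ j, deg G j = d j) ∧ Y ≤ G := by
  simp [fam]

lemma ind_true {p : Prop} (h : p) : ind p = 1 := by simp [ind, h]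

lemma ind_false {p : Prop} (h : ¬ p) : ind p = 0 := by simp [ind, h]

lemma ind_nonneg (p : Prop) : 0 ≤ ind p := by
  unfold ind; split_ifs <;> norm_num

lemma ind_le_one (p : Prop) : ind p ≤ 1 := by
  unfold ind; split_ifs <;> norm_num

lemma ind_and (p r : Prop) : ind (p ∧ r) = ind p * ind r := by
  by_cases hp : p <;> by_cases hr : r <;> simp [ind, hp, hr]

lemma ind_congr {p r : Prop} (h : p ↔ r) : ind p = ind r := by
  rw [propext h]

lemma ind_not (p : Prop) : ind (¬ p) = 1 - ind p := by
  by_cases hp : p <;> simp [ind, hp]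

lemma ind_sq (p : Prop) : ind p * ind p = ind p := by
  by_cases hp : p <;> simp [ind, hp]

lemma sum_ind {α : Type*} (s : Finset α) (p : α → Prop) :
    ∑ x ∈ s, ind (p x) = ((s.filter p).card : ℝ) := by
  simp [ind]

lemma sum_ind_eq {α : Type*} [Fintype α] (u : α) : ∑ x : α, ind (x = u) = 1 := by
  simp [ind]

lemma sum_ind_eq_mul {α : Type*} [Fintype α] (u : α) (f : α → ℝ) :
    ∑ x : α, ind (x = u) * f x = f u := by
  simp [ind]

lemma deg_eq_sum (G : SimpleGraph (Fin n)) (j : Fin n) :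
    (deg G j : ℝ) = ∑ k, ind (G.Adj j k) := by
  rw [sum_ind]; rfl

lemma ind_adj_comm (G : SimpleGraph (Fin n)) (x y : Fin n) :
    ind (G.Adj x y) = ind (G.Adj y x) := ind_congr (G.adj_comm x y)

section Mean

variable (d : Fin n → ℕ) (Y : SimpleGraph (Fin n))

lemma mean_add (f g : SimpleGraph (Fin n) → ℝ) :
    mean d Y (fun G => f G + g G) = mean d Y f + mean d Y g := by
  simp [mean, sum_add_distrib, add_div]

lemma mean_sub (f g : SimpleGraph (Fin n) → ℝ) :
    mean d Y (fun G => f G - g G) = mean d Y f - mean d Y g := by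
  simp [mean, sum_sub_distrib, sub_div]

lemma mean_const_mul (c : ℝ) (f : SimpleGraph (Fin n) → ℝ) :
    mean d Y (fun G => c * f G) = c * mean d Y f := by
  simp [mean, ← mul_sum, mul_div_assoc]

lemma mean_mul_const (f : SimpleGraph (Fin n) → ℝ) (c : ℝ) :
    mean d Y (fun G => f G * c) = mean d Y f * c := by
  simp [mean, ← sum_mul, mul_div_right_comm]

lemma mean_sum {α : Type*} (s : Finset α) (f : α → SimpleGraph (Fin n) → ℝ) :
    mean d Y (fun G => ∑ x ∈ s, f x G) = ∑ x ∈ s, mean d Y (f x) := by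
  simp only [mean]
  rw [sum_comm, sum_div]

variable {d Y}

lemma mean_const (h : (fam d Y).Nonempty) (c : ℝ) : mean d Y (fun _ => c) = c := by
  have : ((fam d Y).card : ℝ) ≠ 0 := by exact_mod_cast h.card_pos.ne'
  simp [mean, this]

lemma mean_congr {f g : SimpleGraph (Fin n) → ℝ} (h : ∀ G ∈ fam d Y, f G = g G) :
    mean d Y f = mean d Y g := by
  simp only [mean]; rw [sum_congr rfl h]

lemma mean_mono {f g : SimpleGraph (Fin n) → ℝ} (h : ∀ G ∈ fam d Y, f G ≤ g G) :
    mean d Y f ≤ mean d Y g := by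
  simp only [mean]
  exact div_le_div_of_nonneg_right (sum_le_sum h) (Nat.cast_nonneg _)

lemma mean_nonneg {f : SimpleGraph (Fin n) → ℝ} (h : ∀ G ∈ fam d Y, 0 ≤ f G) :
    0 ≤ mean d Y f :=
  div_nonneg (sum_nonneg h) (Nat.cast_nonneg _)

lemma abs_mean_le {f g : SimpleGraph (Fin n) → ℝ} (h : ∀ G ∈ fam d Y, |f G| ≤ g G) :
    |mean d Y f| ≤ mean d Y g := by
  rw [abs_le]
  constructor
  · have := mean_mono (d := d) (Y := Y) (f := fun G => (-1) * g G) (g := f)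
      (fun G hG => by have := (abs_le.1 (h G hG)).1; linarith)
    rw [mean_const_mul] at this; linarith
  · exact mean_mono fun G hG => (abs_le.1 (h G hG)).2

lemma mean_le_of_le {f : SimpleGraph (Fin n) → ℝ} {c : ℝ} (hc : 0 ≤ c)
    (h : ∀ G ∈ fam d Y, f G ≤ c) : mean d Y f ≤ c := by
  rcases (fam d Y).eq_empty_or_nonempty with h0 | h0
  · simp [mean, h0, hc]
  · rw [← mean_const h0 c]; exact mean_mono h

lemma abs_mean_le_of_le {f : SimpleGraph (Fin n) → ℝ} {c : ℝ} (hc : 0 ≤ c)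
    (h : ∀ G ∈ fam d Y, |f G| ≤ c) : |mean d Y f| ≤ c :=
  (abs_mean_le h).trans (mean_le_of_le hc fun _ _ => le_rfl)

lemma mean_mul_card (f : SimpleGraph (Fin n) → ℝ) :
    mean d Y f * (fam d Y).card = ∑ G ∈ fam d Y, f G := by
  rcases (fam d Y).eq_empty_or_nonempty with h0 | h0
  · simp [mean, h0]
  · have : ((fam d Y).card : ℝ) ≠ 0 := by exact_mod_cast h0.card_pos.ne'
    simp [mean, this]

end Mean

lemma edge_le_iff {x z : Fin n} (hxz : x ≠ z) (G : SimpleGraph (Fin n)) :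
    SimpleGraph.edge x z ≤ G ↔ G.Adj x z := by
  constructor
  · intro h
    exact h ((SimpleGraph.edge_adj x z x z).2 ⟨Or.inl ⟨rfl, rfl⟩, hxz⟩)
  · intro h u w huw
    rw [SimpleGraph.edge_adj] at huw
    rcases huw with ⟨⟨rfl, rfl⟩ | ⟨rfl, rfl⟩, -⟩
    · exact h
    · exact h.symm

lemma fam_sup_edge (d : Fin n → ℕ) (Y : SimpleGraph (Fin n)) {x z : Fin n} (hxz : x ≠ z) :
    fam d (Y ⊔ SimpleGraph.edge x z) = (fam d Y).filter (fun G => G.Adj x z) := by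
  ext G
  simp only [mem_fam, mem_filter, sup_le_iff, edge_le_iff hxz, and_assoc]

lemma pr_mul_card (d : Fin n → ℕ) (Y : SimpleGraph (Fin n)) {x z : Fin n} (hxz : x ≠ z) :
    pr d Y x z * (fam d Y).card = (fam d (Y ⊔ SimpleGraph.edge x z)).card := by
  rw [pr, mean_mul_card, sum_ind, fam_sup_edge d Y hxz]

lemma pr_nonneg (d : Fin n → ℕ) (Y : SimpleGraph (Fin n)) (x z : Fin n) : 0 ≤ pr d Y x z :=
  mean_nonneg fun _ _ => ind_nonneg _

lemma pr_le_one (d : Fin n → ℕ) (Y : SimpleGraph (Fin n)) (x z : Fin n) : pr d Y x z ≤ 1 :=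
  mean_le_of_le zero_le_one fun _ _ => ind_le_one _

lemma pr_self (d : Fin n → ℕ) (Y : SimpleGraph (Fin n)) (x : Fin n) : pr d Y x x = 0 := by
  simp [pr, ind, mean]

lemma mean_ind_mul (d : Fin n → ℕ) (Y : SimpleGraph (Fin n)) {x z : Fin n} (hxz : x ≠ z)
    (f : SimpleGraph (Fin n) → ℝ) :
    mean d Y (fun G => ind (G.Adj x z) * f G)
      = pr d Y x z * mean d (Y ⊔ SimpleGraph.edge x z) f := by
  have key : ∑ G ∈ fam d Y, ind (G.Adj x z) * f G
      = ∑ G ∈ fam d (Y ⊔ SimpleGraph.edge x z), f G := by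
    rw [fam_sup_edge d Y hxz, sum_filter]
    exact sum_congr rfl fun G _ => by simp [ind]
  rw [mean, key, pr, mean, mean, sum_ind, ← fam_sup_edge d Y hxz]
  rcases (fam d (Y ⊔ SimpleGraph.edge x z)).eq_empty_or_nonempty with h0 | h0
  · simp [h0]
  · have : ((fam d (Y ⊔ SimpleGraph.edge x z)).card : ℝ) ≠ 0 := by
      exact_mod_cast h0.card_pos.ne'
    field_simp

/-- Indicator of the edge `uv` at `(x, y)`. -/
noncomputable def eind (u v x y : Fin n) : ℝ := ind ((x = u ∧ y = v) ∨ (x = v ∧ y = u))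

lemma sum_eind {u v : Fin n} (huv : u ≠ v) (x : Fin n) :
    ∑ y, eind u v x y = ind (x = u) + ind (x = v) := by
  have : ∀ y, eind u v x y = ind (x = u) * ind (y = v) + ind (x = v) * ind (y = u) := by
    intro y
    unfold eind
    by_cases h1 : x = u
    · have h2 : x ≠ v := fun h => huv (h1.symm.trans h)
      simp [ind, h1, huv]
    · simp [ind, h1]
      split_ifs <;> simp_all
  simp_rw [this, sum_add_distrib, ← mul_sum, sum_ind_eq, mul_one]

/-- The four edges toggled by a switching. -/
def swEdges (a v b w : Fin n) : SimpleGraph (Fin n) :=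
  (SimpleGraph.edge a v ⊔ SimpleGraph.edge b w) ⊔ (SimpleGraph.edge a w ⊔ SimpleGraph.edge b v)

/-- The switching replacing `av, bw` by `aw, bv`. -/
def sw (a v b w : Fin n) (G : SimpleGraph (Fin n)) : SimpleGraph (Fin n) :=
  symmDiff G (swEdges a v b w)

/-- `G` admits the switching replacing `av, bw` by `aw, bv` without touching `Y`. -/
def Pat (Y : SimpleGraph (Fin n)) (a v b w : Fin n) (G : SimpleGraph (Fin n)) : Prop :=
  (G.Adj a v ∧ ¬ Y.Adj a v) ∧ (G.Adj b w ∧ ¬ Y.Adj b w) ∧ ¬ G.Adj a w ∧ ¬ G.Adj b v ∧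
    a ≠ w ∧ b ≠ v

lemma swEdges_comm (a v b w : Fin n) : swEdges a w b v = swEdges a v b w := by
  unfold swEdges; rw [sup_comm]

lemma sw_sw (a v b w : Fin n) (G : SimpleGraph (Fin n)) : sw a w b v (sw a v b w G) = G := by
  unfold sw; rw [swEdges_comm, symmDiff_symmDiff_cancel_right]

lemma Pat.distinct {Y : SimpleGraph (Fin n)} {a v b w : Fin n} {G : SimpleGraph (Fin n)}
    (h : Pat Y a v b w G) : a ≠ v ∧ b ≠ w ∧ a ≠ w ∧ b ≠ v ∧ v ≠ w ∧ a ≠ b := by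
  obtain ⟨⟨h1, -⟩, ⟨h2, -⟩, h3, h4, h5, h6⟩ := h
  refine ⟨h1.ne, h2.ne, h5, h6, ?_, ?_⟩
  · rintro rfl; exact h3 h1
  · rintro rfl; exact h4 h1

lemma sw_adj (a v b w : Fin n) (G : SimpleGraph (Fin n)) (x y : Fin n) :
    (sw a v b w G).Adj x y ↔
      (G.Adj x y ∧ ¬ (swEdges a v b w).Adj x y) ∨ ((swEdges a v b w).Adj x y ∧ ¬ G.Adj x y) := by
  simp [sw, symmDiff, SimpleGraph.sup_adj, SimpleGraph.sdiff_adj]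

lemma ind_sw_adj {Y : SimpleGraph (Fin n)} {a v b w : Fin n} {G : SimpleGraph (Fin n)}
    (h : Pat Y a v b w G) (x y : Fin n) :
    ind ((sw a v b w G).Adj x y) = ind (G.Adj x y) - eind a v x y - eind b w x y
      + eind a w x y + eind b v x y := by
  obtain ⟨hav, hbw, haw, hbv, hvw, hab⟩ := h.distinct
  obtain ⟨⟨h1, -⟩, ⟨h2, -⟩, h3, h4, h5, h6⟩ := h
  rw [ind_congr (sw_adj a v b w G x y)]
  have h3' : ¬ G.Adj w a := fun h => h3 h.symm
  have h4' : ¬ G.Adj v b := fun h => h4 h.symm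
  simp only [swEdges, SimpleGraph.sup_adj, SimpleGraph.edge_adj, eind]
  by_cases e1 : (x = a ∧ y = v) ∨ (x = v ∧ y = a)
  · rcases e1 with ⟨rfl, rfl⟩ | ⟨rfl, rfl⟩ <;>
    simp [ind, h1, h1.symm, hav, hav.symm, haw, hbv.symm, hvw, hab]
  by_cases e2 : (x = b ∧ y = w) ∨ (x = w ∧ y = b)
  · rcases e2 with ⟨rfl, rfl⟩ | ⟨rfl, rfl⟩ <;>
    simp [ind, h2, h2.symm, hbw, hbw.symm, haw.symm, hbv, hvw.symm, hab.symm]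
  by_cases e3 : (x = a ∧ y = w) ∨ (x = w ∧ y = a)
  · rcases e3 with ⟨rfl, rfl⟩ | ⟨rfl, rfl⟩ <;>
    simp [ind, h3, h3', hav, hbw.symm, haw, haw.symm, hvw.symm, hab]
  by_cases e4 : (x = b ∧ y = v) ∨ (x = v ∧ y = b)
  · rcases e4 with ⟨rfl, rfl⟩ | ⟨rfl, rfl⟩ <;>
    simp [ind, h4, h4', hav.symm, hbw, hbv, hbv.symm, hvw, hab.symm]
  simp [ind, e1, e2, e3, e4]

lemma deg_sw {Y : SimpleGraph (Fin n)} {a v b w : Fin n} {G : SimpleGraph (Fin n)}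
    (h : Pat Y a v b w G) (x : Fin n) : deg (sw a v b w G) x = deg G x := by
  have : (deg (sw a v b w G) x : ℝ) = deg G x := by
    obtain ⟨hav, hbw, haw, hbv, hvw, hab⟩ := h.distinct
    rw [deg_eq_sum, deg_eq_sum]
    simp_rw [ind_sw_adj h]
    rw [sum_add_distrib, sum_add_distrib, sum_sub_distrib, sum_sub_distrib, sum_eind hav,
      sum_eind hbw, sum_eind haw, sum_eind hbv]
    ring
  exact_mod_cast this

lemma Pat.sw_mem {d : Fin n → ℕ} {Y : SimpleGraph (Fin n)} {a v b w : Fin n}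
    {G : SimpleGraph (Fin n)} (hG : G ∈ fam d Y) (h : Pat Y a v b w G) :
    sw a v b w G ∈ fam d Y := by
  rw [mem_fam] at hG ⊢
  refine ⟨fun j => (deg_sw h j).trans (hG.1 j), ?_⟩
  intro x y hxy
  have hg : G.Adj x y := hG.2 hxy
  obtain ⟨⟨h1, h1'⟩, ⟨h2, h2'⟩, h3, h4, h5, h6⟩ := h
  rw [sw_adj]
  left
  refine ⟨hg, ?_⟩
  simp only [swEdges, SimpleGraph.sup_adj, SimpleGraph.edge_adj]
  rintro ((⟨⟨rfl, rfl⟩ | ⟨rfl, rfl⟩, -⟩ | ⟨⟨rfl, rfl⟩ | ⟨rfl, rfl⟩, -⟩) |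
    (⟨⟨rfl, rfl⟩ | ⟨rfl, rfl⟩, -⟩ | ⟨⟨rfl, rfl⟩ | ⟨rfl, rfl⟩, -⟩))
  · exact h1' hxy
  · exact h1' hxy.symm
  · exact h2' hxy
  · exact h2' hxy.symm
  · exact h3 hg
  · exact h3 hg.symm
  · exact h4 hg
  · exact h4 hg.symm

lemma Pat.sw_pat {Y : SimpleGraph (Fin n)} {a v b w : Fin n}
    {G : SimpleGraph (Fin n)} (hG : Y ≤ G) (h : Pat Y a v b w G) :
    Pat Y a w b v (sw a v b w G) := by
  have hd := h.distinct
  obtain ⟨⟨h1, h1'⟩, ⟨h2, h2'⟩, h3, h4, h5, h6⟩ := h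
  simp only [Pat, sw_adj, swEdges, SimpleGraph.sup_adj, SimpleGraph.edge_adj]
  refine ⟨⟨?_, fun h => h3 (hG h)⟩, ⟨?_, fun h => h4 (hG h)⟩, ?_, ?_, hd.1, hd.2.1⟩
  · right; simp [h3, hd]
  · right; simp [h4, hd]
  · simp [h1, hd]
  · simp [h2, hd]

lemma sum_sw (d : Fin n → ℕ) (Y : SimpleGraph (Fin n)) (a v b w : Fin n)
    (f : SimpleGraph (Fin n) → ℝ) :
    ∑ G ∈ fam d Y, ind (Pat Y a v b w G) * f (sw a v b w G)
      = ∑ G ∈ fam d Y, ind (Pat Y a w b v G) * f G := by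
  have e : ∀ (p : SimpleGraph (Fin n) → Prop) (g : SimpleGraph (Fin n) → ℝ),
      ∑ G ∈ fam d Y, ind (p G) * g G = ∑ G ∈ (fam d Y).filter p, g G := by
    intro p g
    rw [sum_filter]
    exact sum_congr rfl fun G _ => by simp [ind]
  rw [e, e (fun G => Pat Y a w b v G)]
  refine sum_nbij' (sw a v b w) (sw a w b v) ?_ ?_ ?_ ?_ ?_
  · intro G hG
    rw [mem_filter] at hG ⊢
    exact ⟨hG.2.sw_mem hG.1, hG.2.sw_pat (mem_fam.1 hG.1).2⟩
  · intro G hG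
    rw [mem_filter] at hG ⊢
    exact ⟨hG.2.sw_mem hG.1, hG.2.sw_pat (mem_fam.1 hG.1).2⟩
  · intro G _; exact sw_sw a v b w G
  · intro G _; exact sw_sw a w b v G
  · intro G _; rfl

lemma mean_sw (d : Fin n → ℕ) (Y : SimpleGraph (Fin n)) (a v b w : Fin n)
    (f : SimpleGraph (Fin n) → ℝ) :
    mean d Y (fun G => ind (Pat Y a v b w G) * f (sw a v b w G))
      = mean d Y (fun G => ind (Pat Y a w b v G) * f G) := by
  unfold mean; rw [sum_sw]

end Switching

section Identity

open Finset

variable {n : ℕ}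

/-- Indicator that `v` can be moved from the neighbourhood of `a` to that of `b`. -/
noncomputable def mv (Y : SimpleGraph (Fin n)) (a b v : Fin n) (G : SimpleGraph (Fin n)) : ℝ :=
  ind ((G.Adj a v ∧ ¬ Y.Adj a v) ∧ ¬ G.Adj b v ∧ v ≠ b)

/-- Indicator that `v` can be moved in one of the two directions. -/
noncomputable def sig (Y : SimpleGraph (Fin n)) (a b v : Fin n) (G : SimpleGraph (Fin n)) : ℝ :=
  mv Y a b v G + mv Y b a v G

/-- Number of vertices that can be moved from `a` to `b`. -/
noncomputable def mvs (Y : SimpleGraph (Fin n)) (a b : Fin n) (G : SimpleGraph (Fin n)) : ℝ :=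
  ∑ v, mv Y a b v G

/-- Number of vertices that can be moved. -/
noncomputable def ssum (Y : SimpleGraph (Fin n)) (a b : Fin n) (G : SimpleGraph (Fin n)) : ℝ :=
  mvs Y a b G + mvs Y b a G

variable (Y : SimpleGraph (Fin n)) (a b v w : Fin n) (G : SimpleGraph (Fin n))

lemma mv_nonneg : 0 ≤ mv Y a b v G := ind_nonneg _

lemma mv_le_one : mv Y a b v G ≤ 1 := ind_le_one _

lemma sig_nonneg : 0 ≤ sig Y a b v G := add_nonneg (mv_nonneg ..) (mv_nonneg ..)

lemma mvs_nonneg : 0 ≤ mvs Y a b G := sum_nonneg fun _ _ => mv_nonneg ..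

lemma ssum_nonneg : 0 ≤ ssum Y a b G := add_nonneg (mvs_nonneg ..) (mvs_nonneg ..)

lemma ssum_eq : ssum Y a b G = ∑ v, sig Y a b v G := by
  simp [ssum, mvs, sig, sum_add_distrib]

lemma mv_mul_mv : mv Y a b v G * mv Y b a v G = 0 := by
  unfold mv
  rw [← ind_and]
  exact ind_false fun h => h.1.2.1 h.2.1.1

lemma sig_le_one : sig Y a b v G ≤ 1 := by
  unfold sig mv ind
  split_ifs with h1 h2 <;> norm_num
  exact h1.2.1 h2.1.1

lemma mv_le_mvs : mv Y a b v G ≤ mvs Y a b G :=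
  single_le_sum (f := fun v => mv Y a b v G) (fun _ _ => mv_nonneg ..) (mem_univ v)

lemma sig_le_ssum : sig Y a b v G ≤ ssum Y a b G :=
  add_le_add (mv_le_mvs ..) (mv_le_mvs ..)

lemma ssum_le : ssum Y a b G ≤ n := by
  have : ssum Y a b G ≤ ∑ _v : Fin n, (1 : ℝ) := by
    rw [ssum_eq]; exact sum_le_sum fun _ _ => sig_le_one ..
  simpa using this

lemma ind_pat : ind (Pat Y a v b w G) = mv Y a b v G * mv Y b a w G := by
  unfold mv
  rw [← ind_and]
  refine ind_congr ?_
  unfold Pat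
  have : ∀ x y : Fin n, x ≠ y ↔ y ≠ x := fun x y => ne_comm
  rw [this a w, this b v]
  tauto

variable {Y a b v w G}

lemma mv_eq (hY : Y ≤ G) (h : v ≠ b) :
    mv Y a b v G = (ind (G.Adj a v) - ind (Y.Adj a v)) * (1 - ind (G.Adj b v)) := by
  unfold mv ind
  by_cases h1 : Y.Adj a v
  · simp [h1, hY h1]
  · by_cases h2 : G.Adj a v <;> by_cases h3 : G.Adj b v <;> simp [h1, h2, h3, h]

lemma mv_self : mv Y a b b G = 0 := ind_false fun h => h.2.2 rfl

lemma mv_self' : mv Y a b a G = 0 := ind_false fun h => h.1.1.ne rfl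

lemma sw_adj_of_ne {x y : Fin n} (h : ¬ (swEdges a v b w).Adj x y) :
    (sw a v b w G).Adj x y ↔ G.Adj x y := by
  rw [sw_adj]; tauto

lemma sig_sw (hY : Y ≤ G) (h : Pat Y a v b w G) (x : Fin n) :
    sig Y a b x (sw a v b w G) = sig Y a b x G := by
  have hd := h.distinct
  have hp := h.sw_pat hY
  have h1 := ind_pat Y a b v w G
  have h2 := ind_pat Y a b w v (sw a v b w G)
  rw [ind_true h] at h1
  rw [ind_true hp] at h2
  have one : ∀ {s t : ℝ}, 0 ≤ s → s ≤ 1 → 0 ≤ t → t ≤ 1 → 1 = s * t → s = 1 ∧ t = 1 := by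
    intro s t hs hs' ht ht' e
    constructor <;> nlinarith
  obtain ⟨e1, e2⟩ := one (mv_nonneg ..) (mv_le_one ..) (mv_nonneg ..) (mv_le_one ..) h1
  obtain ⟨e3, e4⟩ := one (mv_nonneg ..) (mv_le_one ..) (mv_nonneg ..) (mv_le_one ..) h2
  by_cases hxv : x = v
  · subst hxv
    have i1 := mv_mul_mv Y a b x G
    have i2 := mv_mul_mv Y a b x (sw a x b w G)
    rw [e1] at i1; rw [e4] at i2
    unfold sig; rw [e1, e4]; linarith
  by_cases hxw : x = w
  · subst hxw
    have i1 := mv_mul_mv Y a b x G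
    have i2 := mv_mul_mv Y a b x (sw a v b x G)
    rw [e2] at i1; rw [e3] at i2
    unfold sig; rw [e2, e3]; linarith
  · have k1 : (sw a v b w G).Adj a x ↔ G.Adj a x := by
      refine sw_adj_of_ne ?_
      simp only [swEdges, SimpleGraph.sup_adj, SimpleGraph.edge_adj]
      grind
    have k2 : (sw a v b w G).Adj b x ↔ G.Adj b x := by
      refine sw_adj_of_ne ?_
      simp only [swEdges, SimpleGraph.sup_adj, SimpleGraph.edge_adj]
      grind
    simp only [sig, mv, k1, k2]

lemma ssum_sw (hY : Y ≤ G) (h : Pat Y a v b w G) :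
    ssum Y a b (sw a v b w G) = ssum Y a b G := by
  rw [ssum_eq, ssum_eq]
  exact sum_congr rfl fun x _ => sig_sw hY h x

variable (d : Fin n → ℕ) (Y a b v)

lemma mean_mv_mul :
    mean d Y (fun G => mv Y a b v G * mvs Y b a G / ssum Y a b G)
      = mean d Y (fun G => mv Y b a v G * mvs Y a b G / ssum Y a b G) := by
  have e1 : ∀ G, mv Y a b v G * mvs Y b a G / ssum Y a b G
      = ∑ w, ind (Pat Y a v b w G) * (1 / ssum Y a b G) := by
    intro G
    simp_rw [ind_pat, ← sum_mul, ← mul_sum]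
    rw [mvs]; ring
  have e2 : ∀ G, mv Y b a v G * mvs Y a b G / ssum Y a b G
      = ∑ w, ind (Pat Y a w b v G) * (1 / ssum Y a b G) := by
    intro G
    simp_rw [ind_pat, ← sum_mul]
    rw [mvs]; ring
  simp_rw [e1, e2, mean_sum]
  refine sum_congr rfl fun w _ => ?_
  rw [← mean_sw]
  refine mean_congr fun G hG => ?_
  by_cases h : Pat Y a w b v G
  · rw [ssum_sw (mem_fam.1 hG).2 h]
  · rw [ind_false h]; ring

/-- The basic switching identity. -/
lemma mean_mv_sub :
    mean d Y (fun G => mv Y a b v G - mv Y b a v G)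
      = mean d Y (fun G => sig Y a b v G * (mvs Y a b G - mvs Y b a G) / ssum Y a b G) := by
  have h := mean_mv_mul Y a b v d
  have e : mean d Y (fun G => mv Y a b v G - mv Y b a v G)
      = mean d Y (fun G => sig Y a b v G * (mvs Y a b G - mvs Y b a G) / ssum Y a b G)
      + 2 * (mean d Y (fun G => mv Y a b v G * mvs Y b a G / ssum Y a b G)
      - mean d Y (fun G => mv Y b a v G * mvs Y a b G / ssum Y a b G)) := by
    rw [← mean_sub, ← mean_const_mul, ← mean_add]
    refine mean_congr fun G _ => ?_
    rcases (ssum_nonneg Y a b G).eq_or_lt with h0 | h0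
    · have h1 := sig_le_ssum Y a b v G
      have h2 := mv_nonneg Y a b v G
      have h3 := mv_nonneg Y b a v G
      unfold sig at *
      have : mv Y a b v G = 0 := by linarith
      have h' : mv Y b a v G = 0 := by linarith
      simp [this, h']
    · have : ssum Y a b G ≠ 0 := h0.ne'
      field_simp
      unfold ssum sig
      ring
  rw [e, h]; ring

variable {a b v}

lemma pr_sub_pr (hva : v ≠ a) (hvb : v ≠ b) (hav : ¬ Y.Adj a v) (hbv : ¬ Y.Adj b v) :
    pr d Y a v - pr d Y b v
      = mean d Y (fun G => sig Y a b v G * (mvs Y a b G - mvs Y b a G) / ssum Y a b G) := by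
  rw [← mean_mv_sub, pr, pr, ← mean_sub]
  refine mean_congr fun G hG => ?_
  have hY := (mem_fam.1 hG).2
  rw [mv_eq hY hvb, mv_eq hY hva, ind_false hav, ind_false hbv]
  ring

variable {Y d}

lemma mvs_sub_mvs (hab : a ≠ b) {G : SimpleGraph (Fin n)} (hG : G ∈ fam d Y) :
    mvs Y a b G - mvs Y b a G = ((d a : ℝ) - deg Y a) - ((d b : ℝ) - deg Y b)
      + ∑ x, ind (Y.Adj a x) * ind (G.Adj b x) - ∑ x, ind (Y.Adj b x) * ind (G.Adj a x) := by
  obtain ⟨hd, hY⟩ := mem_fam.1 hG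
  have key : ∀ x, mv Y a b x G - mv Y b a x G =
      ((ind (G.Adj a x) - ind (Y.Adj a x)) - (ind (G.Adj b x) - ind (Y.Adj b x))
      + ind (Y.Adj a x) * ind (G.Adj b x) - ind (Y.Adj b x) * ind (G.Adj a x))
      - ind (x = b) * (ind (G.Adj a b) - ind (Y.Adj a b))
      + ind (x = a) * (ind (G.Adj a b) - ind (Y.Adj a b)) := by
    intro x
    by_cases hxa : x = a
    · subst hxa
      rw [mv_self, mv_self', ind_false hab, ind_true rfl, ind_adj_comm G b x, ind_adj_comm Y b x]
      simp [ind]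
    by_cases hxb : x = b
    · subst hxb
      rw [mv_self, mv_self', ind_false (Ne.symm hab), ind_true rfl]
      simp [ind]
    rw [mv_eq hY hxb, mv_eq hY hxa, ind_false hxa, ind_false hxb]
    ring
  unfold mvs
  rw [← sum_sub_distrib]
  simp_rw [key]
  rw [sum_add_distrib, sum_sub_distrib, sum_ind_eq_mul, sum_ind_eq_mul, sum_sub_distrib,
    sum_add_distrib, sum_sub_distrib, sum_sub_distrib, sum_sub_distrib, ← deg_eq_sum, ← deg_eq_sum,
    ← deg_eq_sum, ← deg_eq_sum, hd a, hd b]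
  ring

lemma sum_pr (h : (fam d Y).Nonempty) (v : Fin n) : ∑ a, pr d Y a v = d v := by
  unfold pr
  rw [← mean_sum, ← mean_const h (d v : ℝ)]
  refine mean_congr fun G hG => ?_
  rw [← (mem_fam.1 hG).1 v, deg_eq_sum]
  exact sum_congr rfl fun x _ => ind_adj_comm G x v

lemma pr_of_adj (h : (fam d Y).Nonempty) {x z : Fin n} (hxz : Y.Adj x z) : pr d Y x z = 1 := by
  rw [pr, ← mean_const h (1 : ℝ)]
  exact mean_congr fun G hG => ind_true ((mem_fam.1 hG).2 hxz)

lemma sum_pr_of_not_adj (h : (fam d Y).Nonempty) (v : Fin n) :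
    ∑ a, (1 - ind (Y.Adj a v)) * pr d Y a v = d v - deg Y v := by
  rw [← sum_pr h v, deg_eq_sum, ← sum_sub_distrib]
  refine sum_congr rfl fun x _ => ?_
  rw [ind_adj_comm Y v x]
  by_cases hx : Y.Adj x v
  · rw [ind_true hx, pr_of_adj h hx]; ring
  · rw [ind_false hx]; ring

end Identity

section Tail

open Finset

/-- Standing assumptions in the dense range; `L` absorbs constants and polylogarithmic factors. -/
structure Dense (n : ℕ) (L lm q : ℝ) (d : Fin n → ℕ) : Prop where
  hL : 1000 ≤ L
  hq0 : 0 < q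
  hq : q ^ 2 = n
  hLq : L ^ 100 ≤ q
  hlm : 1 / L ≤ lm
  hlm' : 1 / L ≤ 1 - lm
  hd : ∀ j, |(d j : ℝ) - lm * (n - 1)| ≤ L * q
  hsum : ∑ j, (d j : ℝ) = lm * n * (n - 1)
  hne : (fam d (⊥ : SimpleGraph (Fin n))).Nonempty

variable {n : ℕ}

/-- Maximum degree at most `D`. -/
def DegLE (Y : SimpleGraph (Fin n)) (D : ℝ) : Prop := ∀ j, (deg Y j : ℝ) ≤ D

namespace Dense

variable {L lm q : ℝ} {d : Fin n → ℕ}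

lemma L_pos (h : Dense n L lm q d) : 0 < L := by linarith [h.hL]

lemma pow_le (h : Dense n L lm q d) {k : ℕ} (hk : k ≤ 100) : L ^ k ≤ q :=
  (pow_le_pow_right₀ (by linarith [h.hL]) hk).trans h.hLq

lemma lm_pos (h : Dense n L lm q d) : 0 < lm := lt_of_lt_of_le (by have := h.L_pos; positivity) h.hlm

lemma lm_lt (h : Dense n L lm q d) : lm < 1 := by
  have := h.L_pos
  have h1 : 0 < 1 / L := by positivity
  linarith [h.hlm']

lemma q_large (h : Dense n L lm q d) : 1000 ≤ q := by
  have := h.pow_le (k := 1) (by norm_num)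
  linarith [h.hL]

lemma d_lower (h : Dense n L lm q d) (j : Fin n) : (n : ℝ) / (2 * L) ≤ d j := by
  have h1 := (abs_le.1 (h.hd j)).1
  have hq := h.hq
  have hL := h.hL
  have h2 := h.pow_le (k := 3) (by norm_num)
  have hlm : 1 ≤ lm * L := by
    have := h.hlm; rwa [div_le_iff₀ h.L_pos] at this
  have hq0 := h.hq0
  rw [div_le_iff₀ (by linarith)]
  have e1 : (lm * L) * (n - 1) ≥ 1 * (n - 1 : ℝ) :=
    mul_le_mul_of_nonneg_right hlm (by rw [← hq]; nlinarith [h.q_large])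
  have e2 : L * q * L ≤ q * q / 1000 := by
    have : L * L * 1000 ≤ q := by nlinarith
    nlinarith
  have e3 : (d j : ℝ) * L ≥ (lm * (n - 1) - L * q) * L :=
    mul_le_mul_of_nonneg_right (by linarith) (by linarith)
  nlinarith [h.q_large]

lemma d_upper (h : Dense n L lm q d) (j : Fin n) : (n : ℝ) / (2 * L) ≤ n - 1 - d j := by
  have h1 := (abs_le.1 (h.hd j)).2
  have hq := h.hq
  have hL := h.hL
  have h2 := h.pow_le (k := 3) (by norm_num)
  have hlm : 1 ≤ (1 - lm) * L := by
    have := h.hlm'; rwa [div_le_iff₀ h.L_pos] at this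
  have hq0 := h.hq0
  rw [div_le_iff₀ (by linarith)]
  have e1 : ((1 - lm) * L) * (n - 1) ≥ 1 * (n - 1 : ℝ) :=
    mul_le_mul_of_nonneg_right hlm (by rw [← hq]; nlinarith [h.q_large])
  have e2 : L * q * L ≤ q * q / 1000 := by
    have : L * L * 1000 ≤ q := by nlinarith
    nlinarith
  have e3 : (n - 1 - d j : ℝ) * L ≥ ((1 - lm) * (n - 1) - L * q) * L :=
    mul_le_mul_of_nonneg_right (by linarith) (by linarith)
  nlinarith [h.q_large]

lemma d_sub (h : Dense n L lm q d) (i j : Fin n) : (d i : ℝ) - d j ≤ 2 * L * q := by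
  have h1 := (abs_le.1 (h.hd i)).2
  have h2 := (abs_le.1 (h.hd j)).1
  linarith

end Dense

variable {L lm q : ℝ} {d : Fin n → ℕ} {Y G : SimpleGraph (Fin n)}

lemma sum_ind_mul_le (Y G : SimpleGraph (Fin n)) (a b : Fin n) :
    ∑ x, ind (Y.Adj a x) * ind (G.Adj b x) ≤ deg Y a := by
  rw [deg_eq_sum]
  exact sum_le_sum fun x _ => mul_le_of_le_one_right (ind_nonneg _) (ind_le_one _)

lemma sum_ind_mul_nonneg (Y G : SimpleGraph (Fin n)) (a b : Fin n) :
    0 ≤ ∑ x, ind (Y.Adj a x) * ind (G.Adj b x) :=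
  sum_nonneg fun _ _ => mul_nonneg (ind_nonneg _) (ind_nonneg _)

lemma abs_mvs_sub (h : Dense n L lm q d) (hY : DegLE Y L) {a b : Fin n} (hab : a ≠ b)
    (hG : G ∈ fam d Y) : |mvs Y a b G - mvs Y b a G| ≤ 2 * L * q + 2 * L := by
  rw [mvs_sub_mvs hab hG]
  have h1 := h.d_sub a b
  have h2 := h.d_sub b a
  have h3 := sum_ind_mul_le Y G a b
  have h4 := sum_ind_mul_le Y G b a
  have h5 := sum_ind_mul_nonneg Y G a b
  have h6 := sum_ind_mul_nonneg Y G b a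
  have h7 := hY a
  have h8 := hY b
  have h9 : (0:ℝ) ≤ deg Y a := Nat.cast_nonneg _
  have h10 : (0:ℝ) ≤ deg Y b := Nat.cast_nonneg _
  rw [abs_le]; constructor <;> linarith

lemma ind_le_ind {p r : Prop} (h : p → r) : ind p ≤ ind r := by
  by_cases hp : p
  · rw [ind_true hp, ind_true (h hp)]
  · rw [ind_false hp]; exact ind_nonneg _

lemma ind_or_le (p r : Prop) : ind (p ∨ r) ≤ ind p + ind r := by
  by_cases hp : p
  · rw [ind_true (Or.inl hp), ind_true hp]; linarith [ind_nonneg r]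
  · rw [ind_false hp, zero_add]; exact ind_le_ind fun h => h.resolve_left hp

lemma ind_le_sum_five {p r₁ r₂ r₃ r₄ r₅ r₆ : Prop}
    (h : p → r₁ ∨ r₂ ∨ r₃ ∨ r₄ ∨ r₅ ∨ r₆) :
    ind p ≤ ind r₁ + ind r₂ + ind r₃ + ind r₄ + ind r₅ + ind r₆ := by
  have h0 := ind_le_ind h
  have h1 := ind_or_le r₁ (r₂ ∨ r₃ ∨ r₄ ∨ r₅ ∨ r₆)
  have h2 := ind_or_le r₂ (r₃ ∨ r₄ ∨ r₅ ∨ r₆)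
  have h3 := ind_or_le r₃ (r₄ ∨ r₅ ∨ r₆)
  have h4 := ind_or_le r₄ (r₅ ∨ r₆)
  have h5 := ind_or_le r₅ r₆
  linarith

set_option maxHeartbeats 1000000 in
/-- Number of triples giving a switching that increases `mvs Y a b` by one. -/
lemma forward_count (h : Dense n L lm q d) (hY : DegLE Y L) {a b : Fin n} (hab : a ≠ b)
    (hG : G ∈ fam d Y) (hk : mvs Y a b G ≤ n / L ^ 3) :
    (n : ℝ) ^ 3 / (64 * L ^ 4) ≤ ∑ b', ∑ v, ∑ w, ind (Pat Y b v b' w G) *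
      ind (b' ≠ a ∧ (G.Adj a v ∧ ¬ Y.Adj a v) ∧ ¬ G.Adj a w ∧ w ≠ a) := by
  set VV : Fin n → Fin n → ℝ := fun b' v =>
    ind ((G.Adj b v ∧ ¬ Y.Adj b v) ∧ (G.Adj a v ∧ ¬ Y.Adj a v) ∧ ¬ G.Adj b' v ∧ b' ≠ v) with hVV
  set WW : Fin n → Fin n → ℝ := fun b' w =>
    ind ((G.Adj b' w ∧ ¬ Y.Adj b' w) ∧ ¬ G.Adj b w ∧ ¬ G.Adj a w ∧ w ≠ a ∧ b ≠ w) with hWW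
  obtain ⟨hdeg, hYG⟩ := mem_fam.1 hG
  have step1 : ∀ b' v w, ind (Pat Y b v b' w G) *
      ind (b' ≠ a ∧ (G.Adj a v ∧ ¬ Y.Adj a v) ∧ ¬ G.Adj a w ∧ w ≠ a)
      = ind (b' ≠ a) * (VV b' v * WW b' w) := by
    intro b' v w
    rw [← ind_and, hVV, hWW, ← ind_and, ← ind_and]
    refine ind_congr ?_
    unfold Pat
    tauto
  simp_rw [step1, ← mul_sum, ← sum_mul]
  set t : ℝ := n / L ^ 3 + 5 * L * q with ht
  set u : Fin n → ℝ := fun b' => ∑ v, ind (G.Adj b' v) * (1 - ind (G.Adj b v)) - t with hu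
  have hLq := h.pow_le (k := 5) (by norm_num)
  have hL := h.hL
  have hq0 := h.hq0
  have hq := h.hq
  have hmv := (abs_le.1 (abs_mvs_sub h hY hab hG)).1
  have hya := hY a
  have hyb := hY b
  have hq1 := h.q_large
  have hLq2 : 1000 * L ≤ L * q := by rw [mul_comm]; gcongr
  have hV : ∀ b', u b' ≤ ∑ v, VV b' v := by
    intro b'
    have pt : ∀ v, ind (G.Adj b v) - ind (G.Adj b' v) + ind (G.Adj b' v) * (1 - ind (G.Adj b v))
        - ind (Y.Adj b v) - ind (Y.Adj a v) - mv Y b a v G - ind (v = a) - ind (v = b')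
        ≤ VV b' v := by
      intro v
      have h1 : ind (G.Adj b v ∧ ¬ G.Adj b' v) ≤ VV b' v + ind (Y.Adj b v) + ind (Y.Adj a v)
          + mv Y b a v G + ind (v = a) + ind (v = b') := by
        refine ind_le_sum_five fun h => ?_
        by_cases e : v = b'
        · tauto
        · have : b' ≠ v := fun h => e h.symm
          tauto
      rw [ind_and, ind_not] at h1
      linarith
    have := sum_le_sum fun v (_ : v ∈ (univ : Finset (Fin n))) => pt v
    simp only [sum_sub_distrib, sum_add_distrib, sum_ind_eq, ← deg_eq_sum, hdeg] at this
    have hdd := h.d_sub b' b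
    have e : ∑ v, mv Y b a v G = mvs Y b a G := rfl
    rw [e] at this
    simp only [hu, ht]
    linarith
  have hW : ∀ b', u b' ≤ ∑ w, WW b' w := by
    intro b'
    have pt : ∀ w, ind (G.Adj b' w) * (1 - ind (G.Adj b w))
        - ind (Y.Adj b' w) - ind (Y.Adj a w) - mv Y a b w G - ind (w = a) - ind (w = b)
        ≤ WW b' w := by
      intro v
      have h1 : ind (G.Adj b' v ∧ ¬ G.Adj b v) ≤ WW b' v + ind (Y.Adj b' v) + ind (Y.Adj a v)
          + mv Y a b v G + ind (v = a) + ind (v = b) := by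
        refine ind_le_sum_five fun h => ?_
        by_cases e : v = b
        · tauto
        · have : b ≠ v := fun h => e h.symm
          tauto
      rw [ind_and, ind_not] at h1
      linarith
    have := sum_le_sum fun v (_ : v ∈ (univ : Finset (Fin n))) => pt v
    simp only [sum_sub_distrib, sum_ind_eq, ← deg_eq_sum] at this
    have e : ∑ v, mv Y a b v G = mvs Y a b G := rfl
    rw [e] at this
    simp only [hu, ht]
    have hyb' := hY b'
    linarith
  have hV0 : ∀ b', 0 ≤ ∑ v, VV b' v := fun b' => sum_nonneg fun v _ => ind_nonneg _
  have hW0 : ∀ b', 0 ≤ ∑ v, WW b' v := fun b' => sum_nonneg fun v _ => ind_nonneg _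
  set x : Fin n → ℝ := fun b' => ind (b' ≠ a) * max 0 (u b') with hx
  have hx2 : ∀ b', x b' ^ 2 ≤ ind (b' ≠ a) * ((∑ v, VV b' v) * ∑ w, WW b' w) := by
    intro b'
    have : x b' ^ 2 = ind (b' ≠ a) * (max 0 (u b') * max 0 (u b')) := by
      rw [hx, ← ind_sq (b' ≠ a)]; simp only [ind_sq]; rw [mul_pow, pow_two, ind_sq, pow_two]
    rw [this]
    refine mul_le_mul_of_nonneg_left ?_ (ind_nonneg _)
    exact mul_le_mul (max_le (hV0 _) (hV _)) (max_le (hW0 _) (hW _)) (le_max_left _ _) (hV0 _)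
  have hcs : (∑ b', x b') ^ 2 ≤ n * ∑ b', x b' ^ 2 := by
    have := sq_sum_le_card_mul_sum_sq (s := (univ : Finset (Fin n))) (f := x)
    simpa using this
  have hub : ∀ b', u b' ≤ n := by
    intro b'
    have : ∑ v, ind (G.Adj b' v) * (1 - ind (G.Adj b v)) ≤ ∑ _v : Fin n, (1 : ℝ) :=
      sum_le_sum fun v _ => mul_le_one₀ (ind_le_one _) (by linarith [ind_le_one (G.Adj b v)])
        (by linarith [ind_nonneg (G.Adj b v)])
    have e : 0 ≤ t := by have := h.L_pos; positivity
    simp only [sum_const, card_univ, Fintype.card_fin, nsmul_eq_mul, mul_one] at this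
    simp only [hu]; linarith
  have hxs : ∑ b', (u b' - ind (b' = a) * n) ≤ ∑ b', x b' := by
    refine sum_le_sum fun b' _ => ?_
    simp only [hx, ind]
    by_cases hb : b' = a
    · simp [hb]; simpa [hb] using hub a
    · simp [hb]
  have hsu : ∑ b', (u b' - ind (b' = a) * n) = ∑ v, (1 - ind (G.Adj b v)) * d v - n * t - n := by
    rw [sum_sub_distrib, sum_ind_eq_mul]
    simp only [hu]
    rw [sum_sub_distrib, sum_comm]
    simp only [sum_const, card_univ, Fintype.card_fin, nsmul_eq_mul]
    congr 2
    refine sum_congr rfl fun v _ => ?_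
    rw [← sum_mul, ← hdeg v, deg_eq_sum, mul_comm]
    simp_rw [ind_adj_comm G v]
  have hlow : (n / (2 * L)) * (n / (2 * L)) ≤ ∑ v, (1 - ind (G.Adj b v)) * (d v : ℝ) := by
    have e1 : ∑ v, (1 - ind (G.Adj b v)) * (n / (2 * L) : ℝ) ≤
        ∑ v, (1 - ind (G.Adj b v)) * (d v : ℝ) :=
      sum_le_sum fun v _ => mul_le_mul_of_nonneg_left (h.d_lower v)
        (by linarith [ind_le_one (G.Adj b v)])
    refine le_trans ?_ e1
    rw [← sum_mul, sum_sub_distrib, ← deg_eq_sum, hdeg]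
    simp only [sum_const, card_univ, Fintype.card_fin, nsmul_eq_mul, mul_one]
    have := h.L_pos
    refine mul_le_mul_of_nonneg_right ?_ (by positivity)
    linarith [h.d_upper b]
  have hS : (n : ℝ) ^ 2 / (8 * L ^ 2) ≤ ∑ b', x b' := by
    refine le_trans ?_ hxs
    rw [hsu]
    refine le_trans ?_ (sub_le_sub_right (sub_le_sub_right hlow _) _)
    rw [ht, ← hq]
    have hL0 := h.L_pos
    rw [show (q^2/(2*L)) * (q^2/(2*L)) - q^2 * (q^2/L^3 + 5*L*q) - q^2
      = (q^4 * L / 4 - q^4 - 5 * L^4 * q^3 - q^2 * L^3) / L^3 by field_simp; ring]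
    rw [div_le_div_iff₀ (by positivity) (by positivity)]
    have f1 : L ^ 4 * q ^ 3 ≤ q ^ 4 := by
      have : L ^ 4 ≤ q := h.pow_le (by norm_num)
      calc L ^ 4 * q ^ 3 ≤ q * q ^ 3 := by gcongr
        _ = q ^ 4 := by ring
    have f2 : q ^ 2 * L ^ 3 ≤ q ^ 4 := by
      have : L ^ 3 ≤ q := h.pow_le (by norm_num)
      calc q ^ 2 * L ^ 3 ≤ q ^ 2 * q ^ 2 := by gcongr; nlinarith
        _ = q ^ 4 := by ring
    have f3 : 1000 * q ^ 4 ≤ q ^ 4 * L := by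
      have : 0 ≤ q ^ 4 := by positivity
      nlinarith
    have : 0 ≤ L ^ 2 := by positivity
    have g : q ^ 4 * L ≤ 8 * (q ^ 4 * L / 4 - q ^ 4 - 5 * L ^ 4 * q ^ 3 - q ^ 2 * L ^ 3) := by
      nlinarith
    calc (q ^ 2) ^ 2 * L ^ 3 = q ^ 4 * L * L ^ 2 := by ring
      _ ≤ 8 * (q ^ 4 * L / 4 - q ^ 4 - 5 * L ^ 4 * q ^ 3 - q ^ 2 * L ^ 3) * L ^ 2 := by gcongr
      _ = _ := by ring
  have hn : (0 : ℝ) < n := by rw [← hq]; positivity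
  have hL0 := h.L_pos
  calc (n : ℝ) ^ 3 / (64 * L ^ 4) = ((n : ℝ) ^ 2 / (8 * L ^ 2)) ^ 2 / n := by field_simp; norm_num
    _ ≤ (∑ b', x b') ^ 2 / n := by gcongr
    _ ≤ ∑ b', x b' ^ 2 := by rw [div_le_iff₀ hn]; linarith
    _ ≤ _ := sum_le_sum fun b' _ => hx2 b'

end Tail

section Tail

open Finset

variable {n : ℕ} {L lm q : ℝ} {d : Fin n → ℕ} {Y G : SimpleGraph (Fin n)}

lemma mvs_eq_card (Y : SimpleGraph (Fin n)) (a b : Fin n) (G : SimpleGraph (Fin n)) :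
    ∃ k : ℕ, mvs Y a b G = k := ⟨_, sum_ind _ _⟩

/-- Side condition on the switchings that increase `mvs Y a b`. -/
def Side (Y : SimpleGraph (Fin n)) (a b' v w : Fin n) (G : SimpleGraph (Fin n)) : Prop :=
  b' ≠ a ∧ (G.Adj a v ∧ ¬ Y.Adj a v) ∧ ¬ G.Adj a w ∧ w ≠ a

lemma sw_raise (hY : Y ≤ G) {a b b' v w : Fin n} (hab : a ≠ b) (hP : Pat Y b v b' w G)
    (hS : Side Y a b' v w G ∨ Side Y a b' v w (sw b v b' w G)) :
    (Side Y a b' v w G ∧ Side Y a b' v w (sw b v b' w G)) ∧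
      mvs Y a b (sw b v b' w G) = mvs Y a b G + 1 := by
  obtain ⟨h1, h2, h3, h4, h5, h6⟩ := hP.distinct
  have hb'a : b' ≠ a := by rcases hS with h | h <;> exact h.1
  have hwa : w ≠ a := by rcases hS with h | h <;> exact h.2.2.2
  have hva : v ≠ a := by
    rcases hS with h | h
    · exact h.2.1.1.ne'
    · exact h.2.1.1.ne'
  have ha : ∀ x, (sw b v b' w G).Adj a x ↔ G.Adj a x := by
    intro x
    refine sw_adj_of_ne ?_
    simp only [swEdges, SimpleGraph.sup_adj, SimpleGraph.edge_adj]
    grind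
  have hb : ∀ x, x ≠ v → x ≠ w → ((sw b v b' w G).Adj b x ↔ G.Adj b x) := by
    intro x hxv hxw
    refine sw_adj_of_ne ?_
    simp only [swEdges, SimpleGraph.sup_adj, SimpleGraph.edge_adj]
    grind
  have hiff : Side Y a b' v w G ↔ Side Y a b' v w (sw b v b' w G) := by
    simp only [Side, ha]
  have hSG : Side Y a b' v w G := by tauto
  have hP' := hP.sw_pat hY
  refine ⟨⟨hSG, hiff.1 hSG⟩, ?_⟩
  have : ∀ x, mv Y a b x (sw b v b' w G) = mv Y a b x G + ind (x = v) := by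
    intro x
    by_cases hxv : x = v
    · subst hxv
      rw [ind_true rfl]
      have e1 : mv Y a b x (sw b x b' w G) = 1 := by
        refine ind_true ⟨⟨(ha x).2 hSG.2.1.1, hSG.2.1.2⟩, ?_, h1.symm⟩
        exact hP'.2.2.1
      have e2 : mv Y a b x G = 0 := ind_false fun h => h.2.1 hP.1.1
      rw [e1, e2]; norm_num
    · rw [ind_false hxv, add_zero]
      by_cases hxw : x = w
      · subst hxw
        have e1 : mv Y a b x (sw b v b' x G) = 0 :=
          ind_false fun h => hSG.2.2.1 ((ha x).1 h.1.1)
        have e2 : mv Y a b x G = 0 := ind_false fun h => hSG.2.2.1 h.1.1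
        rw [e1, e2]
      · simp only [mv, ha, hb x hxv hxw]
  unfold mvs
  simp_rw [this, sum_add_distrib, sum_ind_eq]

lemma level_count (h : Dense n L lm q d) (hY : DegLE Y L) {a b : Fin n} (hab : a ≠ b)
    (k : ℕ) (hk : (k : ℝ) ≤ n / L ^ 3) :
    ∑ G ∈ fam d Y, ind (mvs Y a b G = k) ≤
      (1 / 2) * ∑ G ∈ fam d Y, ind (mvs Y a b G = (k + 1 : ℕ)) := by
  have lower : ∑ G ∈ fam d Y, ind (mvs Y a b G = k) * ((n : ℝ) ^ 3 / (64 * L ^ 4)) ≤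
      ∑ G ∈ fam d Y, ∑ b', ∑ v, ∑ w,
        ind (Pat Y b v b' w G) * (ind (Side Y a b' v w G) * ind (mvs Y a b G = k)) := by
    refine sum_le_sum fun G hG => ?_
    simp_rw [← mul_assoc, ← sum_mul]
    rw [mul_comm]
    by_cases hGk : mvs Y a b G = k
    · rw [ind_true hGk, mul_one, mul_one]
      exact forward_count h hY hab hG (hGk ▸ hk)
    · rw [ind_false hGk]; simp
  have upper : ∑ G ∈ fam d Y, ∑ b', ∑ v, ∑ w,
        ind (Pat Y b w b' v G) * (ind (Side Y a b' v w G) * ind (mvs Y a b G = (k + 1 : ℕ)))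
      ≤ ∑ G ∈ fam d Y, (n * ((k + 1) * (k + 1 + (2 * L * q + 2 * L)))) *
          ind (mvs Y a b G = (k + 1 : ℕ)) := by
    refine sum_le_sum fun G hG => ?_
    simp_rw [← mul_assoc, ← sum_mul]
    by_cases hGk : mvs Y a b G = (k + 1 : ℕ)
    · rw [ind_true hGk, mul_one, mul_one]
      have pt : ∀ b' v w, ind (Pat Y b w b' v G) * ind (Side Y a b' v w G)
          ≤ mv Y a b v G * mv Y b a w G := by
        intro b' v w
        unfold mv
        rw [← ind_and, ← ind_and]
        refine ind_le_ind fun hh => ?_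
        obtain ⟨⟨p1, p2, p3, p4, p5, p6⟩, s1, s2, s3, s4⟩ := hh
        exact ⟨⟨s2, p3, p5.symm⟩, ⟨p1, s3, s4⟩⟩
      have e : ∑ b', ∑ v, ∑ w, ind (Pat Y b w b' v G) * ind (Side Y a b' v w G)
          ≤ ∑ _b' : Fin n, ∑ v, ∑ w, mv Y a b v G * mv Y b a w G :=
        sum_le_sum fun b' _ => sum_le_sum fun v _ => sum_le_sum fun w _ => pt b' v w
      refine e.trans ?_
      simp_rw [← mul_sum, ← sum_mul]
      have e1 : ∑ i, mv Y a b i G = mvs Y a b G := rfl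
      have e2 : ∑ i, mv Y b a i G = mvs Y b a G := rfl
      rw [e1, e2, hGk]
      simp only [sum_const, card_univ, Fintype.card_fin, nsmul_eq_mul]
      have := (abs_le.1 (abs_mvs_sub h hY hab hG)).1
      rw [hGk] at this
      push_cast at this ⊢
      have hb := mvs_nonneg Y b a G
      have h3 : mvs Y b a G ≤ k + 1 + (2 * L * q + 2 * L) := by linarith
      have h4 := mul_le_mul_of_nonneg_left h3 (by positivity : (0 : ℝ) ≤ (k : ℝ) + 1)
      have h5 := mul_le_mul_of_nonneg_left h4 (Nat.cast_nonneg n : (0 : ℝ) ≤ n)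
      linarith
    · rw [ind_false hGk]; simp
  have mid : ∑ G ∈ fam d Y, ∑ b', ∑ v, ∑ w,
        ind (Pat Y b v b' w G) * (ind (Side Y a b' v w G) * ind (mvs Y a b G = k))
      = ∑ G ∈ fam d Y, ∑ b', ∑ v, ∑ w,
        ind (Pat Y b w b' v G) * (ind (Side Y a b' v w G) * ind (mvs Y a b G = (k + 1 : ℕ))) := by
    rw [sum_comm, sum_comm (s := fam d Y)]
    refine sum_congr rfl fun b' _ => ?_
    rw [sum_comm, sum_comm (s := fam d Y)]
    refine sum_congr rfl fun v _ => ?_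
    rw [sum_comm, sum_comm (s := fam d Y)]
    refine sum_congr rfl fun w _ => ?_
    rw [← sum_sw d Y b v b' w
      (fun G => ind (Side Y a b' v w G) * ind (mvs Y a b G = (k + 1 : ℕ)))]
    refine sum_congr rfl fun G hG => ?_
    by_cases hP : Pat Y b v b' w G
    · congr 1
      by_cases hS : Side Y a b' v w G ∨ Side Y a b' v w (sw b v b' w G)
      · obtain ⟨⟨s1, s2⟩, s3⟩ := sw_raise (mem_fam.1 hG).2 hab hP hS
        rw [ind_true s1, ind_true s2, s3]
        refine congrArg _ (ind_congr ?_)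
        push_cast
        exact (add_left_inj _).symm
      · push Not at hS
        rw [ind_false hS.1, ind_false hS.2]; ring
    · rw [ind_false hP]; ring
  have main := lower.trans (mid.le.trans upper)
  rw [← sum_mul, ← mul_sum] at main
  have hn0 : 0 ≤ ∑ G ∈ fam d Y, ind (mvs Y a b G = (k + 1 : ℕ)) :=
    sum_nonneg fun _ _ => ind_nonneg _
  have hL := h.hL
  have hL0 := h.L_pos
  have hq0 := h.hq0
  have hq := h.hq
  have hn : (0 : ℝ) < n := by rw [← hq]; positivity
  have k1 : (k : ℝ) + 1 ≤ 2 * n / L ^ 3 := by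
    have : 1 ≤ (n : ℝ) / L ^ 3 := by
      rw [le_div_iff₀ (by positivity), ← hq]
      have := h.pow_le (k := 3) (by norm_num)
      nlinarith [h.q_large]
    rw [mul_div_assoc]; linarith
  have k2 : (k : ℝ) + 1 + (2 * L * q + 2 * L) ≤ 2 * n / L ^ 3 := by
    have : 1 + (2 * L * q + 2 * L) ≤ (n : ℝ) / L ^ 3 := by
      rw [le_div_iff₀ (by positivity), ← hq]
      have h5 := h.pow_le (k := 5) (by norm_num)
      have e : 1 + (2 * L * q + 2 * L) ≤ L ^ 2 * q := by
        have : 1000 * q ≤ L * q := by gcongr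
        have h0 : 1000 * L ≤ L * q := by rw [mul_comm]; gcongr; exact h.q_large
        have : 1000 * (L * q) ≤ L * (L * q) := by gcongr
        nlinarith [h.q_large]
      calc (1 + (2 * L * q + 2 * L)) * L ^ 3 ≤ (L ^ 2 * q) * L ^ 3 := by gcongr
        _ = q * L ^ 5 := by ring
        _ ≤ q * q := by gcongr
        _ = q ^ 2 := by ring
    rw [mul_div_assoc]; linarith
  set M := ∑ G ∈ fam d Y, ind (mvs Y a b G = (k + 1 : ℕ)) with hM
  have : n * (((k : ℝ) + 1) * (k + 1 + (2 * L * q + 2 * L))) * M ≤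
      (M / 2) * ((n : ℝ) ^ 3 / (64 * L ^ 4)) := by
    calc n * (((k : ℝ) + 1) * (k + 1 + (2 * L * q + 2 * L))) * M
        ≤ n * ((2 * n / L ^ 3) * (2 * n / L ^ 3)) * M := by gcongr
      _ = (4 * n ^ 3 / L ^ 6) * M := by field_simp; ring
      _ ≤ (n ^ 3 / (128 * L ^ 4)) * M := by
          refine mul_le_mul_of_nonneg_right ?_ hn0
          rw [div_le_div_iff₀ (by positivity) (by positivity)]
          have : 512 ≤ L ^ 2 := by nlinarith
          calc 4 * (n:ℝ) ^ 3 * (128 * L ^ 4) = n ^ 3 * (512 * L ^ 4) := by ring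
            _ ≤ n ^ 3 * (L ^ 2 * L ^ 4) := by gcongr
            _ = _ := by ring
      _ = _ := by ring
  have f := main.trans this
  rw [one_div_mul_eq_div]
  exact le_of_mul_le_mul_right f (by positivity)

lemma level_count_iter (h : Dense n L lm q d) (hY : DegLE Y L) {a b : Fin n} (hab : a ≠ b)
    (J k : ℕ) (hk : ((k + J : ℕ) : ℝ) ≤ n / L ^ 3) :
    2 ^ J * ∑ G ∈ fam d Y, ind (mvs Y a b G = k) ≤ (fam d Y).card := by
  induction J generalizing k with
  | zero =>
    rw [pow_zero, one_mul]
    calc ∑ G ∈ fam d Y, ind (mvs Y a b G = k) ≤ ∑ _G ∈ fam d Y, (1 : ℝ) :=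
          sum_le_sum fun _ _ => ind_le_one _
      _ = _ := by simp
  | succ J ih =>
    have h1 := level_count h hY hab k (le_trans (by push_cast; linarith) hk)
    have h2 := ih (k + 1) (by convert hk using 2; ring)
    calc (2:ℝ) ^ (J + 1) * ∑ G ∈ fam d Y, ind (mvs Y a b G = k)
        ≤ 2 ^ (J + 1) * ((1 / 2) * ∑ G ∈ fam d Y, ind (mvs Y a b G = (k + 1 : ℕ))) := by gcongr
      _ = 2 ^ J * ∑ G ∈ fam d Y, ind (mvs Y a b G = (k + 1 : ℕ)) := by ring
      _ ≤ _ := h2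

lemma tail_bound (h : Dense n L lm q d) (hY : DegLE Y L) {a b : Fin n} (hab : a ≠ b) :
    mean d Y (fun G => ind (ssum Y a b G ≤ n / (2 * L ^ 3))) ≤ 2 / q ^ 10 := by
  have hL := h.hL
  have hL0 := h.L_pos
  have hq0 := h.hq0
  have hq := h.hq
  have hq1 := h.q_large
  set K : ℕ := ⌊(n : ℝ) / (2 * L ^ 3)⌋₊ with hK
  have hKle : (K : ℝ) ≤ n / (2 * L ^ 3) := Nat.floor_le (by positivity)
  have hKn : (K : ℝ) + 1 ≤ 2 * q ^ 2 := by
    have : (n : ℝ) / (2 * L ^ 3) ≤ n := by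
      apply div_le_self (Nat.cast_nonneg _)
      have : 1 ≤ L ^ 3 := one_le_pow₀ (by linarith)
      linarith
    rw [← hq] at this hKle
    nlinarith
  set j : ℕ := ⌈q⌉₊ with hj
  have hj1 : q ≤ j := Nat.le_ceil q
  have hj2 : (j : ℝ) ≤ q + 1 := (Nat.ceil_lt_add_one hq0.le).le
  have h2j : q ^ 12 ≤ 2 ^ (12 * j) := by
    rw [mul_comm, pow_mul]
    have : (j : ℝ) ≤ 2 ^ j := by exact_mod_cast (Nat.lt_two_pow_self (n := j)).le
    gcongr
    linarith
  have hKJ : ∀ k ∈ range (K + 1), ((k + 12 * j : ℕ) : ℝ) ≤ n / L ^ 3 := by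
    intro k hk
    have : (k : ℝ) ≤ K := by exact_mod_cast Nat.lt_succ_iff.1 (mem_range.1 hk)
    push_cast
    have e1 : (n : ℝ) / L ^ 3 = n / (2 * L ^ 3) + n / (2 * L ^ 3) := by field_simp; norm_num
    have e2 : 12 * (q + 1) ≤ (n : ℝ) / (2 * L ^ 3) := by
      rw [le_div_iff₀ (by positivity), ← hq]
      have h4 := h.pow_le (k := 4) (by norm_num)
      have : 1000 * L ^ 3 ≤ q := by
        calc 1000 * L ^ 3 ≤ L * L ^ 3 := by gcongr
          _ = L ^ 4 := by ring
          _ ≤ q := h4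
      nlinarith
    rw [e1]; linarith
  have hcount : q ^ 12 * ∑ G ∈ fam d Y, ind (ssum Y a b G ≤ n / (2 * L ^ 3)) ≤
      (2 * q ^ 2) * (fam d Y).card := by
    have pt : ∀ G, ind (ssum Y a b G ≤ n / (2 * L ^ 3)) ≤
        ∑ k ∈ range (K + 1), ind (mvs Y a b G = k) := by
      intro G
      by_cases hG : ssum Y a b G ≤ n / (2 * L ^ 3)
      · obtain ⟨k, hk⟩ := mvs_eq_card Y a b G
        have : (k : ℝ) ≤ n / (2 * L ^ 3) := by
          rw [← hk]; refine le_trans ?_ hG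
          exact le_add_of_nonneg_right (mvs_nonneg ..)
        have hkK : k ∈ range (K + 1) := mem_range.2 (Nat.lt_succ_of_le (Nat.le_floor this))
        rw [ind_true hG, ← ind_true hk]
        exact single_le_sum (f := fun k : ℕ => ind (mvs Y a b G = k))
          (fun _ _ => ind_nonneg _) hkK
      · rw [ind_false hG]; exact sum_nonneg fun _ _ => ind_nonneg _
    calc q ^ 12 * ∑ G ∈ fam d Y, ind (ssum Y a b G ≤ n / (2 * L ^ 3))
        ≤ 2 ^ (12 * j) * ∑ G ∈ fam d Y, ∑ k ∈ range (K + 1), ind (mvs Y a b G = k) := by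
          refine mul_le_mul h2j (sum_le_sum fun G _ => pt G)
            (sum_nonneg fun _ _ => ind_nonneg _) (by positivity)
      _ = ∑ k ∈ range (K + 1), 2 ^ (12 * j) * ∑ G ∈ fam d Y, ind (mvs Y a b G = k) := by
          rw [sum_comm, mul_sum]
      _ ≤ ∑ k ∈ range (K + 1), ((fam d Y).card : ℝ) :=
          sum_le_sum fun k hk => level_count_iter h hY hab _ _ (hKJ k hk)
      _ = (K + 1) * (fam d Y).card := by simp
      _ ≤ _ := by gcongr
  rcases (fam d Y).eq_empty_or_nonempty with h0 | h0
  · simp only [mean, h0, sum_empty, zero_div]; positivity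
  · have hc : (0 : ℝ) < (fam d Y).card := by exact_mod_cast h0.card_pos
    rw [mean, div_le_div_iff₀ hc (by positivity)]
    have : q ^ 2 * ((∑ G ∈ fam d Y, ind (ssum Y a b G ≤ n / (2 * L ^ 3))) * q ^ 10) ≤
        q ^ 2 * (2 * (fam d Y).card) := by linarith [hcount]
    exact le_of_mul_le_mul_left this (by positivity)

end Tail

section LevelZero

open Finset

variable {n : ℕ} {L lm q : ℝ} {d : Fin n → ℕ} {Y G : SimpleGraph (Fin n)}

lemma deg_sup_edge (Y : SimpleGraph (Fin n)) {x z : Fin n} (hxz : x ≠ z) (hY : ¬ Y.Adj x z)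
    (j : Fin n) :
    (deg (Y ⊔ SimpleGraph.edge x z) j : ℝ) = deg Y j + ind (j = x) + ind (j = z) := by
  rw [deg_eq_sum, deg_eq_sum, add_assoc, ← sum_eind hxz, ← sum_add_distrib]
  refine sum_congr rfl fun k _ => ?_
  by_cases hj : (j = x ∧ k = z) ∨ (j = z ∧ k = x)
  · have h1 : eind x z j k = 1 := ind_true hj
    have h2 : ¬ Y.Adj j k := by
      rcases hj with ⟨rfl, rfl⟩ | ⟨rfl, rfl⟩
      · exact hY
      · exact fun h => hY h.symm
    have h3 : (Y ⊔ SimpleGraph.edge x z).Adj j k := by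
      rw [SimpleGraph.sup_adj, SimpleGraph.edge_adj]
      right; grind
    rw [h1, ind_false h2, ind_true h3, zero_add]
  · have h1 : eind x z j k = 0 := ind_false hj
    rw [h1, add_zero]
    refine ind_congr ?_
    rw [SimpleGraph.sup_adj, SimpleGraph.edge_adj]
    constructor
    · rintro (h | h)
      · exact h
      · exfalso; grind
    · exact Or.inl

lemma graph_induction {P : SimpleGraph (Fin n) → Prop} (h0 : P ⊥)
    (hs : ∀ Y x z, x ≠ z → ¬ Y.Adj x z → P Y → P (Y ⊔ SimpleGraph.edge x z)) :
    ∀ Y, P Y := by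
  intro Y
  induction hk : ∑ j, deg Y j using Nat.strong_induction_on generalizing Y with
  | _ k ih =>
    by_cases hb : Y = ⊥
    · rw [hb]; exact h0
    · obtain ⟨x, z, hxz⟩ : ∃ x z, Y.Adj x z := by
        by_contra hcon
        push Not at hcon
        apply hb
        ext x z
        simp [hcon x z]
      set Y' := Y.deleteEdges {s(x, z)} with hY'
      have hnot : ¬ Y'.Adj x z := by simp [hY']
      have hsup : Y' ⊔ SimpleGraph.edge x z = Y := by
        ext u w
        simp only [hY', SimpleGraph.sup_adj, SimpleGraph.deleteEdges_adj, SimpleGraph.edge_adj,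
          Set.mem_singleton_iff, Sym2.eq_iff]
        constructor
        · rintro (h | ⟨⟨rfl, rfl⟩ | ⟨rfl, rfl⟩, -⟩)
          · exact h.1
          · exact hxz
          · exact hxz.symm
        · intro h
          have := h.ne
          by_cases hh : (u = x ∧ w = z) ∨ (u = z ∧ w = x)
          · right; grind
          · left; exact ⟨h, hh⟩
      rw [← hsup]
      refine hs Y' x z hxz.ne hnot (ih _ ?_ Y' rfl)
      have := sum_congr rfl fun j (_ : j ∈ univ) => deg_sup_edge Y' hxz.ne hnot j
      rw [hsup, sum_add_distrib, sum_add_distrib, sum_ind_eq, sum_ind_eq] at this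
      have h2 : ((∑ j, deg Y' j : ℕ) : ℝ) < ((∑ j, deg Y j : ℕ) : ℝ) := by
        push_cast
        linarith
      rw [← hk]
      exact_mod_cast h2

lemma DegLE.mono {D D' : ℝ} (h : DegLE Y D) (hD : D ≤ D') : DegLE Y D' :=
  fun j => (h j).trans hD

lemma DegLE.sup_edge {D : ℝ} (h : DegLE Y D) {x z : Fin n} (hxz : x ≠ z) (hY : ¬ Y.Adj x z) :
    DegLE (Y ⊔ SimpleGraph.edge x z) (D + 1) := by
  intro j
  rw [deg_sup_edge Y hxz hY]
  have : ind (j = x) + ind (j = z) ≤ 1 := by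
    by_cases h1 : j = x
    · rw [ind_true h1, ind_false (fun h2 => hxz (h1.symm.trans h2))]; norm_num
    · rw [ind_false h1, zero_add]; exact ind_le_one _
  linarith [h j]

lemma DegLE.of_sup_edge {D : ℝ} {x z : Fin n} (hxz : x ≠ z) (hY : ¬ Y.Adj x z)
    (h : DegLE (Y ⊔ SimpleGraph.edge x z) D) : DegLE Y D := by
  intro j
  have := h j
  rw [deg_sup_edge Y hxz hY] at this
  linarith [ind_nonneg (j = x), ind_nonneg (j = z)]

lemma sig_div_nonneg (Y : SimpleGraph (Fin n)) (a b v : Fin n) (G : SimpleGraph (Fin n)) :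
    0 ≤ sig Y a b v G / ssum Y a b G := div_nonneg (sig_nonneg ..) (ssum_nonneg ..)

lemma sig_div_le (h : Dense n L lm q d) (Y : SimpleGraph (Fin n)) (a b v : Fin n)
    (G : SimpleGraph (Fin n)) :
    sig Y a b v G / ssum Y a b G ≤ 2 * L ^ 3 / n + ind (ssum Y a b G ≤ n / (2 * L ^ 3)) := by
  have hL0 := h.L_pos
  have hn : (0 : ℝ) < n := by rw [← h.hq]; have := h.hq0; positivity
  by_cases hs : ssum Y a b G ≤ n / (2 * L ^ 3)
  · rw [ind_true hs]
    have : sig Y a b v G / ssum Y a b G ≤ 1 :=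
      div_le_one_of_le₀ (sig_le_ssum ..) (ssum_nonneg ..)
    have : 0 ≤ 2 * L ^ 3 / n := by positivity
    linarith
  · rw [ind_false hs, add_zero]
    push Not at hs
    have : 0 < (n : ℝ) / (2 * L ^ 3) := by positivity
    calc sig Y a b v G / ssum Y a b G ≤ 1 / (n / (2 * L ^ 3)) := by
          gcongr; exact sig_le_one ..
      _ = _ := by rw [one_div_div]

lemma mean_sig_div_le (h : Dense n L lm q d) (hY : DegLE Y L) (hne : (fam d Y).Nonempty)
    {a b : Fin n} (hab : a ≠ b) (v : Fin n) :
    mean d Y (fun G => sig Y a b v G / ssum Y a b G) ≤ 3 * L ^ 3 / n := by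
  have h1 := mean_mono (d := d) (Y := Y) fun G _ => sig_div_le h Y a b v G
  rw [mean_add, mean_const hne] at h1
  have h2 := tail_bound h hY hab
  refine h1.trans ?_
  have hL0 := h.L_pos
  have hq0 := h.hq0
  have : 2 / q ^ 10 ≤ L ^ 3 / n := by
    rw [← h.hq, div_le_div_iff₀ (by positivity) (by positivity)]
    have e : 2 ≤ L ^ 3 := by
      have : (1000:ℝ) ^ 3 ≤ L ^ 3 := by gcongr; exact h.hL
      linarith
    have e2 : q ^ 2 ≤ q ^ 10 := pow_le_pow_right₀ (by linarith [h.q_large]) (by norm_num)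
    gcongr
  calc 2 * L ^ 3 / n + mean d Y (fun G => ind (ssum Y a b G ≤ n / (2 * L ^ 3)))
      ≤ 2 * L ^ 3 / n + L ^ 3 / n := by linarith
    _ = _ := by ring

/-- Weight selecting the possible non-forced neighbours of `v`. -/
noncomputable def wt (Y : SimpleGraph (Fin n)) (v b : Fin n) : ℝ :=
  1 - ind (b = v) - ind (Y.Adj b v)

lemma wt_eq_one {v b : Fin n} (h : b ≠ v) (hY : ¬ Y.Adj b v) : wt Y v b = 1 := by
  rw [wt, ind_false h, ind_false hY]; norm_num

lemma wt_eq_zero {v b : Fin n} (h : ¬ (b ≠ v ∧ ¬ Y.Adj b v)) : wt Y v b = 0 := by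
  by_cases hb : b = v
  · subst hb; rw [wt, ind_true rfl, ind_false Y.irrefl]; norm_num
  · have : Y.Adj b v := by tauto
    rw [wt, ind_false hb, ind_true this]; norm_num

lemma sum_wt (Y : SimpleGraph (Fin n)) (v : Fin n) : ∑ b, wt Y v b = n - 1 - deg Y v := by
  unfold wt
  rw [sum_sub_distrib, sum_sub_distrib, sum_ind_eq, deg_eq_sum]
  simp_rw [ind_adj_comm Y v]
  simp

lemma sum_wt_pr (hne : (fam d Y).Nonempty) (v : Fin n) :
    ∑ b, wt Y v b * pr d Y b v = d v - deg Y v := by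
  rw [← sum_pr_of_not_adj hne]
  refine sum_congr rfl fun b _ => ?_
  by_cases hb : b = v
  · subst hb; rw [pr_self]; ring
  · rw [wt, ind_false hb]; ring

lemma average_bound (hne : (fam d Y).Nonempty) {v : Fin n} {g : Fin n → ℝ} {η : ℝ}
    (hg : ∀ a b, a ≠ v → b ≠ v → ¬ Y.Adj a v → ¬ Y.Adj b v → a ≠ b →
      |pr d Y a v - pr d Y b v - (g a - g b)| ≤ η) (hη : 0 ≤ η)
    {a : Fin n} (hav : a ≠ v) (hY : ¬ Y.Adj a v) :
    |(n - 1 - deg Y v) * (pr d Y a v - g a) - ((d v - deg Y v) - ∑ b, wt Y v b * g b)|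
      ≤ (n - 1 - deg Y v) * η := by
  rw [← sum_wt, ← sum_wt_pr hne, sum_mul, sum_mul, ← sum_sub_distrib, ← sum_sub_distrib]
  refine (abs_sum_le_sum_abs _ _).trans (sum_le_sum fun b _ => ?_)
  by_cases hb : b ≠ v ∧ ¬ Y.Adj b v
  · rw [wt_eq_one hb.1 hb.2]
    by_cases hab : a = b
    · subst hab
      simpa using hη
    · have := hg a b hav hb.1 hY hb.2 hab
      rw [show 1 * (pr d Y a v - g a) - (1 * pr d Y b v - 1 * g b)
        = pr d Y a v - pr d Y b v - (g a - g b) by ring, one_mul]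
      exact this
  · rw [wt_eq_zero hb]; simp

lemma Dense.n_pos (h : Dense n L lm q d) : (0 : ℝ) < n := by
  rw [← h.hq]; have := h.hq0; positivity

lemma Dense.L_le_n (h : Dense n L lm q d) : 1000 * L ≤ n := by
  rw [← h.hq]
  have h1 := h.pow_le (k := 1) (by norm_num)
  nlinarith [h.q_large]

lemma pr_level_zero' (h : Dense n L lm q d) (hY : DegLE Y L) (hne : (fam d Y).Nonempty)
    {a v : Fin n} (hav : a ≠ v) (hYav : ¬ Y.Adj a v) : |pr d Y a v - lm| ≤ L ^ 5 / q := by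
  have hL := h.hL
  have hL0 := h.L_pos
  have hq0 := h.hq0
  have hq1 := h.q_large
  have hn := h.n_pos
  have hLn := h.L_le_n
  have hyv := hY v
  have hyv0 : (0 : ℝ) ≤ deg Y v := Nat.cast_nonneg _
  have hLq2 : 1000 * L ≤ L * q := by rw [mul_comm]; gcongr
  have diff : ∀ a b, a ≠ v → b ≠ v → ¬ Y.Adj a v → ¬ Y.Adj b v → a ≠ b →
      |pr d Y a v - pr d Y b v - ((0 : Fin n → ℝ) a - (0 : Fin n → ℝ) b)| ≤ 9 * L ^ 4 / q := by
    intro a b ha hb hYa hYb hab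
    rw [pr_sub_pr Y d ha.symm hb.symm hYa hYb]
    have h1 : |mean d Y (fun G => sig Y a b v G * (mvs Y a b G - mvs Y b a G) / ssum Y a b G)|
        ≤ mean d Y (fun G => (3 * L * q) * (sig Y a b v G / ssum Y a b G)) := by
      refine abs_mean_le fun G hG => ?_
      rw [mul_div_right_comm, abs_mul, mul_comm, abs_of_nonneg (sig_div_nonneg ..)]
      refine mul_le_mul_of_nonneg_right ?_ (sig_div_nonneg ..)
      refine (abs_mvs_sub h hY hab hG).trans ?_
      linarith
    rw [mean_const_mul] at h1
    have h2 := mean_sig_div_le h hY hne hab v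
    simp only [Pi.zero_apply, sub_zero]
    refine h1.trans ?_
    calc 3 * L * q * mean d Y (fun G => sig Y a b v G / ssum Y a b G)
        ≤ 3 * L * q * (3 * L ^ 3 / n) := by gcongr
      _ = 9 * L ^ 4 / q := by rw [← h.hq]; field_simp; norm_num
  have := average_bound hne diff (by positivity) hav hYav
  simp only [Pi.zero_apply, sub_zero, mul_zero, sum_const_zero] at this
  have hd := h.hd v
  set c : ℝ := n - 1 - deg Y v with hc
  have hc1 : (n : ℝ) / 2 ≤ c := by rw [hc]; linarith
  have hc0 : 0 < c := by linarith
  have key : |c * (pr d Y a v - lm)| ≤ c * (9 * L ^ 4 / q) + 2 * L * q := by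
    have e : c * (pr d Y a v - lm) = (c * pr d Y a v - (d v - deg Y v))
        + ((d v - lm * (n - 1)) - (1 - lm) * deg Y v) := by rw [hc]; ring
    rw [e]
    refine (abs_add_le _ _).trans (add_le_add this ?_)
    refine (abs_sub _ _).trans ?_
    have e2 : |(1 - lm) * (deg Y v : ℝ)| ≤ L := by
      rw [abs_of_nonneg (mul_nonneg (by linarith [h.lm_lt]) hyv0)]
      nlinarith [h.lm_pos]
    linarith
  rw [abs_mul, abs_of_pos hc0] at key
  have e3 : 2 * L * q ≤ c * (4 * L / q) := by
    calc 2 * L * q = (n / 2) * (4 * L / q) := by rw [← h.hq]; field_simp; norm_num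
      _ ≤ _ := by gcongr
  have : c * |pr d Y a v - lm| ≤ c * (9 * L ^ 4 / q + 4 * L / q) := by linarith
  refine (le_of_mul_le_mul_left this hc0).trans ?_
  rw [← add_div]
  gcongr
  have e4 : 1000 * L ^ 4 ≤ L ^ 5 := by
    rw [pow_succ L 4, mul_comm]; gcongr
  have e5 : L ≤ L ^ 4 := le_self_pow₀ (by linarith) (by norm_num)
  linarith

lemma fam_nonempty (h : Dense n L lm q d) : ∀ Y : SimpleGraph (Fin n), DegLE Y L →
    (fam d Y).Nonempty := by
  refine graph_induction (fun _ => h.hne) ?_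
  intro Y x z hxz hYxz ih hdeg
  have hY := DegLE.of_sup_edge hxz hYxz hdeg
  have hne := ih hY
  have h1 := (abs_le.1 (pr_level_zero' h hY hne hxz hYxz)).1
  have hpos : 0 < pr d Y x z := by
    have hq0 := h.hq0
    have hL0 := h.L_pos
    have : L ^ 5 / q < 1 / L := by
      rw [div_lt_div_iff₀ hq0 hL0]
      have := h.pow_le (k := 7) (by norm_num)
      have : L ^ 5 * L * 1 < L ^ 5 * L * L := by gcongr; linarith [h.hL]
      nlinarith
    linarith [h.hlm]
  have hc : (0 : ℝ) < (fam d Y).card := by exact_mod_cast hne.card_pos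
  have := mul_pos hpos hc
  rw [pr_mul_card d Y hxz] at this
  exact card_pos.1 (by exact_mod_cast this)

lemma pr_level_zero (h : Dense n L lm q d) (hY : DegLE Y L)
    {a v : Fin n} (hav : a ≠ v) (hYav : ¬ Y.Adj a v) : |pr d Y a v - lm| ≤ L ^ 5 / q :=
  pr_level_zero' h hY (fam_nonempty h Y hY) hav hYav

end LevelZero

section Step

open Finset

variable {n : ℕ} {L lm q : ℝ} {d : Fin n → ℕ} {Y G : SimpleGraph (Fin n)}

/-- `p` approximates all conditional edge probabilities with error `e`, for all conditioning
graphs of maximum degree at most `D`. -/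
def Approx (d : Fin n → ℕ) (p : Fin n → Fin n → ℝ) (D e : ℝ) : Prop :=
  ∀ Y : SimpleGraph (Fin n), DegLE Y D → ∀ x z, x ≠ z → ¬ Y.Adj x z → |pr d Y x z - p x z| ≤ e

/-- Exactly one of `a`, `b` is adjacent to `x`. -/
noncomputable def sg (a b x : Fin n) (G : SimpleGraph (Fin n)) : ℝ :=
  ind (G.Adj a x) + ind (G.Adj b x) - 2 * (ind (G.Adj a x) * ind (G.Adj b x))

/-- The value of `sg` expected when the two edges are independent with probabilities `p`. -/
def sgp (p : Fin n → Fin n → ℝ) (a b x : Fin n) : ℝ := p a x + p b x - 2 * (p a x * p b x)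

/-- The vertices whose adjacencies to `a` and `b` are not prescribed by `Y`. -/
noncomputable def free (Y : SimpleGraph (Fin n)) (a b : Fin n) : Finset (Fin n) :=
  univ.filter fun x => x ≠ a ∧ x ≠ b ∧ ¬ Y.Adj a x ∧ ¬ Y.Adj b x

lemma mem_free {a b x : Fin n} :
    x ∈ free Y a b ↔ x ≠ a ∧ x ≠ b ∧ ¬ Y.Adj a x ∧ ¬ Y.Adj b x := by simp [free]

lemma sg_nonneg (a b x : Fin n) (G : SimpleGraph (Fin n)) : 0 ≤ sg a b x G := by
  unfold sg ind; split_ifs <;> norm_num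

lemma sg_le_one (a b x : Fin n) (G : SimpleGraph (Fin n)) : sg a b x G ≤ 1 := by
  unfold sg ind; split_ifs <;> norm_num

lemma sig_eq_sg (hY : Y ≤ G) {a b x : Fin n} (hx : x ∈ free Y a b) :
    sig Y a b x G = sg a b x G := by
  obtain ⟨hxa, hxb, ha, hb⟩ := mem_free.1 hx
  rw [sig, mv_eq hY hxb, mv_eq hY hxa, ind_false ha, ind_false hb, sg]
  ring

lemma card_free (hY : DegLE Y L) (a b : Fin n) : (n : ℝ) - (2 * L + 2) ≤ (free Y a b).card := by
  have : ∀ x : Fin n, (1 : ℝ) - ind (x = a) - ind (x = b) - ind (Y.Adj a x) - ind (Y.Adj b x)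
      ≤ ind (x ≠ a ∧ x ≠ b ∧ ¬ Y.Adj a x ∧ ¬ Y.Adj b x) := by
    intro x
    by_cases hp : x ≠ a ∧ x ≠ b ∧ ¬ Y.Adj a x ∧ ¬ Y.Adj b x
    · rw [ind_true hp]
      linarith [ind_nonneg (x = a), ind_nonneg (x = b), ind_nonneg (Y.Adj a x),
        ind_nonneg (Y.Adj b x)]
    · rw [ind_false hp]
      unfold ind; split_ifs <;> first | (exfalso; tauto) | norm_num
  have hc : ∑ x, ind (x ≠ a ∧ x ≠ b ∧ ¬ Y.Adj a x ∧ ¬ Y.Adj b x) = ((free Y a b).card : ℝ) := by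
    rw [sum_ind, free]; congr!
  have h2 := sum_le_sum fun x (_ : x ∈ univ) => this x
  rw [hc, sum_sub_distrib, sum_sub_distrib, sum_sub_distrib, sum_sub_distrib, sum_ind_eq,
    sum_ind_eq, ← deg_eq_sum, ← deg_eq_sum] at h2
  simp only [sum_const, card_univ, Fintype.card_fin, nsmul_eq_mul, mul_one] at h2
  linarith [hY a, hY b]

lemma card_free_le (Y : SimpleGraph (Fin n)) (a b : Fin n) : ((free Y a b).card : ℝ) ≤ n := by
  have := card_le_univ (free Y a b)
  rw [Fintype.card_fin] at this
  exact_mod_cast this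

/-- The part of `ssum` coming from vertices outside `free`. -/
noncomputable def rest (Y : SimpleGraph (Fin n)) (a b : Fin n) (G : SimpleGraph (Fin n)) : ℝ :=
  ∑ x ∈ univ \ free Y a b, sig Y a b x G

lemma rest_nonneg (Y : SimpleGraph (Fin n)) (a b : Fin n) (G : SimpleGraph (Fin n)) :
    0 ≤ rest Y a b G := sum_nonneg fun _ _ => sig_nonneg ..

lemma rest_le (hY : DegLE Y L) (a b : Fin n) (G : SimpleGraph (Fin n)) :
    rest Y a b G ≤ 2 * L + 2 := by
  have h1 : rest Y a b G ≤ ∑ x ∈ univ \ free Y a b, (1 : ℝ) := sum_le_sum fun _ _ => sig_le_one ..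
  have h2 : ∑ x ∈ univ \ free Y a b, (1 : ℝ) + ∑ x ∈ free Y a b, (1 : ℝ) = ∑ x : Fin n, (1 : ℝ) :=
    sum_sdiff (subset_univ _)
  simp only [sum_const, card_univ, Fintype.card_fin, nsmul_eq_mul, mul_one] at h1 h2
  linarith [card_free hY a b]

lemma ssum_eq_free (hY : Y ≤ G) (a b : Fin n) :
    ssum Y a b G = ∑ x ∈ free Y a b, sg a b x G + rest Y a b G := by
  rw [ssum_eq, rest, ← sum_sdiff (subset_univ (free Y a b)), add_comm]
  congr 1
  exact sum_congr rfl fun x hx => sig_eq_sg hY hx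

lemma abs_mul_sub_le {P E p c η e : ℝ} (hP0 : 0 ≤ P) (hP1 : P ≤ 1) (hc : |c| ≤ 1)
    (hE : |E - c| ≤ η) (hp : |P - p| ≤ e) : |P * E - p * c| ≤ η + e := by
  have e1 : P * E - p * c = P * (E - c) + (P - p) * c := by ring
  rw [e1]
  refine (abs_add_le _ _).trans (add_le_add ?_ ?_)
  · rw [abs_mul, abs_of_nonneg hP0]
    calc P * |E - c| ≤ 1 * |E - c| := by gcongr
      _ ≤ η := by linarith
  · rw [abs_mul]
    calc |P - p| * |c| ≤ |P - p| * 1 := by gcongr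
      _ ≤ e := by linarith

lemma mean_sg_mul {p : Fin n → Fin n → ℝ} {D e c η : ℝ} (hap : Approx d p D e)
    (hp0 : ∀ x z, 0 ≤ p x z) (hp1 : ∀ x z, p x z ≤ 1) (hY : DegLE Y (D - 2)) {a b x : Fin n}
    (hab : a ≠ b) (hx : x ∈ free Y a b) (f : SimpleGraph (Fin n) → ℝ) (hc : |c| ≤ 1)
    (hf : ∀ Y', DegLE Y' D → (∀ u y, y ≠ x → u ≠ x → (Y'.Adj u y ↔ Y.Adj u y)) →
      |mean d Y' f - c| ≤ η) :
    |mean d Y (fun G => sg a b x G * f G) - sgp p a b x * c| ≤ 4 * η + 6 * e := by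
  obtain ⟨hxa, hxb, ha, hb⟩ := mem_free.1 hx
  have hY1 := hY.sup_edge hxa.symm ha
  have hY2 := hY.sup_edge hxb.symm hb
  have hb' : ¬ (Y ⊔ SimpleGraph.edge a x).Adj b x := by
    rw [SimpleGraph.sup_adj, SimpleGraph.edge_adj]
    grind
  have hY3 := hY1.sup_edge hxb.symm hb'
  have e0 : mean d Y (fun G => sg a b x G * f G)
      = pr d Y a x * mean d (Y ⊔ SimpleGraph.edge a x) f
        + pr d Y b x * mean d (Y ⊔ SimpleGraph.edge b x) f
        - 2 * (pr d Y a x * (pr d (Y ⊔ SimpleGraph.edge a x) b x *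
          mean d ((Y ⊔ SimpleGraph.edge a x) ⊔ SimpleGraph.edge b x) f)) := by
    rw [← mean_ind_mul d _ hxb.symm f, ← mean_ind_mul d _ hxa.symm f,
      ← mean_ind_mul d _ hxb.symm f, ← mean_ind_mul d _ hxa.symm, ← mean_const_mul,
      ← mean_add, ← mean_sub]
    refine mean_congr fun G _ => ?_
    rw [sg]; ring
  have nadj : ∀ u : Fin n, u ≠ x → ∀ w y, y ≠ x → w ≠ x →
      ¬ (SimpleGraph.edge u x).Adj w y := by
    intro u hu w y hy hw
    rw [SimpleGraph.edge_adj]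
    grind
  have m1 := hf _ (hY1.mono (by linarith)) (fun w y hy hw => by
    rw [SimpleGraph.sup_adj]; have := nadj a hxa.symm w y hy hw; tauto)
  have m2 := hf _ (hY2.mono (by linarith)) (fun w y hy hw => by
    rw [SimpleGraph.sup_adj]; have := nadj b hxb.symm w y hy hw; tauto)
  have m3 := hf _ (hY3.mono (by linarith)) (fun w y hy hw => by
    rw [SimpleGraph.sup_adj, SimpleGraph.sup_adj]
    have := nadj a hxa.symm w y hy hw
    have := nadj b hxb.symm w y hy hw; tauto)
  have t1 := abs_mul_sub_le (pr_nonneg d Y a x) (pr_le_one d Y a x) hc m1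
    (hap Y (hY.mono (by linarith)) a x hxa.symm ha)
  have t2 := abs_mul_sub_le (pr_nonneg d Y b x) (pr_le_one d Y b x) hc m2
    (hap Y (hY.mono (by linarith)) b x hxb.symm hb)
  have t3 := abs_mul_sub_le (pr_nonneg d _ b x) (pr_le_one d _ b x) hc m3
    (hap _ (hY1.mono (by linarith)) b x hxb.symm hb')
  have hc' : |p b x * c| ≤ 1 := by
    rw [abs_mul, abs_of_nonneg (hp0 b x)]
    exact mul_le_one₀ (hp1 b x) (abs_nonneg _) hc
  have t4 := abs_mul_sub_le (pr_nonneg d Y a x) (pr_le_one d Y a x) hc' t3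
    (hap Y (hY.mono (by linarith)) a x hxa.symm ha)
  rw [e0, sgp, show ∀ A B C : ℝ, A + B - 2 * C - (p a x + p b x - 2 * (p a x * p b x)) * c
      = (A - p a x * c) + (B - p b x * c) - 2 * (C - p a x * (p b x * c)) from
      fun A B C => by ring]
  rw [abs_le] at *
  constructor <;> linarith [t1.1, t1.2, t2.1, t2.2, t4.1, t4.2]

lemma sgp_nonneg {p : Fin n → Fin n → ℝ}
    (hp0 : ∀ x z, 0 ≤ p x z) (hp1 : ∀ x z, p x z ≤ 1) (a b x : Fin n) : 0 ≤ sgp p a b x := by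
  unfold sgp
  nlinarith [mul_nonneg (hp0 a x) (sub_nonneg.2 (hp1 b x)),
    mul_nonneg (hp0 b x) (sub_nonneg.2 (hp1 a x))]

lemma sgp_le_one {p : Fin n → Fin n → ℝ}
    (hp0 : ∀ x z, 0 ≤ p x z) (hp1 : ∀ x z, p x z ≤ 1) (a b x : Fin n) : sgp p a b x ≤ 1 := by
  unfold sgp
  nlinarith [mul_nonneg (hp0 a x) (hp0 b x),
    mul_nonneg (sub_nonneg.2 (hp1 b x)) (sub_nonneg.2 (hp1 a x))]

lemma abs_sgp_le_one {p : Fin n → Fin n → ℝ}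
    (hp0 : ∀ x z, 0 ≤ p x z) (hp1 : ∀ x z, p x z ≤ 1) (a b x : Fin n) : |sgp p a b x| ≤ 1 := by
  rw [abs_of_nonneg (sgp_nonneg hp0 hp1 a b x)]
  exact sgp_le_one hp0 hp1 a b x

lemma mean_sg (h : Dense n L lm q d) {p : Fin n → Fin n → ℝ} {D e : ℝ} (hap : Approx d p D e)
    (hD : D ≤ L)
    (hp0 : ∀ x z, 0 ≤ p x z) (hp1 : ∀ x z, p x z ≤ 1) (hY : DegLE Y (D - 2)) {a b x : Fin n}
    (hab : a ≠ b) (hx : x ∈ free Y a b) :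
    |mean d Y (fun G => sg a b x G) - sgp p a b x| ≤ 6 * e := by
  have := mean_sg_mul (c := 1) (η := 0) hap hp0 hp1 hY hab hx (fun _ => 1) (by norm_num)
    (fun Y' hY' _ => by rw [mean_const (fam_nonempty h Y' (hY'.mono hD))]; norm_num)
  simpa using this

lemma mean_sg_sg (h : Dense n L lm q d) {p : Fin n → Fin n → ℝ} {D e : ℝ} (hap : Approx d p D e)
    (hD : D ≤ L)
    (hp0 : ∀ x z, 0 ≤ p x z) (hp1 : ∀ x z, p x z ≤ 1) (hY : DegLE Y (D - 4)) {a b x y : Fin n}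
    (hab : a ≠ b) (hx : x ∈ free Y a b) (hy : y ∈ free Y a b) (hxy : y ≠ x) :
    |mean d Y (fun G => sg a b x G * sg a b y G) - sgp p a b x * sgp p a b y| ≤ 30 * e := by
  have hap' : Approx d p (D - 2) e := fun Y hY => hap Y (hY.mono (by linarith))
  obtain ⟨hxa, hxb, ha, hb⟩ := mem_free.1 hx
  obtain ⟨hya, hyb, ha', hb'⟩ := mem_free.1 hy
  have := mean_sg_mul (c := sgp p a b y) (η := 6 * e) hap' hp0 hp1
    (hY.mono (by linarith)) hab hx (fun G => sg a b y G)
    (abs_sgp_le_one hp0 hp1 a b y)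
    (fun Y' hY' hadj => mean_sg h hap hD hp0 hp1 hY' hab (mem_free.2 ⟨hya, hyb, by
      rwa [hadj _ _ hxy hxa.symm], by rwa [hadj _ _ hxy hxb.symm]⟩))
  linarith

/-- Hypotheses for passing from an approximation of the edge probabilities to an approximation
of the normalised switching weights. -/
structure StepHyp (n : ℕ) (L lm q : ℝ) (d : Fin n → ℕ) (p : Fin n → Fin n → ℝ) (D e : ℝ) :
    Prop where
  dense : Dense n L lm q d
  ap : Approx d p D e
  hD : D ≤ L
  hp0 : ∀ x z, 1 / (2 * L) ≤ p x z
  hp1 : ∀ x z, p x z ≤ 1 - 1 / (2 * L)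
  he : 1 / n ≤ e

namespace StepHyp

variable {p : Fin n → Fin n → ℝ} {D e : ℝ} {a b v : Fin n}

lemma p_nonneg (h : StepHyp n L lm q d p D e) (x z : Fin n) : 0 ≤ p x z :=
  le_trans (by have := h.dense.L_pos; positivity) (h.hp0 x z)

lemma p_le_one (h : StepHyp n L lm q d p D e) (x z : Fin n) : p x z ≤ 1 :=
  (h.hp1 x z).trans (by have := h.dense.L_pos; rw [sub_le_self_iff]; positivity)

lemma e_pos (h : StepHyp n L lm q d p D e) : 0 < e :=
  lt_of_lt_of_le (by have := h.dense.n_pos; positivity) h.he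

lemma one_le_ne (h : StepHyp n L lm q d p D e) : 1 ≤ n * e := by
  have := h.he
  rwa [div_le_iff₀ h.dense.n_pos, mul_comm] at this

lemma sum_sgp_ge (h : StepHyp n L lm q d p D e) (hY : DegLE Y (D - 4)) (a b : Fin n) :
    n / (8 * L ^ 2) ≤ ∑ x ∈ free Y a b, sgp p a b x := by
  have hL0 := h.dense.L_pos
  have hL := h.dense.hL
  have h1 : ∀ x ∈ free Y a b, 1 / (4 * L ^ 2) ≤ sgp p a b x := by
    intro x _
    have e1 : 1 / (4 * L ^ 2) = 1 / (2 * L) * (1 / (2 * L)) := by field_simp; norm_num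
    have e2 : 1 / (2 * L) * (1 / (2 * L)) ≤ p a x * (1 - p b x) := by
      have := h.hp0 a x
      have := h.hp1 b x
      gcongr
      · exact h.p_nonneg a x
      · linarith
    have e3 := mul_nonneg (h.p_nonneg b x) (sub_nonneg.2 (h.p_le_one a x))
    rw [e1, sgp]
    linarith
  have h2 := sum_le_sum h1
  rw [sum_const, nsmul_eq_mul] at h2
  refine le_trans ?_ h2
  have h3 := card_free (hY.mono (by linarith [h.hD] : D - 4 ≤ L)) a b
  have h4 := h.dense.L_le_n
  calc n / (8 * L ^ 2) = (n / 2) * (1 / (4 * L ^ 2)) := by field_simp; ring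
    _ ≤ _ := by gcongr; linarith

lemma mean_sq (h : StepHyp n L lm q d p D e) (hY : DegLE Y (D - 4)) (hab : a ≠ b) :
    mean d Y (fun G => (ssum Y a b G - ∑ x ∈ free Y a b, sgp p a b x) ^ 2) ≤ 90 * n ^ 2 * e := by
  have hYL := hY.mono (by linarith [h.hD] : D - 4 ≤ L)
  have hne := fam_nonempty h.dense Y hYL
  have hL := h.dense.hL
  have hn := h.dense.n_pos
  have h1 : mean d Y (fun G => (ssum Y a b G - ∑ x ∈ free Y a b, sgp p a b x) ^ 2)
      ≤ mean d Y (fun G => 2 * (∑ x ∈ free Y a b, ∑ y ∈ free Y a b,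
          (sg a b x G - sgp p a b x) * (sg a b y G - sgp p a b y)) + 2 * (2 * L + 2) ^ 2) := by
    refine mean_mono fun G hG => ?_
    rw [ssum_eq_free (mem_fam.1 hG).2, ← sum_mul_sum, sum_sub_distrib]
    have r0 := rest_nonneg Y a b G
    have r1 := rest_le hYL a b G
    have : rest Y a b G ^ 2 ≤ (2 * L + 2) ^ 2 := by gcongr
    nlinarith [sq_nonneg (∑ x ∈ free Y a b, sg a b x G - ∑ x ∈ free Y a b, sgp p a b x
      - rest Y a b G)]
  refine h1.trans ?_
  rw [mean_add, mean_const hne, mean_const_mul, mean_sum]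
  simp_rw [mean_sum]
  have h2 : ∀ x ∈ free Y a b, ∀ y ∈ free Y a b,
      mean d Y (fun G => (sg a b x G - sgp p a b x) * (sg a b y G - sgp p a b y))
        ≤ 42 * e + ind (y = x) := by
    intro x hx y hy
    by_cases hxy : y = x
    · rw [ind_true hxy]
      have he := h.e_pos
      refine (mean_le_of_le zero_le_one fun G _ => ?_).trans (by linarith)
      subst hxy
      have := sg_nonneg a b y G
      have := sg_le_one a b y G
      have := sgp_nonneg h.p_nonneg h.p_le_one a b y
      have := sgp_le_one h.p_nonneg h.p_le_one a b y
      rw [← sq, sq_le_one_iff_abs_le_one, abs_le]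
      constructor <;> linarith
    · rw [ind_false hxy, add_zero]
      have e1 : mean d Y (fun G => (sg a b x G - sgp p a b x) * (sg a b y G - sgp p a b y))
          = (mean d Y (fun G => sg a b x G * sg a b y G) - sgp p a b x * sgp p a b y)
            - sgp p a b y * (mean d Y (fun G => sg a b x G) - sgp p a b x)
            - sgp p a b x * (mean d Y (fun G => sg a b y G) - sgp p a b y) := by
        rw [show mean d Y (fun G => (sg a b x G - sgp p a b x) * (sg a b y G - sgp p a b y))
          = mean d Y (fun G => ((sg a b x G * sg a b y G - sgp p a b y * sg a b x G)
            - sgp p a b x * sg a b y G) + sgp p a b x * sgp p a b y) from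
            mean_congr fun G _ => by ring]
        rw [mean_add, mean_sub, mean_sub, mean_const_mul, mean_const_mul, mean_const hne]
        ring
      have t1 := (abs_le.1 (mean_sg_sg h.dense h.ap h.hD h.p_nonneg h.p_le_one hY hab hx hy hxy)).2
      have hY2 := hY.mono (by linarith : D - 4 ≤ D - 2)
      have t2 := (abs_le.1 (mean_sg h.dense h.ap h.hD h.p_nonneg h.p_le_one hY2 hab hx)).1
      have t3 := (abs_le.1 (mean_sg h.dense h.ap h.hD h.p_nonneg h.p_le_one hY2 hab hy)).1
      have qx0 := sgp_nonneg h.p_nonneg h.p_le_one a b x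
      have qx1 := sgp_le_one h.p_nonneg h.p_le_one a b x
      have qy0 := sgp_nonneg h.p_nonneg h.p_le_one a b y
      have qy1 := sgp_le_one h.p_nonneg h.p_le_one a b y
      have he := h.e_pos
      rw [e1]
      nlinarith
  have h3 := sum_le_sum fun x hx => sum_le_sum fun y hy => h2 x hx y hy
  have h4 : ∑ x ∈ free Y a b, ∑ y ∈ free Y a b, (42 * e + ind (y = x))
      ≤ ∑ x : Fin n, ∑ y : Fin n, (42 * e + ind (y = x)) := by
    have := h.e_pos
    refine (sum_le_sum fun x _ => sum_le_univ_sum_of_nonneg fun y => ?_).trans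
      (sum_le_univ_sum_of_nonneg fun x => sum_nonneg fun y _ => ?_) <;>
    exact add_nonneg (by positivity) (ind_nonneg _)
  have h5 : ∑ x : Fin n, ∑ y : Fin n, (42 * e + ind (y = x)) = n * (n * (42 * e) + 1) := by
    simp_rw [sum_add_distrib, sum_ind_eq]
    simp
    ring
  have h6 := h.one_le_ne
  have h7 : (2 * L + 2) ^ 2 ≤ n * (n * e) := by
    have := h.dense.pow_le (k := 2) (by norm_num)
    have h8 : (L + L) ^ 2 = 4 * L ^ 2 := by ring
    have h9 : 4 * L ^ 2 ≤ n := by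
      rw [← h.dense.hq]
      nlinarith [h.dense.q_large]
    have h10 : (2 * L + 2) ^ 2 ≤ 9 * L ^ 2 := by nlinarith
    have h11 : 9 * L ^ 2 ≤ n := by
      rw [← h.dense.hq]
      nlinarith [h.dense.q_large]
    nlinarith
  have : (n : ℝ) ≤ n * (n * e) := by nlinarith
  nlinarith

lemma mean_cross (h : StepHyp n L lm q d p D e) (hY : DegLE Y (D - 4)) (hab : a ≠ b)
    (hv : v ∈ free Y a b) :
    |mean d Y (fun G => sg a b v G * (ssum Y a b G - ∑ x ∈ free Y a b, sgp p a b x))|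
      ≤ 40 * L * n * e := by
  have hYL := hY.mono (by linarith [h.hD] : D - 4 ≤ L)
  have hne := fam_nonempty h.dense Y hYL
  have hL := h.dense.hL
  have hn := h.dense.n_pos
  have hY2 := hY.mono (by linarith : D - 4 ≤ D - 2)
  have he := h.e_pos
  have h1 : mean d Y (fun G => sg a b v G * (ssum Y a b G - ∑ x ∈ free Y a b, sgp p a b x))
      = ∑ x ∈ free Y a b, mean d Y (fun G => sg a b v G * (sg a b x G - sgp p a b x))
        + mean d Y (fun G => sg a b v G * rest Y a b G) := by
    rw [← mean_sum, ← mean_add]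
    refine mean_congr fun G hG => ?_
    rw [ssum_eq_free (mem_fam.1 hG).2, ← mul_sum, sum_sub_distrib]
    ring
  have h2 : ∀ x ∈ free Y a b,
      |mean d Y (fun G => sg a b v G * (sg a b x G - sgp p a b x))| ≤ 36 * e + ind (x = v) := by
    intro x hx
    have qx0 := sgp_nonneg h.p_nonneg h.p_le_one a b x
    have qx1 := sgp_le_one h.p_nonneg h.p_le_one a b x
    by_cases hxv : x = v
    · rw [ind_true hxv]
      refine (abs_mean_le_of_le zero_le_one fun G _ => ?_).trans (by linarith)
      have s0 := sg_nonneg a b v G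
      have s1 := sg_le_one a b v G
      have := sg_nonneg a b x G
      have := sg_le_one a b x G
      rw [abs_mul]
      refine mul_le_one₀ ?_ (abs_nonneg _) ?_ <;> rw [abs_le] <;> constructor <;> linarith
    · rw [ind_false hxv, add_zero]
      have e1 : mean d Y (fun G => sg a b v G * (sg a b x G - sgp p a b x))
          = (mean d Y (fun G => sg a b v G * sg a b x G) - sgp p a b v * sgp p a b x)
            - sgp p a b x * (mean d Y (fun G => sg a b v G) - sgp p a b v) := by
        rw [show mean d Y (fun G => sg a b v G * (sg a b x G - sgp p a b x))
          = mean d Y (fun G => sg a b v G * sg a b x G - sgp p a b x * sg a b v G) from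
            mean_congr fun G _ => by ring]
        rw [mean_sub, mean_const_mul]
        ring
      have t1 := mean_sg_sg h.dense h.ap h.hD h.p_nonneg h.p_le_one hY hab hv hx hxv
      have t2 := mean_sg h.dense h.ap h.hD h.p_nonneg h.p_le_one hY2 hab hv
      rw [e1]
      refine (abs_sub _ _).trans ?_
      rw [abs_mul, abs_of_nonneg qx0]
      have : sgp p a b x * |mean d Y (fun G => sg a b v G) - sgp p a b v| ≤ 1 * (6 * e) := by
        gcongr
      linarith
  have h3 : |∑ x ∈ free Y a b, mean d Y (fun G => sg a b v G * (sg a b x G - sgp p a b x))|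
      ≤ n * (36 * e) + 1 := by
    refine (abs_sum_le_sum_abs _ _).trans ((sum_le_sum h2).trans ?_)
    refine (sum_le_univ_sum_of_nonneg fun x => ?_).trans (le_of_eq ?_)
    · exact add_nonneg (by positivity) (ind_nonneg _)
    · rw [sum_add_distrib, sum_ind_eq]; simp
  have h4 : |mean d Y (fun G => sg a b v G * rest Y a b G)| ≤ 2 * L + 2 := by
    refine abs_mean_le_of_le (by linarith) fun G _ => ?_
    rw [abs_of_nonneg (mul_nonneg (sg_nonneg ..) (rest_nonneg ..))]
    have := rest_le hYL a b G
    have := rest_nonneg Y a b G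
    have := sg_le_one a b v G
    nlinarith
  rw [h1]
  refine (abs_add_le _ _).trans ?_
  have h6 := h.one_le_ne
  nlinarith

/-- The normalised switching weight is approximately that of independent edges. -/
lemma mean_sig_div (h : StepHyp n L lm q d p D e) (hY : DegLE Y (D - 4)) (hab : a ≠ b)
    (hv : v ∈ free Y a b) :
    |mean d Y (fun G => sig Y a b v G / ssum Y a b G)
      - sgp p a b v / ∑ x ∈ free Y a b, sgp p a b x| ≤ L ^ 9 * e / n := by
  have hYL := hY.mono (by linarith [h.hD] : D - 4 ≤ L)
  have hne := fam_nonempty h.dense Y hYL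
  have hL := h.dense.hL
  have hL0 := h.dense.L_pos
  have hn := h.dense.n_pos
  have hY2 := hY.mono (by linarith : D - 4 ≤ D - 2)
  have he := h.e_pos
  have hone := h.one_le_ne
  have hS := h.sum_sgp_ge hY a b
  have hsq := h.mean_sq hY hab
  have hcr := h.mean_cross hY hab hv
  have hsg := mean_sg h.dense h.ap h.hD h.p_nonneg h.p_le_one hY2 hab hv
  have htl := tail_bound h.dense hYL hab
  set S := ∑ x ∈ free Y a b, sgp p a b x with hSdef
  have hS1 : S ≤ n := by
    refine le_trans ?_ (card_free_le Y a b)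
    rw [hSdef, card_eq_sum_ones]
    push_cast
    exact sum_le_sum fun x _ => sgp_le_one h.p_nonneg h.p_le_one a b x
  have hS0 : 0 < S := lt_of_lt_of_le (by positivity) hS
  set t : SimpleGraph (Fin n) → ℝ := fun G =>
    (ssum Y a b G - S) ^ 2 * (sig Y a b v G / ssum Y a b G) with ht
  have e1 : mean d Y (fun G => sig Y a b v G / ssum Y a b G)
      = mean d Y (fun G => sg a b v G) / S
        - mean d Y (fun G => sg a b v G * (ssum Y a b G - S)) / S ^ 2
        + mean d Y t / S ^ 2 := by
    rw [div_eq_mul_inv, div_eq_mul_inv, div_eq_mul_inv, ← mean_mul_const, ← mean_mul_const,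
      ← mean_mul_const, ← mean_sub, ← mean_add]
    refine mean_congr fun G hG => ?_
    rw [← sig_eq_sg (mem_fam.1 hG).2 hv, ht]
    simp only
    by_cases h0 : ssum Y a b G = 0
    · have : sig Y a b v G = 0 :=
        le_antisymm (h0 ▸ sig_le_ssum Y a b v G) (sig_nonneg ..)
      rw [this]; simp
    · field_simp
      ring
  have ht0 : 0 ≤ mean d Y t :=
    mean_nonneg fun G _ => mul_nonneg (sq_nonneg _) (sig_div_nonneg ..)
  have ht1 : mean d Y t ≤ 181 * n * e * L ^ 3 := by
    have a1 : mean d Y t ≤ mean d Y (fun G => (ssum Y a b G - S) ^ 2 * (2 * L ^ 3 / n)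
        + n ^ 2 * ind (ssum Y a b G ≤ n / (2 * L ^ 3))) := by
      refine mean_mono fun G _ => ?_
      have b1 := sig_div_le h.dense Y a b v G
      have b2 : (ssum Y a b G - S) ^ 2 ≤ n ^ 2 := by
        rw [sq_le_sq, abs_of_pos hn, abs_le]
        have := ssum_nonneg Y a b G
        have := ssum_le Y a b G
        constructor <;> linarith
      calc t G ≤ (ssum Y a b G - S) ^ 2
            * (2 * L ^ 3 / n + ind (ssum Y a b G ≤ n / (2 * L ^ 3))) := by
            rw [ht]; simp only; gcongr
        _ = (ssum Y a b G - S) ^ 2 * (2 * L ^ 3 / n)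
            + (ssum Y a b G - S) ^ 2 * ind (ssum Y a b G ≤ n / (2 * L ^ 3)) := by ring
        _ ≤ _ := by
            have := ind_nonneg (ssum Y a b G ≤ n / (2 * L ^ 3))
            gcongr
    rw [mean_add, mean_mul_const, mean_const_mul] at a1
    have a2 : (n : ℝ) ^ 2 * (2 / q ^ 10) ≤ 1 := by
      rw [← h.dense.hq, ← mul_div_assoc, div_le_one (by have := h.dense.hq0; positivity)]
      have := h.dense.q_large
      calc (q ^ 2) ^ 2 * 2 ≤ (q ^ 2) ^ 2 * q ^ 6 := by
            gcongr; exact le_trans (by linarith) (le_self_pow₀ (by linarith) (by norm_num))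
        _ = q ^ 10 := by ring
    have a3 : (n : ℝ) ^ 2 * mean d Y (fun G => ind (ssum Y a b G ≤ n / (2 * L ^ 3)))
        ≤ n ^ 2 * (2 / q ^ 10) := by gcongr
    have a4 : mean d Y (fun G => (ssum Y a b G - S) ^ 2) * (2 * L ^ 3 / n)
        ≤ 90 * n ^ 2 * e * (2 * L ^ 3 / n) := by gcongr
    have a5 : 90 * n ^ 2 * e * (2 * L ^ 3 / n) = 180 * n * e * L ^ 3 := by field_simp; norm_num
    have a6 : 1 ≤ n * e * L ^ 3 := by
      have : 1 ≤ L ^ 3 := one_le_pow₀ (by linarith)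
      nlinarith
    linarith
  have hSi : 1 / S ≤ 8 * L ^ 2 / n := by
    rw [div_le_div_iff₀ hS0 hn]
    rw [div_le_iff₀ (by positivity)] at hS
    linarith
  have hSi2 : 1 / S ^ 2 ≤ 64 * L ^ 4 / n ^ 2 := by
    calc 1 / S ^ 2 = (1 / S) ^ 2 := by rw [div_pow, one_pow]
      _ ≤ (8 * L ^ 2 / n) ^ 2 := by gcongr
      _ = _ := by rw [div_pow, mul_pow]; ring_nf
  have hd : mean d Y (fun G => sig Y a b v G / ssum Y a b G) - sgp p a b v / S
      = (mean d Y (fun G => sg a b v G) - sgp p a b v) * (1 / S)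
        - mean d Y (fun G => sg a b v G * (ssum Y a b G - S)) * (1 / S ^ 2)
        + mean d Y t * (1 / S ^ 2) := by rw [e1]; ring
  rw [hd]
  have c1 : |(mean d Y (fun G => sg a b v G) - sgp p a b v) * (1 / S)|
      ≤ 6 * e * (8 * L ^ 2 / n) := by
    rw [abs_mul, abs_of_pos (show 0 < 1 / S by positivity)]; gcongr
  have c2 : |mean d Y (fun G => sg a b v G * (ssum Y a b G - S)) * (1 / S ^ 2)|
      ≤ 40 * L * n * e * (64 * L ^ 4 / n ^ 2) := by
    rw [abs_mul, abs_of_pos (show 0 < 1 / S ^ 2 by positivity)]; gcongr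
  have c3 : |mean d Y t * (1 / S ^ 2)| ≤ 181 * n * e * L ^ 3 * (64 * L ^ 4 / n ^ 2) := by
    rw [abs_mul, abs_of_pos (show 0 < 1 / S ^ 2 by positivity), abs_of_nonneg ht0]; gcongr
  refine (abs_add_le _ _).trans ((add_le_add ((abs_sub _ _).trans (add_le_add c1 c2)) c3).trans ?_)
  have c4 : 6 * e * (8 * L ^ 2 / n) + 40 * L * n * e * (64 * L ^ 4 / n ^ 2)
      + 181 * n * e * L ^ 3 * (64 * L ^ 4 / n ^ 2)
      = (48 * L ^ 2 + 2560 * L ^ 5 + 11584 * L ^ 7) * (e / n) := by field_simp; ring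
  rw [c4, mul_div_assoc]
  refine mul_le_mul_of_nonneg_right ?_ (by positivity)
  have d1 : L ^ 2 ≤ L ^ 7 := pow_le_pow_right₀ (by linarith) (by norm_num)
  have d2 : L ^ 5 ≤ L ^ 7 := pow_le_pow_right₀ (by linarith) (by norm_num)
  have d3 : 1000000 * L ^ 7 ≤ L ^ 9 := by
    have : (1000 : ℝ) ^ 2 ≤ L ^ 2 := by gcongr
    calc 1000000 * L ^ 7 ≤ L ^ 2 * L ^ 7 := by gcongr; linarith
      _ = L ^ 9 := by ring
  have : 0 ≤ L ^ 7 := by positivity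
  linarith

end StepHyp

end Step

section LevelOne

open Finset

variable {n : ℕ} {L lm q : ℝ} {d : Fin n → ℕ} {Y G : SimpleGraph (Fin n)}

/-- Deviation of a degree from `lm * (n - 1)`. -/
def dev (lm : ℝ) (d : Fin n → ℕ) (x : Fin n) : ℝ := d x - lm * (n - 1)

lemma Dense.abs_dev_le (h : Dense n L lm q d) (x : Fin n) : |dev lm d x| ≤ L * q := h.hd x

lemma Dense.sum_dev (h : Dense n L lm q d) : ∑ x, dev lm d x = 0 := by
  simp only [dev, sum_sub_distrib, h.hsum, sum_const, card_univ, Fintype.card_fin, nsmul_eq_mul]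
  ring

lemma abs_sum_free_sub (hY : DegLE Y L) (a b : Fin n) {f : Fin n → ℝ} {M : ℝ}
    (hf : ∀ x, |f x| ≤ M) (hM : 0 ≤ M) :
    |∑ x ∈ free Y a b, f x - ∑ x, f x| ≤ (2 * L + 2) * M := by
  rw [← sum_sdiff (subset_univ (free Y a b)), abs_sub_comm, add_sub_cancel_right]
  refine (abs_sum_le_sum_abs _ _).trans ((sum_le_sum fun x _ => hf x).trans ?_)
  rw [sum_const, nsmul_eq_mul]
  gcongr
  have h2 : ((univ \ free Y a b).card : ℝ) + (free Y a b).card = n := by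
    rw [← Nat.cast_add, card_sdiff_add_card_eq_card (subset_univ _), card_univ, Fintype.card_fin]
  linarith [card_free hY a b]

lemma sum_wt_mul (Y : SimpleGraph (Fin n)) (v : Fin n) (f : Fin n → ℝ) :
    ∑ x, wt Y v x * f x = ∑ x, f x - f v - ∑ x, ind (Y.Adj x v) * f x := by
  rw [← sum_ind_eq_mul v f, ← sum_sub_distrib, ← sum_sub_distrib]
  exact sum_congr rfl fun x _ => by rw [wt]; ring

lemma abs_sum_adj_mul_le (hY : DegLE Y L) (v : Fin n) {f : Fin n → ℝ} {M : ℝ}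
    (hf : ∀ x, |f x| ≤ M) (hM : 0 ≤ M) : |∑ x, ind (Y.Adj x v) * f x| ≤ L * M := by
  refine (abs_sum_le_sum_abs _ _).trans ?_
  calc ∑ x, |ind (Y.Adj x v) * f x| ≤ ∑ x, ind (Y.Adj v x) * M := by
        refine sum_le_sum fun x _ => ?_
        rw [abs_mul, abs_of_nonneg (ind_nonneg _), ind_adj_comm]
        exact mul_le_mul_of_nonneg_left (hf x) (ind_nonneg _)
    _ = deg Y v * M := by rw [← sum_mul, ← deg_eq_sum]
    _ ≤ L * M := by gcongr; exact hY v

lemma stepHyp_zero (h : Dense n L lm q d) : StepHyp n L lm q d (fun _ _ => lm) L (L ^ 5 / q) where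
  dense := h
  ap _ hY _ _ hxz hYxz := pr_level_zero h hY hxz hYxz
  hD := le_rfl
  hp0 _ _ := (one_div_le_one_div_of_le h.L_pos (by linarith [h.L_pos])).trans h.hlm
  hp1 _ _ := by
    have := (one_div_le_one_div_of_le h.L_pos (by linarith [h.L_pos] : L ≤ 2 * L)).trans h.hlm'
    linarith
  he := by
    have hq0 := h.hq0
    have : 1 ≤ L ^ 5 := one_le_pow₀ (by linarith [h.hL])
    rw [← h.hq, div_le_div_iff₀ (by positivity) hq0]
    have := h.q_large
    nlinarith

lemma mean_sig_div_one (h : Dense n L lm q d) (hY : DegLE Y (L - 4)) {a b v : Fin n}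
    (hab : a ≠ b) (hv : v ∈ free Y a b) :
    |mean d Y (fun G => sig Y a b v G / ssum Y a b G) - 1 / n| ≤ L ^ 15 / (q * n) := by
  have hL := h.hL
  have hL0 := h.L_pos
  have hq0 := h.hq0
  have hn := h.n_pos
  have h1 := (stepHyp_zero h).mean_sig_div hY hab hv
  have hA : 0 < lm * (1 - lm) := mul_pos h.lm_pos (by linarith [h.lm_lt])
  have hfree := card_free (hY.mono (by linarith : L - 4 ≤ L)) a b
  have hLn := h.L_le_n
  have e1 : sgp (fun _ _ : Fin n => lm) a b v / ∑ x ∈ free Y a b, sgp (fun _ _ => lm) a b x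
      = 1 / (free Y a b).card := by
    simp only [sgp, sum_const, nsmul_eq_mul]
    have : lm + lm - 2 * (lm * lm) = 2 * (lm * (1 - lm)) := by ring
    rw [this, mul_comm _ (2 * _), ← div_div, div_self (by positivity)]
  rw [e1] at h1
  set c : ℝ := ((free Y a b).card : ℝ) with hc
  have hc0 : (n : ℝ) / 2 ≤ c := by linarith
  have hcpos : 0 < c := by linarith
  have e2 : |1 / c - 1 / n| ≤ L ^ 2 / (q * n) := by
    have hcn : c ≤ n := card_free_le Y a b
    rw [div_sub_div _ _ hcpos.ne' hn.ne', abs_of_nonneg (div_nonneg (by linarith) (by positivity)),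
      div_le_div_iff₀ (by positivity) (by positivity)]
    have : (1 * (n : ℝ) - c * 1) ≤ 3 * L := by linarith
    have hq1 := h.q_large
    calc (1 * (n : ℝ) - c * 1) * (q * n) ≤ (3 * L) * (q * n) := by gcongr
      _ ≤ L ^ 2 * ((n / 2) * n) := by
          rw [← h.hq]
          have : 3 * L * 2 ≤ L ^ 2 * q := by nlinarith
          have : 0 ≤ q ^ 3 := by positivity
          nlinarith
      _ ≤ _ := by gcongr
  have e3 : L ^ 9 * (L ^ 5 / q) / n = L ^ 14 / (q * n) := by field_simp
  rw [e3] at h1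
  have := abs_sub_le (mean d Y (fun G => sig Y a b v G / ssum Y a b G)) (1 / c) (1 / n)
  refine this.trans ((add_le_add h1 e2).trans ?_)
  rw [← add_div]
  gcongr
  have d1 : L ^ 2 ≤ L ^ 14 := pow_le_pow_right₀ (by linarith) (by norm_num)
  have : 0 ≤ L ^ 14 := by positivity
  calc L ^ 14 + L ^ 2 ≤ L ^ 14 * 1000 := by linarith
    _ ≤ L ^ 14 * L := by gcongr
    _ = L ^ 15 := by ring

lemma mem_free_of {a b v : Fin n} (ha : a ≠ v) (hb : b ≠ v) (hYa : ¬ Y.Adj a v)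
    (hYb : ¬ Y.Adj b v) : v ∈ free Y a b := mem_free.2 ⟨ha.symm, hb.symm, hYa, hYb⟩

lemma pr_level_one (h : Dense n L lm q d) (hY : DegLE Y (L - 4)) {a v : Fin n}
    (hav : a ≠ v) (hYav : ¬ Y.Adj a v) :
    |pr d Y a v - (lm + (dev lm d a + dev lm d v) / n)| ≤ L ^ 18 / n := by
  have hL := h.hL
  have hL0 := h.L_pos
  have hq0 := h.hq0
  have hq1 := h.q_large
  have hn := h.n_pos
  have hLn := h.L_le_n
  have hYL := hY.mono (by linarith : L - 4 ≤ L)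
  have hne := fam_nonempty h Y hYL
  have diff : ∀ a b, a ≠ v → b ≠ v → ¬ Y.Adj a v → ¬ Y.Adj b v → a ≠ b →
      |pr d Y a v - pr d Y b v - (dev lm d a / n - dev lm d b / n)| ≤ L ^ 17 / n := by
    intro a b ha hb hYa hYb hab
    rw [pr_sub_pr Y d ha.symm hb.symm hYa hYb]
    have h1 := mean_sig_div_one h hY hab (mem_free_of ha hb hYa hYb)
    have h2 := mean_sig_div_le h hYL hne hab v
    have e1 : mean d Y (fun G => sig Y a b v G * (mvs Y a b G - mvs Y b a G) / ssum Y a b G)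
        = (dev lm d a - dev lm d b) * mean d Y (fun G => sig Y a b v G / ssum Y a b G)
        + mean d Y (fun G => (mvs Y a b G - mvs Y b a G - (dev lm d a - dev lm d b)) *
            (sig Y a b v G / ssum Y a b G)) := by
      rw [← mean_const_mul, ← mean_add]
      exact mean_congr fun G _ => by ring
    have h3 : |mean d Y (fun G => (mvs Y a b G - mvs Y b a G - (dev lm d a - dev lm d b)) *
            (sig Y a b v G / ssum Y a b G))| ≤ L * (3 * L ^ 3 / n) := by
      refine le_trans (b := mean d Y (fun G => L * (sig Y a b v G / ssum Y a b G))) ?_ ?_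
      · refine abs_mean_le fun G hG => ?_
        rw [abs_mul, abs_of_nonneg (sig_div_nonneg ..)]
        refine mul_le_mul_of_nonneg_right ?_ (sig_div_nonneg ..)
        rw [mvs_sub_mvs hab hG, dev, dev, abs_le]
        have := sum_ind_mul_le Y G a b
        have := sum_ind_mul_le Y G b a
        have := sum_ind_mul_nonneg Y G a b
        have := sum_ind_mul_nonneg Y G b a
        constructor <;> linarith [hYL a, hYL b]
      · rw [mean_const_mul]; gcongr
    rw [e1]
    set μ := mean d Y (fun G => sig Y a b v G / ssum Y a b G)
    have hda := h.abs_dev_le a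
    have hdb := h.abs_dev_le b
    have h4 : |(dev lm d a - dev lm d b) * (μ - 1 / n)| ≤ 2 * L * q * (L ^ 15 / (q * n)) := by
      rw [abs_mul]
      refine mul_le_mul ?_ h1 (abs_nonneg _) (by positivity)
      exact (abs_sub _ _).trans (by linarith)
    rw [show ∀ x : ℝ, (dev lm d a - dev lm d b) * μ + x - (dev lm d a / n - dev lm d b / n)
      = (dev lm d a - dev lm d b) * (μ - 1 / n) + x from fun x => by ring]
    refine (abs_add_le _ _).trans ((add_le_add h4 h3).trans ?_)
    have e2 : 2 * L * q * (L ^ 15 / (q * n)) + L * (3 * L ^ 3 / n)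
        = (2 * L ^ 16 + 3 * L ^ 4) / n := by field_simp
    rw [e2]
    gcongr
    have d1 : L ^ 4 ≤ L ^ 16 := pow_le_pow_right₀ (by linarith) (by norm_num)
    have : 0 ≤ L ^ 16 := by positivity
    calc 2 * L ^ 16 + 3 * L ^ 4 ≤ L ^ 16 * 1000 := by linarith
      _ ≤ L ^ 16 * L := by gcongr
      _ = L ^ 17 := by ring
  have hav' := average_bound hne diff (by positivity) hav hYav
  rw [sum_wt_mul] at hav'
  simp only [← mul_div_assoc, ← sum_div, h.sum_dev] at hav'
  rw [mul_div_assoc] at hav'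
  have hnb := abs_sum_adj_mul_le hYL v h.abs_dev_le (by positivity)
  have hdv := h.abs_dev_le v
  have hyv := hYL v
  have hyv0 : (0 : ℝ) ≤ deg Y v := Nat.cast_nonneg _
  set N := ∑ x, ind (Y.Adj x v) * dev lm d x
  set c : ℝ := n - 1 - deg Y v with hc
  have hc1 : (n : ℝ) / 2 ≤ c := by rw [hc]; linarith
  have hc0 : 0 < c := by linarith
  have key : |c * (pr d Y a v - (lm + (dev lm d a + dev lm d v) / n))|
      ≤ c * (L ^ 17 / n) + 5 * L := by
    have e : c * (pr d Y a v - (lm + (dev lm d a + dev lm d v) / n))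
        = (c * (pr d Y a v - dev lm d a / n)
            - ((d v - deg Y v) - (0 / n - dev lm d v / n - N / n)))
          + (- (1 - lm) * deg Y v + (deg Y v + 2) * (dev lm d v / n) + N / n) := by
      rw [hc, show (d v : ℝ) = dev lm d v + lm * (n - 1) by rw [dev]; ring]; field_simp; ring
    rw [e]
    refine (abs_add_le _ _).trans (add_le_add hav' ?_)
    have hLLq : L * (L * q) / n ≤ 1 := by
      rw [div_le_one hn, ← h.hq]
      have := h.pow_le (k := 2) (by norm_num)
      nlinarith
    have t1 : |-(1 - lm) * (deg Y v : ℝ)| ≤ L := by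
      rw [abs_mul, abs_neg, abs_of_pos (by linarith [h.lm_lt]), abs_of_nonneg hyv0]
      nlinarith [h.lm_pos]
    have t2 : |((deg Y v : ℝ) + 2) * (dev lm d v / n)| ≤ 2 := by
      rw [abs_mul, abs_of_nonneg (by linarith), abs_div, abs_of_pos hn]
      calc ((deg Y v : ℝ) + 2) * (|dev lm d v| / n) ≤ (2 * L) * (L * q / n) := by
            gcongr; linarith
        _ = 2 * (L * (L * q) / n) := by ring
        _ ≤ 2 := by linarith
    have t3 : |N / n| ≤ 1 := by
      rw [abs_div, abs_of_pos hn]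
      exact (div_le_div_of_nonneg_right hnb hn.le).trans hLLq
    refine (abs_add_le _ _).trans ((add_le_add ((abs_add_le _ _).trans (add_le_add t1 t2)) t3).trans ?_)
    linarith
  rw [abs_mul, abs_of_pos hc0] at key
  have e3 : 5 * L ≤ c * (10 * L / n) := by
    calc 5 * L = (n / 2) * (10 * L / n) := by field_simp; norm_num
      _ ≤ _ := by gcongr
  have : c * |pr d Y a v - (lm + (dev lm d a + dev lm d v) / n)|
      ≤ c * (L ^ 17 / n + 10 * L / n) := by linarith
  refine (le_of_mul_le_mul_left this hc0).trans ?_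
  rw [← add_div]
  gcongr
  have d1 : L ≤ L ^ 17 := le_self_pow₀ (by linarith) (by norm_num)
  have : 0 ≤ L ^ 17 := by positivity
  calc L ^ 17 + 10 * L ≤ L ^ 17 * 1000 := by linarith
    _ ≤ L ^ 17 * L := by gcongr
    _ = L ^ 18 := by ring

end LevelOne

section LevelTwo

open Finset

variable {n : ℕ} {L lm q : ℝ} {d : Fin n → ℕ} {Y G : SimpleGraph (Fin n)}

/-- First order approximation of the edge probabilities. -/
noncomputable def pone (lm : ℝ) (d : Fin n → ℕ) (x z : Fin n) : ℝ :=
  lm + (dev lm d x + dev lm d z) / n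

lemma Dense.pow_div_le (h : Dense n L lm q d) {i j k : ℕ} (hk : i + j ≤ k) (hk' : k ≤ 100) :
    L ^ i / q ≤ 1 / L ^ j := by
  have hL0 := h.L_pos
  rw [div_le_div_iff₀ h.hq0 (by positivity), ← pow_add, one_mul]
  exact h.pow_le (hk.trans hk')

lemma abs_dev_div_le (h : Dense n L lm q d) (x : Fin n) : |dev lm d x / n| ≤ L / q := by
  have hq0 := h.hq0
  rw [abs_div, abs_of_pos h.n_pos]
  calc |dev lm d x| / n ≤ L * q / n := by
        have := h.n_pos
        gcongr; exact h.abs_dev_le x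
    _ = L / q := by rw [← h.hq]; field_simp

lemma stepHyp_one (h : Dense n L lm q d) :
    StepHyp n L lm q d (pone lm d) (L - 4) (L ^ 18 / n) := by
  have hL := h.hL
  have hL0 := h.L_pos
  have key : ∀ x z : Fin n, |(dev lm d x + dev lm d z) / n| ≤ 1 / (2 * L) := by
    intro x z
    rw [add_div]
    refine (abs_add_le _ _).trans ((add_le_add (abs_dev_div_le h x) (abs_dev_div_le h z)).trans ?_)
    have := h.pow_div_le (i := 1) (j := 2) (k := 3) (by norm_num) (by norm_num)
    rw [pow_one] at this
    have e : 1 / L ^ 2 ≤ 1 / (4 * L) := by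
      apply one_div_le_one_div_of_le (by positivity); nlinarith
    have e2 : 1 / (4 * L) + 1 / (4 * L) = 1 / (2 * L) := by field_simp; norm_num
    linarith
  have e3 : 1 / L = 1 / (2 * L) + 1 / (2 * L) := by field_simp; norm_num
  refine ⟨h, fun Y hY x z hxz hYxz => pr_level_one h hY hxz hYxz, by linarith, ?_, ?_, ?_⟩
  · intro x z
    have := (abs_le.1 (key x z)).1
    unfold pone
    linarith [h.hlm]
  · intro x z
    have := (abs_le.1 (key x z)).2
    unfold pone
    linarith [h.hlm']
  · have := h.n_pos
    gcongr
    exact one_le_pow₀ (by linarith)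

/-- Second order approximation of the normalised switching weight. -/
noncomputable def wone (lm : ℝ) (d : Fin n → ℕ) (v : Fin n) : ℝ :=
  (1 + (1 - 2 * lm) * dev lm d v / (lm * (1 - lm) * n)) / n

lemma Dense.inv_var_le (h : Dense n L lm q d) : 1 / (lm * (1 - lm)) ≤ 2 * L := by
  have hL0 := h.L_pos
  have h0 := h.lm_pos
  have h1 : 0 < 1 - lm := by linarith [h.lm_lt]
  have e : 1 / (lm * (1 - lm)) = 1 / lm + 1 / (1 - lm) := by field_simp; ring
  have a1 : 1 / lm ≤ L := by
    have := h.hlm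
    rw [div_le_iff₀ hL0] at this
    rw [div_le_iff₀ h0]; linarith
  have a2 : 1 / (1 - lm) ≤ L := by
    have := h.hlm'
    rw [div_le_iff₀ hL0] at this
    rw [div_le_iff₀ h1]; linarith
  linarith

lemma abs_skew_le (h : Dense n L lm q d) : |1 - 2 * lm| ≤ 1 := by
  rw [abs_le]; constructor <;> linarith [h.lm_pos, h.lm_lt]

lemma abs_wone_corr_le (h : Dense n L lm q d) (v : Fin n) :
    |(1 - 2 * lm) * dev lm d v / (lm * (1 - lm) * n)| ≤ 2 * L ^ 2 / q := by
  have hL0 := h.L_pos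
  have hq0 := h.hq0
  have hA : 0 < 1 / (lm * (1 - lm)) := by
    have := h.lm_pos
    have : 0 < 1 - lm := by linarith [h.lm_lt]
    positivity
  have e : (1 - 2 * lm) * dev lm d v / (lm * (1 - lm) * n)
      = (1 - 2 * lm) * ((dev lm d v / n) * (1 / (lm * (1 - lm)))) := by
    rw [div_mul_div_comm, mul_one, mul_div_assoc, mul_comm (n : ℝ)]
  rw [e, abs_mul, abs_mul, abs_of_pos hA]
  calc |1 - 2 * lm| * (|dev lm d v / n| * (1 / (lm * (1 - lm)))) ≤ 1 * (L / q * (2 * L)) := by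
        gcongr
        · exact abs_skew_le h
        · exact abs_dev_div_le h v
        · exact h.inv_var_le
    _ = _ := by ring

lemma abs_wone_le (h : Dense n L lm q d) (v : Fin n) : |wone lm d v| ≤ 2 / n := by
  have hn := h.n_pos
  rw [wone, abs_div, abs_of_pos hn]
  gcongr
  refine (abs_add_le _ _).trans ?_
  have := abs_wone_corr_le h v
  have h1 := h.pow_div_le (i := 2) (j := 1) (k := 3) (by norm_num) (by norm_num)
  have h2 : 1 / L ^ 1 ≤ 1 / 1000 := by
    rw [pow_one]; exact one_div_le_one_div_of_le (by norm_num) h.hL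
  rw [abs_one]
  have : 2 * L ^ 2 / q = 2 * (L ^ 2 / q) := by ring
  linarith

lemma sgp_pone_bound (h : Dense n L lm q d) (a b x : Fin n) :
    |sgp (pone lm d) a b x - (2 * (lm * (1 - lm))
      + (1 - 2 * lm) * ((dev lm d a + dev lm d b) / n + 2 * (dev lm d x / n)))|
      ≤ 8 * (L ^ 2 / n) := by
  have hL0 := h.L_pos
  have hq0 := h.hq0
  have e : sgp (pone lm d) a b x - (2 * (lm * (1 - lm))
      + (1 - 2 * lm) * ((dev lm d a + dev lm d b) / n + 2 * (dev lm d x / n)))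
      = - 2 * ((dev lm d a / n + dev lm d x / n) * (dev lm d b / n + dev lm d x / n)) := by
    unfold sgp pone; ring
  have ea := abs_dev_div_le h a
  have eb := abs_dev_div_le h b
  have ex := abs_dev_div_le h x
  rw [e, abs_mul, abs_mul, abs_neg, abs_two]
  calc 2 * (|dev lm d a / n + dev lm d x / n| * |dev lm d b / n + dev lm d x / n|)
      ≤ 2 * ((L / q + L / q) * (L / q + L / q)) := by
        gcongr
        · exact (abs_add_le _ _).trans (add_le_add ea ex)
        · exact (abs_add_le _ _).trans (add_le_add eb ex)
    _ = 8 * (L ^ 2 / n) := by rw [← h.hq]; ring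

lemma sum_sgp_pone_bound (h : Dense n L lm q d) (hY : DegLE Y L) (a b : Fin n) :
    |∑ x ∈ free Y a b, sgp (pone lm d) a b x - (n * (2 * (lm * (1 - lm))
      + (1 - 2 * lm) * ((dev lm d a + dev lm d b) / n)))| ≤ 12 * L ^ 2 := by
  have hL := h.hL
  have hL0 := h.L_pos
  have hq0 := h.hq0
  have hn := h.n_pos
  set B := 2 * (lm * (1 - lm)) + (1 - 2 * lm) * ((dev lm d a + dev lm d b) / n) with hB
  have hfree := card_free hY a b
  have hfree' := card_free_le Y a b
  have hA0 : 0 ≤ lm * (1 - lm) := mul_nonneg h.lm_pos.le (by linarith [h.lm_lt])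
  have hA1 : lm * (1 - lm) ≤ 1 / 4 := by nlinarith [sq_nonneg (lm - 1 / 2)]
  have hLq : L / q ≤ 1 / 1000 := by
    have h1 := h.pow_div_le (i := 1) (j := 1) (k := 2) (by norm_num) (by norm_num)
    have h2 : 1 / L ^ 1 ≤ 1 / 1000 := by
      rw [pow_one]; exact one_div_le_one_div_of_le (by norm_num) h.hL
    rw [pow_one] at h1 h2
    linarith
  have hsk := abs_skew_le h
  have hB1 : |B| ≤ 1 := by
    rw [hB]
    refine (abs_add_le _ _).trans ?_
    rw [abs_mul _ ((dev lm d a + dev lm d b) / n), abs_of_nonneg (by positivity), add_div]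
    have := (abs_add_le (dev lm d a / n) (dev lm d b / n)).trans
      (add_le_add (abs_dev_div_le h a) (abs_dev_div_le h b))
    have : |1 - 2 * lm| * |dev lm d a / n + dev lm d b / n| ≤ 1 * (L / q + L / q) := by gcongr
    linarith
  have t1 : |∑ x ∈ free Y a b, (sgp (pone lm d) a b x - (B + (1 - 2 * lm) * (2 * (dev lm d x / n))))|
      ≤ 8 * L ^ 2 := by
    refine (abs_sum_le_sum_abs _ _).trans ((sum_le_sum (g := fun _ => 8 * (L ^ 2 / n)) fun x _ => ?_).trans ?_)
    · refine le_trans (le_of_eq ?_) (sgp_pone_bound h a b x)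
      congr 1
      rw [hB]; ring
    · rw [sum_const, nsmul_eq_mul]
      calc ((free Y a b).card : ℝ) * (8 * (L ^ 2 / n)) ≤ n * (8 * (L ^ 2 / n)) := by gcongr
        _ = 8 * L ^ 2 := by field_simp
  have t2 : |∑ x ∈ free Y a b, dev lm d x - 0| ≤ (2 * L + 2) * (L * q) := by
    rw [← h.sum_dev]
    exact abs_sum_free_sub hY a b h.abs_dev_le (by positivity)
  have e : ∑ x ∈ free Y a b, sgp (pone lm d) a b x - n * B
      = ∑ x ∈ free Y a b, (sgp (pone lm d) a b x - (B + (1 - 2 * lm) * (2 * (dev lm d x / n))))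
        + (-((n - (free Y a b).card) * B)
          + (1 - 2 * lm) * (2 / n * (∑ x ∈ free Y a b, dev lm d x - 0))) := by
    rw [sum_sub_distrib, sum_add_distrib, sum_const, nsmul_eq_mul, ← mul_sum, ← mul_sum, ← sum_div]
    ring
  rw [e]
  have t3 : |-((n - (free Y a b).card) * B)| ≤ 2 * L + 2 := by
    rw [abs_neg, abs_mul, abs_of_nonneg (by linarith)]
    calc (n - ((free Y a b).card : ℝ)) * |B| ≤ (2 * L + 2) * 1 := by gcongr; linarith
      _ = _ := by ring
  have t4 : |(1 - 2 * lm) * (2 / n * (∑ x ∈ free Y a b, dev lm d x - 0))| ≤ 1 := by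
    rw [abs_mul, abs_mul, abs_of_pos (by positivity : (0:ℝ) < 2 / n)]
    calc |1 - 2 * lm| * (2 / n * |∑ x ∈ free Y a b, dev lm d x - 0|)
        ≤ 1 * (2 / n * ((2 * L + 2) * (L * q))) := by gcongr
      _ ≤ 1 * (2 / n * ((4 * L) * (L * q))) := by gcongr; linarith
      _ = 8 * (L ^ 2 / q) := by rw [← h.hq]; field_simp; norm_num
      _ ≤ 1 := by
        have h1 := h.pow_div_le (i := 2) (j := 1) (k := 3) (by norm_num) (by norm_num)
        have h2 : 1 / L ^ 1 ≤ 1 / 1000 := by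
          rw [pow_one]; exact one_div_le_one_div_of_le (by norm_num) h.hL
        linarith
  refine (abs_add_le _ _).trans ((add_le_add t1 ((abs_add_le _ _).trans (add_le_add t3 t4))).trans ?_)
  nlinarith

lemma sgp_ratio_bound (h : Dense n L lm q d) (hY : DegLE Y (L - 8)) (a b v : Fin n) :
    |sgp (pone lm d) a b v / ∑ x ∈ free Y a b, sgp (pone lm d) a b x - wone lm d v|
      ≤ L ^ 6 / n ^ 2 := by
  have hL := h.hL
  have hL0 := h.L_pos
  have hq0 := h.hq0
  have hn := h.n_pos
  have hS := (stepHyp_one h).sum_sgp_ge (hY.mono (by linarith : L - 8 ≤ L - 4 - 4)) a b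
  have h1 := sgp_pone_bound h a b v
  have h2 := sum_sgp_pone_bound h (hY.mono (by linarith : L - 8 ≤ L)) a b
  set S := ∑ x ∈ free Y a b, sgp (pone lm d) a b x
  have hS0 : 0 < S := lt_of_lt_of_le (by positivity) hS
  have hl0 := h.lm_pos
  have hl1 : 0 < 1 - lm := by linarith [h.lm_lt]
  have e : sgp (pone lm d) a b v / S - wone lm d v
      = ((sgp (pone lm d) a b v - (2 * (lm * (1 - lm))
        + (1 - 2 * lm) * ((dev lm d a + dev lm d b) / n + 2 * (dev lm d v / n))))
        - wone lm d v * (S - (n * (2 * (lm * (1 - lm))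
          + (1 - 2 * lm) * ((dev lm d a + dev lm d b) / n))))
        - ((1 - 2 * lm) * dev lm d v / (lm * (1 - lm) * n))
          * ((1 - 2 * lm) * (dev lm d a / n + dev lm d b / n))) * (1 / S) := by
    rw [wone]; field_simp; ring
  have hsk := abs_skew_le h
  have t2 : |wone lm d v * (S - (n * (2 * (lm * (1 - lm))
          + (1 - 2 * lm) * ((dev lm d a + dev lm d b) / n))))| ≤ 2 / n * (12 * L ^ 2) := by
    rw [abs_mul]
    exact mul_le_mul (abs_wone_le h v) h2 (abs_nonneg _) (by positivity)
  have t3 : |((1 - 2 * lm) * dev lm d v / (lm * (1 - lm) * n))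
          * ((1 - 2 * lm) * (dev lm d a / n + dev lm d b / n))| ≤ 2 * L ^ 2 / q * (1 * (2 * L / q)) := by
    rw [abs_mul, abs_mul (1 - 2 * lm) (_ + _)]
    have := (abs_add_le (dev lm d a / n) (dev lm d b / n)).trans
      (add_le_add (abs_dev_div_le h a) (abs_dev_div_le h b))
    have e4 : L / q + L / q = 2 * L / q := by ring
    rw [e4] at this
    have := abs_wone_corr_le h v
    gcongr
  have hSi : 1 / S ≤ 8 * L ^ 2 / n := by
    rw [div_le_div_iff₀ hS0 hn]
    rw [div_le_iff₀ (by positivity)] at hS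
    linarith
  rw [e, abs_mul, abs_of_pos (by positivity : 0 < 1 / S)]
  calc _ ≤ (8 * (L ^ 2 / n) + 2 / n * (12 * L ^ 2) + 2 * L ^ 2 / q * (1 * (2 * L / q)))
        * (8 * L ^ 2 / n) := by
        gcongr
        exact (abs_sub _ _).trans (add_le_add ((abs_sub _ _).trans (add_le_add h1 t2)) t3)
    _ = (256 * L ^ 4 + 32 * L ^ 5) / n ^ 2 := by rw [← h.hq]; field_simp; ring
    _ ≤ L ^ 6 / n ^ 2 := by
        gcongr
        have d1 : L ^ 4 ≤ L ^ 5 := pow_le_pow_right₀ (by linarith) (by norm_num)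
        have : 0 ≤ L ^ 5 := by positivity
        calc 256 * L ^ 4 + 32 * L ^ 5 ≤ L ^ 5 * 1000 := by linarith
          _ ≤ L ^ 5 * L := by gcongr
          _ = L ^ 6 := by ring

lemma mean_sig_div_two (h : Dense n L lm q d) (hY : DegLE Y (L - 8)) {a b v : Fin n}
    (hab : a ≠ b) (hv : v ∈ free Y a b) :
    |mean d Y (fun G => sig Y a b v G / ssum Y a b G) - wone lm d v| ≤ L ^ 28 / n ^ 2 := by
  have hL := h.hL
  have hn := h.n_pos
  have h1 := (stepHyp_one h).mean_sig_div (hY.mono (by linarith : L - 8 ≤ L - 4 - 4)) hab hv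
  have h2 := sgp_ratio_bound h hY a b v
  refine (abs_sub_le _ _ _).trans ((add_le_add h1 h2).trans ?_)
  have e : L ^ 9 * (L ^ 18 / n) / n = L ^ 27 / n ^ 2 := by field_simp
  rw [e, ← add_div]
  gcongr
  have d1 : L ^ 6 ≤ L ^ 27 := pow_le_pow_right₀ (by linarith) (by norm_num)
  have : 0 ≤ L ^ 27 := by have := h.L_pos; positivity
  calc L ^ 27 + L ^ 6 ≤ L ^ 27 * 1000 := by linarith
    _ ≤ L ^ 27 * L := by gcongr
    _ = L ^ 28 := by ring

end LevelTwo

section LevelTwoDegrees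

open Finset

variable {n : ℕ} {L lm q : ℝ} {d : Fin n → ℕ} {Y G : SimpleGraph (Fin n)}

lemma mv_sup_edge {a b x : Fin n} (hG : Y ≤ G) (hax : Y.Adj a x) (hab : a ≠ b) (w : Fin n) :
    mv (Y ⊔ SimpleGraph.edge b x) a b w G = mv Y a b w G ∧
      mv (Y ⊔ SimpleGraph.edge b x) b a w G = mv Y b a w G := by
  have h1 := hax.ne
  have h2 : G.Adj a x := hG hax
  constructor <;> refine ind_congr ?_ <;>
    simp only [SimpleGraph.sup_adj, SimpleGraph.edge_adj] <;> grind

lemma sig_comm (Y : SimpleGraph (Fin n)) (a b v : Fin n) (G : SimpleGraph (Fin n)) :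
    sig Y a b v G = sig Y b a v G := add_comm _ _

lemma ssum_comm (Y : SimpleGraph (Fin n)) (a b : Fin n) (G : SimpleGraph (Fin n)) :
    ssum Y a b G = ssum Y b a G := add_comm _ _

lemma mean_adj_sig (h : Dense n L lm q d) (hY : DegLE Y (L - 5)) {a b v x : Fin n}
    (hab : a ≠ b) (hv : v ∈ free Y a b) (hax : Y.Adj a x) (hbx : ¬ Y.Adj b x) (hxb : x ≠ b) :
    |mean d Y (fun G => ind (G.Adj b x) * (sig Y a b v G / ssum Y a b G)) - lm / n|
      ≤ L ^ 16 / (q * n) := by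
  have hL := h.hL
  have hL0 := h.L_pos
  have hq0 := h.hq0
  have hn := h.n_pos
  have hY' := hY.sup_edge hxb.symm hbx
  obtain ⟨hva, hvb, hYa, hYb⟩ := mem_free.1 hv
  have hvx : v ≠ x := fun hvx => hYa (hvx ▸ hax)
  have hv' : v ∈ free (Y ⊔ SimpleGraph.edge b x) a b := by
    refine mem_free.2 ⟨hva, hvb, ?_, ?_⟩ <;>
      simp only [SimpleGraph.sup_adj, SimpleGraph.edge_adj] <;> grind
  have h1 := mean_sig_div_one h (hY'.mono (by linarith)) hab hv'
  have h2 := pr_level_zero h (hY.mono (by linarith)) hxb.symm hbx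
  have e1 : mean d (Y ⊔ SimpleGraph.edge b x) (fun G => sig Y a b v G / ssum Y a b G)
      = mean d (Y ⊔ SimpleGraph.edge b x) (fun G => sig (Y ⊔ SimpleGraph.edge b x) a b v G
        / ssum (Y ⊔ SimpleGraph.edge b x) a b G) := by
    refine mean_congr fun G hG => ?_
    have hYG : Y ≤ G := le_sup_left.trans (mem_fam.1 hG).2
    simp only [ssum_eq, sig, (mv_sup_edge hYG hax hab _).1, (mv_sup_edge hYG hax hab _).2]
  rw [mean_ind_mul d Y hxb.symm, e1]
  set E := mean d (Y ⊔ SimpleGraph.edge b x) (fun G => sig (Y ⊔ SimpleGraph.edge b x) a b v G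
        / ssum (Y ⊔ SimpleGraph.edge b x) a b G)
  rw [show pr d Y b x * E - lm / n = pr d Y b x * (E - 1 / n) + (pr d Y b x - lm) * (1 / n) by ring]
  have t1 : |pr d Y b x * (E - 1 / n)| ≤ 1 * (L ^ 15 / (q * n)) := by
    rw [abs_mul, abs_of_nonneg (pr_nonneg ..)]
    have := pr_le_one d Y b x
    gcongr
  have t2 : |(pr d Y b x - lm) * (1 / n)| ≤ L ^ 5 / q * (1 / n) := by
    rw [abs_mul, abs_of_pos (by positivity : (0:ℝ) < 1 / n)]
    gcongr
  refine (abs_add_le _ _).trans ((add_le_add t1 t2).trans ?_)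
  rw [one_mul, div_mul_div_comm, mul_one, ← add_div]
  gcongr
  have d1 : L ^ 5 ≤ L ^ 15 := pow_le_pow_right₀ (by linarith) (by norm_num)
  have : 0 ≤ L ^ 15 := by positivity
  calc L ^ 15 + L ^ 5 ≤ L ^ 15 * 1000 := by linarith
    _ ≤ L ^ 15 * L := by gcongr
    _ = L ^ 16 := by ring

lemma mean_adj_diff (h : Dense n L lm q d) (hY : DegLE Y (L - 5)) {a b v : Fin n}
    (hab : a ≠ b) (hv : v ∈ free Y a b) :
    |mean d Y (fun G => (∑ x, ind (Y.Adj a x) * ind (G.Adj b x)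
        - ∑ x, ind (Y.Adj b x) * ind (G.Adj a x)) * (sig Y a b v G / ssum Y a b G))
      - lm / n * (deg Y a - deg Y b)| ≤ L ^ 18 / (q * n) := by
  have hL := h.hL
  have hL0 := h.L_pos
  have hq0 := h.hq0
  have hn := h.n_pos
  set η := L ^ 16 / (q * n) with hη
  have hη0 : 0 ≤ η := by positivity
  have e1 : mean d Y (fun G => (∑ x, ind (Y.Adj a x) * ind (G.Adj b x)
        - ∑ x, ind (Y.Adj b x) * ind (G.Adj a x)) * (sig Y a b v G / ssum Y a b G))
      = ∑ x, (ind (Y.Adj a x) * mean d Y (fun G => ind (G.Adj b x)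
          * (sig Y a b v G / ssum Y a b G))
        - ind (Y.Adj b x) * mean d Y (fun G => ind (G.Adj a x)
          * (sig Y a b v G / ssum Y a b G))) := by
    simp_rw [← mean_const_mul, ← mean_sub]
    rw [← mean_sum]
    refine mean_congr fun G _ => ?_
    rw [← sum_sub_distrib, sum_mul]
    exact sum_congr rfl fun x _ => by ring
  have e2 : lm / n * ((deg Y a : ℝ) - deg Y b) = ∑ x, lm / n *
      (ind (Y.Adj a x) * (1 - ind (x = b)) - ind (Y.Adj b x) * (1 - ind (x = a))) := by
    rw [← mul_sum, deg_eq_sum, deg_eq_sum]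
    congr 1
    have hs : ∑ x, ind (x = b) * ind (Y.Adj a x) = ∑ x, ind (x = a) * ind (Y.Adj b x) := by
      rw [sum_ind_eq_mul, sum_ind_eq_mul, ind_adj_comm]
    have : ∀ x, ind (Y.Adj a x) * (1 - ind (x = b)) - ind (Y.Adj b x) * (1 - ind (x = a))
        = (ind (Y.Adj a x) - ind (x = b) * ind (Y.Adj a x))
          - (ind (Y.Adj b x) - ind (x = a) * ind (Y.Adj b x)) := fun x => by ring
    simp_rw [this]
    rw [sum_sub_distrib, sum_sub_distrib, sum_sub_distrib, hs]
    ring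
  have hx : ∀ x, |(ind (Y.Adj a x) * mean d Y (fun G => ind (G.Adj b x)
          * (sig Y a b v G / ssum Y a b G))
        - ind (Y.Adj b x) * mean d Y (fun G => ind (G.Adj a x)
          * (sig Y a b v G / ssum Y a b G))) - lm / n *
      (ind (Y.Adj a x) * (1 - ind (x = b)) - ind (Y.Adj b x) * (1 - ind (x = a)))|
      ≤ (ind (Y.Adj a x) + ind (Y.Adj b x)) * η := by
    intro x
    by_cases h1 : Y.Adj a x <;> by_cases h2 : Y.Adj b x
    · have e3 : mean d Y (fun G => ind (G.Adj b x) * (sig Y a b v G / ssum Y a b G))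
          = mean d Y (fun G => ind (G.Adj a x) * (sig Y a b v G / ssum Y a b G)) :=
        mean_congr fun G hG => by
          rw [ind_true ((mem_fam.1 hG).2 h1), ind_true ((mem_fam.1 hG).2 h2)]
      rw [e3, ind_true h1, ind_true h2, ind_false h1.ne', ind_false h2.ne']
      simpa using hη0
    · rw [ind_true h1, ind_false h2, ind_false h1.ne']
      by_cases hxb : x = b
      · subst hxb
        rw [ind_true rfl]
        have : mean d Y (fun G => ind (G.Adj x x) * (sig Y a x v G / ssum Y a x G)) = 0 := by
          rw [mean_congr (g := fun _ => 0 * 0) fun G _ => by rw [ind_false G.irrefl]; ring,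
            mean_const_mul]
          ring
        rw [this]
        simpa using hη0
      · rw [ind_false hxb]
        have := mean_adj_sig h hY hab hv h1 h2 hxb
        simpa using this
    · rw [ind_false h1, ind_true h2, ind_false h2.ne']
      by_cases hxa : x = a
      · subst hxa
        rw [ind_true rfl]
        have : mean d Y (fun G => ind (G.Adj x x) * (sig Y x b v G / ssum Y x b G)) = 0 := by
          rw [mean_congr (g := fun _ => 0 * 0) fun G _ => by rw [ind_false G.irrefl]; ring,
            mean_const_mul]
          ring
        rw [this]
        simpa using hη0
      · rw [ind_false hxa]
        have hv' : v ∈ free Y b a := by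
          rw [mem_free] at hv ⊢; tauto
        have := mean_adj_sig h hY hab.symm hv' h2 h1 hxa
        simp_rw [sig_comm Y b a, ssum_comm Y b a] at this
        rw [← abs_neg]
        refine le_trans (le_of_eq ?_) (this.trans (le_of_eq ?_))
        · congr 1; ring
        · rw [hη]; ring
    · rw [ind_false h1, ind_false h2]; simp
  rw [e1, e2, ← sum_sub_distrib]
  refine (abs_sum_le_sum_abs _ _).trans ((sum_le_sum fun x _ => hx x).trans ?_)
  rw [← sum_mul, sum_add_distrib, ← deg_eq_sum, ← deg_eq_sum]
  calc ((deg Y a : ℝ) + deg Y b) * η ≤ (L ^ 2) * η := by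
        gcongr
        have := hY a
        have := hY b
        nlinarith
    _ = _ := by rw [hη]; ring

/-- Auxiliary one-sided approximation used in averaging. -/
noncomputable def gtwo (lm : ℝ) (d : Fin n → ℕ) (Y : SimpleGraph (Fin n)) (v a : Fin n) : ℝ :=
  dev lm d a * wone lm d v - (1 - lm) * deg Y a / n

lemma pr_diff_two (h : Dense n L lm q d) (hY : DegLE Y (L - 8)) {a b v : Fin n}
    (ha : a ≠ v) (hb : b ≠ v) (hYa : ¬ Y.Adj a v) (hYb : ¬ Y.Adj b v) (hab : a ≠ b) :
    |pr d Y a v - pr d Y b v - (gtwo lm d Y v a - gtwo lm d Y v b)| ≤ L ^ 30 / q ^ 3 := by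
  have hL := h.hL
  have hL0 := h.L_pos
  have hq0 := h.hq0
  have hn := h.n_pos
  rw [pr_sub_pr Y d ha.symm hb.symm hYa hYb]
  have hv := mem_free_of ha hb hYa hYb
  have h1 := mean_sig_div_two h hY hab hv
  have h2 := mean_adj_diff h (hY.mono (by linarith)) hab hv
  have e1 : mean d Y (fun G => sig Y a b v G * (mvs Y a b G - mvs Y b a G) / ssum Y a b G)
      = ((dev lm d a - deg Y a) - (dev lm d b - deg Y b))
          * mean d Y (fun G => sig Y a b v G / ssum Y a b G)
        + mean d Y (fun G => (∑ x, ind (Y.Adj a x) * ind (G.Adj b x)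
        - ∑ x, ind (Y.Adj b x) * ind (G.Adj a x)) * (sig Y a b v G / ssum Y a b G)) := by
    rw [← mean_const_mul, ← mean_add]
    refine mean_congr fun G hG => ?_
    rw [mvs_sub_mvs hab hG, dev, dev]
    ring
  rw [e1]
  set μ := mean d Y (fun G => sig Y a b v G / ssum Y a b G)
  set M := mean d Y (fun G => (∑ x, ind (Y.Adj a x) * ind (G.Adj b x)
        - ∑ x, ind (Y.Adj b x) * ind (G.Adj a x)) * (sig Y a b v G / ssum Y a b G))
  have e2 : ((dev lm d a - deg Y a) - (dev lm d b - deg Y b)) * μ + M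
        - (gtwo lm d Y v a - gtwo lm d Y v b)
      = ((dev lm d a - deg Y a) - (dev lm d b - deg Y b)) * (μ - wone lm d v)
        + (M - lm / n * (deg Y a - deg Y b))
        - (deg Y a - deg Y b) * ((1 - 2 * lm) * dev lm d v / (lm * (1 - lm) * n)) * (1 / n) := by
    rw [gtwo, gtwo, wone]; ring
  rw [e2]
  have hya := hY a
  have hyb := hY b
  have hya0 : (0 : ℝ) ≤ deg Y a := Nat.cast_nonneg _
  have hyb0 : (0 : ℝ) ≤ deg Y b := Nat.cast_nonneg _
  have t1 : |((dev lm d a - deg Y a) - (dev lm d b - deg Y b)) * (μ - wone lm d v)|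
      ≤ 4 * (L * q) * (L ^ 28 / n ^ 2) := by
    rw [abs_mul]
    refine mul_le_mul ?_ h1 (abs_nonneg _) (by positivity)
    have hq1 := h.q_large
    have a1 := h.abs_dev_le a
    have a2 := h.abs_dev_le b
    rw [abs_le] at *
    have : L ≤ L * q := by nlinarith
    constructor <;> linarith [a1.1, a1.2, a2.1, a2.2]
  have t3 : |(deg Y a - deg Y b) * ((1 - 2 * lm) * dev lm d v / (lm * (1 - lm) * n)) * (1 / n)|
      ≤ L * (2 * L ^ 2 / q) * (1 / n) := by
    rw [abs_mul, abs_mul, abs_of_pos (by positivity : (0:ℝ) < 1 / n)]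
    have : |(deg Y a : ℝ) - deg Y b| ≤ L := by rw [abs_le]; constructor <;> linarith
    have := abs_wone_corr_le h v
    gcongr
  refine (abs_sub _ _).trans ((add_le_add ((abs_add_le _ _).trans (add_le_add t1 h2)) t3).trans ?_)
  have e3 : 4 * (L * q) * (L ^ 28 / n ^ 2) + L ^ 18 / (q * n) + L * (2 * L ^ 2 / q) * (1 / n)
      = (4 * L ^ 29 + L ^ 18 + 2 * L ^ 3) / q ^ 3 := by rw [← h.hq]; field_simp
  rw [e3]
  gcongr
  have d1 : L ^ 18 ≤ L ^ 29 := pow_le_pow_right₀ (by linarith) (by norm_num)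
  have d2 : L ^ 3 ≤ L ^ 29 := pow_le_pow_right₀ (by linarith) (by norm_num)
  have : 0 ≤ L ^ 29 := by positivity
  calc 4 * L ^ 29 + L ^ 18 + 2 * L ^ 3 ≤ L ^ 29 * 1000 := by linarith
    _ ≤ L ^ 29 * L := by gcongr
    _ = L ^ 30 := by ring

/-- Second order approximation of the conditional edge probabilities. -/
noncomputable def ptwo (lm : ℝ) (d : Fin n → ℕ) (Y : SimpleGraph (Fin n)) (a v : Fin n) : ℝ :=
  lm + ((dev lm d a - (1 - lm) * deg Y a) + (dev lm d v - (1 - lm) * deg Y v)) / n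
    + (1 - lm) * (∑ x, (deg Y x : ℝ)) / n ^ 2
    + (1 - 2 * lm) * dev lm d a * dev lm d v / (lm * (1 - lm) * n ^ 2)

lemma pr_level_two (h : Dense n L lm q d) (hY : DegLE Y (L - 8)) {a v : Fin n}
    (hav : a ≠ v) (hYav : ¬ Y.Adj a v) : |pr d Y a v - ptwo lm d Y a v| ≤ L ^ 31 / q ^ 3 := by
  have hL := h.hL
  have hL0 := h.L_pos
  have hq0 := h.hq0
  have hq1 := h.q_large
  have hn := h.n_pos
  have hLn := h.L_le_n
  have hYL := hY.mono (by linarith : L - 8 ≤ L)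
  have hne := fam_nonempty h Y hYL
  have hl0 := h.lm_pos
  have hl1 : 0 < 1 - lm := by linarith [h.lm_lt]
  have hav' := average_bound hne (fun a b ha hb hYa hYb hab => pr_diff_two h hY ha hb hYa hYb hab)
    (by positivity) hav hYav
  set η := L ^ 30 / q ^ 3 with hη
  have e1 : ∑ b, wt Y v b * gtwo lm d Y v b
      = wone lm d v * ∑ b, wt Y v b * dev lm d b - (1 - lm) / n * ∑ b, wt Y v b * (deg Y b : ℝ) := by
    rw [mul_sum, mul_sum, ← sum_sub_distrib]
    exact sum_congr rfl fun b _ => by rw [gtwo]; ring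
  rw [e1, sum_wt_mul, sum_wt_mul, h.sum_dev] at hav'
  have hY0 : ∀ x, |(deg Y x : ℝ)| ≤ L := fun x => by
    rw [abs_of_nonneg (Nat.cast_nonneg _)]; exact hYL x
  have hnb := abs_sum_adj_mul_le hYL v h.abs_dev_le (by positivity)
  have hnb2 := abs_sum_adj_mul_le hYL v hY0 hL0.le
  have hdv := h.abs_dev_le v
  have hw := abs_wone_le h v
  have hyv := hYL v
  have hyv0 : (0 : ℝ) ≤ deg Y v := Nat.cast_nonneg _
  set N := ∑ x, ind (Y.Adj x v) * dev lm d x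
  set N2 := ∑ x, ind (Y.Adj x v) * (deg Y x : ℝ)
  set S := ∑ x, (deg Y x : ℝ) with hS
  have hS0 : 0 ≤ S := sum_nonneg fun _ _ => Nat.cast_nonneg _
  have hS1 : S ≤ n * L := by
    refine (sum_le_sum fun x _ => hYL x).trans ?_
    simp
  set c : ℝ := n - 1 - deg Y v with hc
  have hc1 : (n : ℝ) / 2 ≤ c := by rw [hc]; linarith
  have hc0 : 0 < c := by linarith
  set K := dev lm d v - (1 - lm) * deg Y v + (1 - lm) * S / n with hK
  have e : c * (pr d Y a v - ptwo lm d Y a v)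
      = (c * (pr d Y a v - gtwo lm d Y v a) - ((d v - deg Y v) - (wone lm d v * (0 - dev lm d v - N)
          - (1 - lm) / n * (S - deg Y v - N2))))
        + (wone lm d v * dev lm d v + wone lm d v * N - (1 - lm) / n * (deg Y v + N2)
          + (1 + deg Y v) / n * K) := by
    rw [hK, hc, ptwo, gtwo, show (d v : ℝ) = dev lm d v + lm * (n - 1) by rw [dev]; ring, ← hS]
    set W := (1 - 2 * lm) * dev lm d v / (lm * (1 - lm) * n) with hW
    have e0 : wone lm d v = (1 + W) / n := rfl
    have e2 : (1 - 2 * lm) * dev lm d a * dev lm d v / (lm * (1 - lm) * n ^ 2)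
        = dev lm d a * (W / n) := by rw [hW]; field_simp
    rw [e0, e2]
    field_simp
    ring
  have hKb : |K| ≤ 3 * (L * q) := by
    have a1 : |(1 - lm) * (deg Y v : ℝ)| ≤ L := by
      rw [abs_of_nonneg (by positivity)]
      exact (mul_le_of_le_one_left hyv0 (by linarith)).trans (by linarith)
    have a2 : |(1 - lm) * S / n| ≤ L := by
      rw [abs_of_nonneg (by positivity), div_le_iff₀ hn]
      exact (mul_le_of_le_one_left hS0 (by linarith)).trans (by linarith)
    have a3 : L ≤ L * q := le_mul_of_one_le_right hL0.le (by linarith)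
    refine (abs_add_le _ _).trans ((add_le_add ((abs_sub _ _).trans (add_le_add hdv a1)) a2).trans ?_)
    linarith
  have key : |c * (pr d Y a v - ptwo lm d Y a v)| ≤ c * η + 20 * L ^ 2 / q := by
    rw [e]
    refine (abs_add_le _ _).trans (add_le_add hav' ?_)
    have t1 : |wone lm d v * dev lm d v| ≤ 2 / n * (L * q) := by
      rw [abs_mul]; gcongr
    have t2 : |wone lm d v * N| ≤ 2 / n * (L * (L * q)) := by
      rw [abs_mul]; gcongr
    have t3 : |(1 - lm) / n * (deg Y v + N2)| ≤ 1 / n * (L + L * L) := by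
      rw [abs_mul, abs_of_pos (by positivity : 0 < (1 - lm) / n)]
      gcongr
      · linarith
      · exact (abs_add_le _ _).trans (add_le_add (hY0 v) hnb2)
    have t4 : |(1 + deg Y v) / n * K| ≤ (2 * L) / n * (3 * (L * q)) := by
      rw [abs_mul, abs_of_nonneg (by positivity : (0:ℝ) ≤ (1 + deg Y v) / n)]
      gcongr
      linarith
    refine (abs_add_le _ _).trans ((add_le_add ((abs_sub _ _).trans (add_le_add
      ((abs_add_le _ _).trans (add_le_add t1 t2)) t3)) t4).trans ?_)
    have e3 : 2 / n * (L * q) + 2 / n * (L * (L * q)) + 1 / n * (L + L * L)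
        + (2 * L) / n * (3 * (L * q)) = (2 * L * q + 8 * L ^ 2 * q + L + L ^ 2) / q ^ 2 := by
      rw [← h.hq]; field_simp; ring
    rw [e3, div_le_div_iff₀ (by positivity) hq0]
    have u0 : L ≤ L ^ 2 := le_self_pow₀ (by linarith) two_ne_zero
    have u1 : L * q ≤ L ^ 2 * q := by gcongr
    have u2 : L ^ 2 ≤ L ^ 2 * q := le_mul_of_one_le_right (by positivity) (by linarith)
    calc (2 * L * q + 8 * L ^ 2 * q + L + L ^ 2) * q ≤ 20 * L ^ 2 * q * q := by
          gcongr
          linarith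
      _ = _ := by ring
  rw [abs_mul, abs_of_pos hc0] at key
  have e3 : 20 * L ^ 2 / q ≤ c * (40 * L ^ 2 / q ^ 3) := by
    calc 20 * L ^ 2 / q = (n / 2) * (40 * L ^ 2 / q ^ 3) := by
          rw [← h.hq]; field_simp; norm_num
      _ ≤ _ := by gcongr
  have : c * |pr d Y a v - ptwo lm d Y a v| ≤ c * (η + 40 * L ^ 2 / q ^ 3) := by linarith
  refine (le_of_mul_le_mul_left this hc0).trans ?_
  rw [hη, ← add_div]
  gcongr
  have d1 : L ^ 2 ≤ L ^ 30 := pow_le_pow_right₀ (by linarith) (by norm_num)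
  have : 0 ≤ L ^ 30 := by positivity
  calc L ^ 30 + 40 * L ^ 2 ≤ L ^ 30 * 1000 := by linarith
    _ ≤ L ^ 30 * L := by gcongr
    _ = L ^ 31 := by ring

end LevelTwoDegrees

section SubgraphProbability

open Finset

variable {n : ℕ} {L lm q : ℝ} {d : Fin n → ℕ} {Y G : SimpleGraph (Fin n)}

/-- Second order approximation of the logarithm of the conditional edge probability, without the
leading term `log lm`. -/
noncomputable def lstep (lm : ℝ) (d : Fin n → ℕ) (Y : SimpleGraph (Fin n)) (a v : Fin n) : ℝ :=
  ((dev lm d a - (1 - lm) * deg Y a) + (dev lm d v - (1 - lm) * deg Y v)) / (lm * n)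
    + (1 - lm) * (∑ x, (deg Y x : ℝ)) / (lm * n ^ 2)
    - (dev lm d a ^ 2 + dev lm d v ^ 2) / (2 * lm ^ 2 * n ^ 2)
    - dev lm d a * dev lm d v / (lm * (1 - lm) * n ^ 2)

lemma abs_log_one_add_sub_le {u : ℝ} (hu : |u| ≤ 1 / 2) :
    |Real.log (1 + u) - u + u ^ 2 / 2| ≤ 2 * |u| ^ 3 := by
  have h1 : |(-u)| < 1 := by rw [abs_neg]; linarith
  have h2 := Real.abs_log_sub_add_sum_range_le h1 2
  rw [abs_neg, sub_neg_eq_add] at h2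
  have e : ∑ i ∈ range 2, (-u) ^ (i + 1) / ((i : ℝ) + 1) + Real.log (1 + u)
      = Real.log (1 + u) - u + u ^ 2 / 2 := by
    simp [sum_range_succ]; ring
  rw [e] at h2
  refine h2.trans ?_
  rw [div_le_iff₀ (by linarith)]
  have h3 := mul_nonneg (by positivity : 0 ≤ |u| ^ 3) (sub_nonneg.2 hu)
  norm_num
  linarith

lemma log_pr (h : Dense n L lm q d) (hY : DegLE Y (L - 8)) {a v : Fin n}
    (hav : a ≠ v) (hYav : ¬ Y.Adj a v) :
    0 < pr d Y a v ∧
      |Real.log (pr d Y a v) - (Real.log lm + lstep lm d Y a v)| ≤ L ^ 33 / q ^ 3 := by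
  have hL := h.hL
  have hL0 := h.L_pos
  have hq0 := h.hq0
  have hn := h.n_pos
  have hl0 := h.lm_pos
  have hl1 : 0 < 1 - lm := by linarith [h.lm_lt]
  have p0 := pr_level_zero h (hY.mono (by linarith : L - 8 ≤ L)) hav hYav
  have p1 := pr_level_one h (hY.mono (by linarith : L - 8 ≤ L - 4)) hav hYav
  have p2 := pr_level_two h hY hav hYav
  have hil : 1 / lm ≤ L := by
    rw [div_le_iff₀ hl0]
    have := h.hlm
    rw [div_le_iff₀ hL0] at this
    linarith
  set p := pr d Y a v
  set u := (p - lm) / lm with hu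
  set t := (dev lm d a + dev lm d v) / (lm * n) with ht
  have hpu : p = lm * (1 + u) := by rw [hu]; field_simp; ring
  have u0 : |u| ≤ L ^ 6 / q := by
    calc |u| = |p - lm| * (1 / lm) := by rw [hu, abs_div, abs_of_pos hl0]; ring
      _ ≤ L ^ 5 / q * L := by gcongr
      _ = L ^ 6 / q := by ring
  have u1 : |u| ≤ 1 / 2 := by
    refine u0.trans ((h.pow_div_le (i := 6) (j := 1) le_rfl (by norm_num)).trans ?_)
    rw [pow_one]
    exact one_div_le_one_div_of_le (by norm_num) (by linarith)
  have u2 : |u - t| ≤ L ^ 19 / n := by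
    calc |u - t| = |p - (lm + (dev lm d a + dev lm d v) / n)| * (1 / lm) := by
          rw [hu, ht, ← abs_of_pos (by positivity : 0 < 1 / lm), ← abs_mul]
          congr 1
          field_simp
          ring
      _ ≤ L ^ 18 / n * L := by gcongr
      _ = L ^ 19 / n := by ring
  have u3 : |u - (ptwo lm d Y a v - lm) / lm| ≤ L ^ 32 / q ^ 3 := by
    calc |u - (ptwo lm d Y a v - lm) / lm| = |p - ptwo lm d Y a v| * (1 / lm) := by
          rw [hu, ← abs_of_pos (by positivity : 0 < 1 / lm), ← abs_mul]
          congr 1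
          field_simp
          ring
      _ ≤ L ^ 31 / q ^ 3 * L := by gcongr
      _ = L ^ 32 / q ^ 3 := by ring
  have t0 : |t| ≤ 2 * L ^ 2 / q := by
    have h1 := abs_dev_div_le h a
    have h2 := abs_dev_div_le h v
    calc |t| = |dev lm d a / n + dev lm d v / n| * (1 / lm) := by
          rw [ht, ← abs_of_pos (by positivity : 0 < 1 / lm), ← abs_mul]
          congr 1
          field_simp
      _ ≤ (L / q + L / q) * L := by
          gcongr
          exact (abs_add_le _ _).trans (add_le_add h1 h2)
      _ = 2 * L ^ 2 / q := by ring
  have t1 : |u + t| ≤ 2 * L ^ 6 / q := by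
    refine (abs_add_le _ _).trans ((add_le_add u0 t0).trans ?_)
    rw [← add_div]
    gcongr
    have : L ^ 2 * 2 ≤ L ^ 2 * L ^ 4 := by
      gcongr
      nlinarith [sq_nonneg (L ^ 2), pow_le_pow_right₀ (by linarith : (1:ℝ) ≤ L) (by norm_num : 1 ≤ 4)]
    nlinarith
  have hlog := abs_log_one_add_sub_le u1
  have hp : 0 < p := by
    rw [hpu]
    have := abs_le.1 u1
    exact mul_pos hl0 (by linarith)
  refine ⟨hp, ?_⟩
  have e1 : Real.log p = Real.log lm + Real.log (1 + u) := by
    rw [hpu, Real.log_mul hl0.ne' (by have := abs_le.1 u1; linarith)]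
  have e2 : (ptwo lm d Y a v - lm) / lm - t ^ 2 / 2 = lstep lm d Y a v := by
    rw [ptwo, lstep, ht]
    field_simp
    ring
  have e : Real.log p - (Real.log lm + lstep lm d Y a v)
      = (Real.log (1 + u) - u + u ^ 2 / 2) + (u - (ptwo lm d Y a v - lm) / lm)
        - (u - t) * (u + t) / 2 := by
    rw [e1, ← e2]; ring
  have t3 : |(u - t) * (u + t) / 2| ≤ L ^ 19 / n * (2 * L ^ 6 / q) / 2 := by
    rw [abs_div, abs_mul, abs_two]
    gcongr
  rw [e]
  refine (abs_sub _ _).trans ((add_le_add ((abs_add_le _ _).trans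
    (add_le_add (hlog.trans (mul_le_mul_of_nonneg_left
      (pow_le_pow_left₀ (abs_nonneg _) u0 3) zero_le_two)) u3)) t3).trans ?_)
  have e3 : 2 * (L ^ 6 / q) ^ 3 + L ^ 32 / q ^ 3 + L ^ 19 / n * (2 * L ^ 6 / q) / 2
      = (2 * L ^ 18 + L ^ 32 + L ^ 25) / q ^ 3 := by rw [← h.hq]; field_simp
  rw [e3]
  gcongr
  have d1 : L ^ 18 ≤ L ^ 32 := pow_le_pow_right₀ (by linarith) (by norm_num)
  have d2 : L ^ 25 ≤ L ^ 32 := pow_le_pow_right₀ (by linarith) (by norm_num)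
  have : 0 ≤ L ^ 32 := by positivity
  calc 2 * L ^ 18 + L ^ 32 + L ^ 25 ≤ L ^ 32 * 1000 := by linarith
    _ ≤ L ^ 32 * L := by gcongr
    _ = L ^ 33 := by ring

/-- The sum of `dev x * dev z` over the edges of `Y`, normalised. -/
noncomputable def xsum (lm : ℝ) (d : Fin n → ℕ) (Y : SimpleGraph (Fin n)) : ℝ :=
  (∑ x, ∑ z, ind (Y.Adj x z) * (dev lm d x * dev lm d z)) / (2 * (lm * (1 - lm) * n ^ 2))

/-- Approximation of the logarithm of the probability of containing `Y`. -/
noncomputable def lprob (lm : ℝ) (d : Fin n → ℕ) (Y : SimpleGraph (Fin n)) : ℝ :=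
  (∑ x, (deg Y x : ℝ)) / 2 * Real.log lm
    + ∑ x, (deg Y x * (dev lm d x / (lm * n) - dev lm d x ^ 2 / (2 * lm ^ 2 * n ^ 2))
        - (1 - lm) * (deg Y x * (deg Y x - 1)) / (2 * lm * n))
    + (1 - lm) * ((∑ x, (deg Y x : ℝ)) * (∑ x, (deg Y x : ℝ) - 2)) / (4 * lm * n ^ 2)
    - xsum lm d Y

lemma ind_sup_edge_adj {a v : Fin n} (hav : a ≠ v) (hY : ¬ Y.Adj a v) (x z : Fin n) :
    ind ((Y ⊔ SimpleGraph.edge a v).Adj x z)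
      = ind (Y.Adj x z) + ind (x = a) * ind (z = v) + ind (x = v) * ind (z = a) := by
  have hY' : ¬ Y.Adj v a := fun h => hY h.symm
  rw [SimpleGraph.sup_adj, SimpleGraph.edge_adj, ← ind_and, ← ind_and]
  by_cases h1 : x = a ∧ z = v
  · obtain ⟨rfl, rfl⟩ := h1
    simp [ind, hY, hav]
  · by_cases h2 : x = v ∧ z = a
    · obtain ⟨rfl, rfl⟩ := h2
      simp [ind, hY', hav, hav.symm]
    · simp [ind, h1, h2]

lemma sum_sum_ind_mul_ind_mul (a v : Fin n) (f : Fin n → Fin n → ℝ) :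
    ∑ x, ∑ z, ind (x = a) * ind (z = v) * f x z = f a v := by
  calc ∑ x, ∑ z, ind (x = a) * ind (z = v) * f x z
      = ∑ x, ind (x = a) * ∑ z, ind (z = v) * f x z :=
        sum_congr rfl fun x _ => by
          rw [mul_sum]; exact sum_congr rfl fun z _ => by ring
    _ = f a v := by simp_rw [sum_ind_eq_mul]

lemma xsum_sup_edge (lm : ℝ) (d : Fin n → ℕ) {a v : Fin n} (hav : a ≠ v) (hY : ¬ Y.Adj a v) :
    xsum lm d (Y ⊔ SimpleGraph.edge a v)
      = xsum lm d Y + dev lm d a * dev lm d v / (lm * (1 - lm) * n ^ 2) := by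
  have e : ∑ x, ∑ z, ind ((Y ⊔ SimpleGraph.edge a v).Adj x z) * (dev lm d x * dev lm d z)
      = ∑ x, ∑ z, ind (Y.Adj x z) * (dev lm d x * dev lm d z)
        + 2 * (dev lm d a * dev lm d v) := by
    simp_rw [ind_sup_edge_adj hav hY, add_mul, sum_add_distrib]
    rw [sum_sum_ind_mul_ind_mul a v fun x z => dev lm d x * dev lm d z,
      sum_sum_ind_mul_ind_mul v a fun x z => dev lm d x * dev lm d z]
    ring
  rw [xsum, e, xsum, add_div, mul_div_mul_left _ _ two_ne_zero]

lemma sum_deg_sup_edge {a v : Fin n} (hav : a ≠ v) (hY : ¬ Y.Adj a v) :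
    ∑ x, (deg (Y ⊔ SimpleGraph.edge a v) x : ℝ) = ∑ x, (deg Y x : ℝ) + 2 := by
  simp_rw [deg_sup_edge Y hav hY, sum_add_distrib, sum_ind_eq]
  ring

lemma lprob_sup_edge (h : Dense n L lm q d) {a v : Fin n} (hav : a ≠ v) (hY : ¬ Y.Adj a v) :
    lprob lm d (Y ⊔ SimpleGraph.edge a v)
      = lprob lm d Y + (Real.log lm + lstep lm d Y a v) := by
  have hn := h.n_pos
  have hl0 := h.lm_pos
  have e : ∑ x, ((deg (Y ⊔ SimpleGraph.edge a v) x : ℝ)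
          * (dev lm d x / (lm * n) - dev lm d x ^ 2 / (2 * lm ^ 2 * n ^ 2))
        - (1 - lm) * (deg (Y ⊔ SimpleGraph.edge a v) x
            * ((deg (Y ⊔ SimpleGraph.edge a v) x : ℝ) - 1)) / (2 * lm * n))
      = ∑ x, ((deg Y x : ℝ) * (dev lm d x / (lm * n) - dev lm d x ^ 2 / (2 * lm ^ 2 * n ^ 2))
        - (1 - lm) * (deg Y x * ((deg Y x : ℝ) - 1)) / (2 * lm * n))
        + (dev lm d a / (lm * n) - dev lm d a ^ 2 / (2 * lm ^ 2 * n ^ 2)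
            - (1 - lm) * deg Y a / (lm * n))
        + (dev lm d v / (lm * n) - dev lm d v ^ 2 / (2 * lm ^ 2 * n ^ 2)
            - (1 - lm) * deg Y v / (lm * n)) := by
    rw [← sum_ind_eq_mul a fun x => dev lm d x / (lm * n) - dev lm d x ^ 2 / (2 * lm ^ 2 * n ^ 2)
            - (1 - lm) * deg Y x / (lm * n),
      ← sum_ind_eq_mul v fun x => dev lm d x / (lm * n) - dev lm d x ^ 2 / (2 * lm ^ 2 * n ^ 2)
            - (1 - lm) * deg Y x / (lm * n), ← sum_add_distrib, ← sum_add_distrib]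
    refine sum_congr rfl fun x _ => ?_
    rw [deg_sup_edge Y hav hY]
    by_cases h1 : x = a
    · subst h1
      rw [ind_true rfl, ind_false hav]
      field_simp
      ring
    · rw [ind_false h1]
      by_cases h2 : x = v
      · subst h2
        rw [ind_true rfl]
        field_simp
        ring
      · rw [ind_false h2]
        ring
  rw [lprob, e, xsum_sup_edge lm d hav hY, sum_deg_sup_edge hav hY, lprob, lstep]
  set S := ∑ x, (deg Y x : ℝ)
  set T := ∑ x, ((deg Y x : ℝ) * (dev lm d x / (lm * n) - dev lm d x ^ 2 / (2 * lm ^ 2 * n ^ 2))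
        - (1 - lm) * (deg Y x * ((deg Y x : ℝ) - 1)) / (2 * lm * n))
  set X := dev lm d a * dev lm d v / (lm * (1 - lm) * n ^ 2)
  field_simp
  ring

lemma deg_bot (x : Fin n) : deg (⊥ : SimpleGraph (Fin n)) x = 0 := by
  simp [deg]

lemma lprob_bot (lm : ℝ) (d : Fin n → ℕ) : lprob lm d (⊥ : SimpleGraph (Fin n)) = 0 := by
  simp [lprob, xsum, deg_bot, ind]

/-- The probability that a uniform random graph with degree sequence `d` contains `Y`. -/
lemma log_card_fam (h : Dense n L lm q d) : ∀ Y : SimpleGraph (Fin n), DegLE Y (L - 8) →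
    |Real.log ((fam d Y).card / (fam d ⊥).card) - lprob lm d Y|
      ≤ (∑ x, (deg Y x : ℝ)) / 2 * (L ^ 33 / q ^ 3) := by
  have hL := h.hL
  refine graph_induction ?_ ?_
  · intro _
    have : ((fam d (⊥ : SimpleGraph (Fin n))).card : ℝ) ≠ 0 := by
      exact_mod_cast (card_pos.2 h.hne).ne'
    rw [div_self this, lprob_bot]
    simp [deg_bot]
  · intro Y a v hav hYav ih hY
    have hY' := hY.of_sup_edge hav hYav
    have ih' := ih hY'
    obtain ⟨hp, hlog⟩ := log_pr h hY' hav hYav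
    have c0 : (0 : ℝ) < (fam d (⊥ : SimpleGraph (Fin n))).card := by
      exact_mod_cast card_pos.2 h.hne
    have c1 : (0 : ℝ) < (fam d Y).card := by
      exact_mod_cast card_pos.2 (fam_nonempty h Y (hY'.mono (by linarith)))
    have e : Real.log ((fam d (Y ⊔ SimpleGraph.edge a v)).card / (fam d ⊥).card)
        = Real.log ((fam d Y).card / (fam d ⊥).card) + Real.log (pr d Y a v) := by
      rw [← pr_mul_card d Y hav, mul_div_assoc, Real.log_mul hp.ne' (by positivity), add_comm]
    rw [e, lprob_sup_edge h hav hYav, sum_deg_sup_edge hav hYav]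
    have e2 : Real.log ((fam d Y).card / (fam d ⊥).card) + Real.log (pr d Y a v)
          - (lprob lm d Y + (Real.log lm + lstep lm d Y a v))
        = (Real.log ((fam d Y).card / (fam d ⊥).card) - lprob lm d Y)
          + (Real.log (pr d Y a v) - (Real.log lm + lstep lm d Y a v)) := by ring
    rw [e2]
    refine (abs_add_le _ _).trans ((add_le_add ih' hlog).trans (le_of_eq ?_))
    ring

/-- The main terms for a regular graph. -/
lemma lprob_regular (h : Dense n L lm q d) {k : ℕ} (hk : (k : ℝ) ≤ L) (hY : ∀ x, deg Y x = k) :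
    |lprob lm d Y - (n * k / 2 * Real.log lm - (1 - lm) / (4 * lm) * (k * (k - 2))
        - k * (∑ x, dev lm d x ^ 2) / (2 * lm ^ 2 * n ^ 2) - xsum lm d Y)| ≤ L ^ 2 / n := by
  have hn := h.n_pos
  have hl0 := h.lm_pos
  have hl1 : 0 < 1 - lm := by linarith [h.lm_lt]
  have hL0 := h.L_pos
  have e1 : ∑ x : Fin n, (deg Y x : ℝ) = n * k := by simp [hY]
  have e2 : ∑ x, ((deg Y x : ℝ) * (dev lm d x / (lm * n) - dev lm d x ^ 2 / (2 * lm ^ 2 * n ^ 2))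
        - (1 - lm) * (deg Y x * ((deg Y x : ℝ) - 1)) / (2 * lm * n))
      = - (k * (∑ x, dev lm d x ^ 2) / (2 * lm ^ 2 * n ^ 2))
        - (1 - lm) * (k * (k - 1)) / (2 * lm) := by
    simp_rw [hY, mul_sub, sum_sub_distrib, ← mul_sum, ← sum_div, h.sum_dev]
    simp
    field_simp
  rw [lprob, e1, e2]
  have e3 : n * k / 2 * Real.log lm + (-(k * (∑ x, dev lm d x ^ 2) / (2 * lm ^ 2 * n ^ 2))
        - (1 - lm) * (k * (k - 1)) / (2 * lm))
        + (1 - lm) * (n * k * (n * k - 2)) / (4 * lm * n ^ 2) - xsum lm d Y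
        - (n * k / 2 * Real.log lm - (1 - lm) / (4 * lm) * (k * (k - 2))
        - k * (∑ x, dev lm d x ^ 2) / (2 * lm ^ 2 * n ^ 2) - xsum lm d Y)
      = - ((1 - lm) * k * (1 / lm) / (2 * n)) := by
    field_simp
    ring
  rw [e3, abs_neg, abs_of_nonneg (by positivity)]
  have hil : 1 / lm ≤ L := by
    rw [div_le_iff₀ hl0]
    have := h.hlm
    rw [div_le_iff₀ hL0] at this
    linarith
  calc (1 - lm) * k * (1 / lm) / (2 * n) ≤ 1 * L * L / (2 * n) := by gcongr; linarith
    _ ≤ L ^ 2 / n := by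
      rw [one_mul, div_le_div_iff₀ (by positivity) hn]
      have : 0 ≤ L ^ 2 * n := by positivity
      nlinarith

end SubgraphProbability

section ExponentialSum

open Finset

variable {n k : ℕ} {G : SimpleGraph (Fin n)} {f : Fin n → ℝ} {B c : ℝ}

/-- The sum of `f x * f z` over ordered pairs of adjacent vertices. -/
noncomputable def esum (f : Fin n → ℝ) (G : SimpleGraph (Fin n)) : ℝ :=
  ∑ x, ∑ z, ind (G.Adj x z) * (f x * f z)

lemma sum_sum_eind_mul {u v : Fin n} (huv : u ≠ v) (f : Fin n → Fin n → ℝ) :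
    ∑ x, ∑ z, eind u v x z * f x z = f u v + f v u := by
  rw [← sum_sum_ind_mul_ind_mul u v f, ← sum_sum_ind_mul_ind_mul v u f, ← sum_add_distrib]
  refine sum_congr rfl fun x _ => ?_
  rw [← sum_add_distrib]
  refine sum_congr rfl fun z _ => ?_
  rw [← add_mul, eind, ← ind_and, ← ind_and]
  congr 1
  by_cases h1 : x = u ∧ z = v
  · obtain ⟨rfl, rfl⟩ := h1
    simp [ind, huv]
  · simp [ind, h1]

lemma esum_sw {a v b w : Fin n} (h : Pat ⊥ a v b w G) (f : Fin n → ℝ) :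
    esum f (sw a v b w G) - esum f G
      = 2 * (f a * f w + f b * f v - f a * f v - f b * f w) := by
  obtain ⟨h1, h2, h3, h4, -, -⟩ := h.distinct
  simp_rw [esum, ind_sw_adj h, add_mul, sub_mul, sum_add_distrib, sum_sub_distrib]
  rw [sum_sum_eind_mul h1 fun x z => f x * f z, sum_sum_eind_mul h2 fun x z => f x * f z,
    sum_sum_eind_mul h3 fun x z => f x * f z, sum_sum_eind_mul h4 fun x z => f x * f z]
  ring

lemma abs_mul_le_of_abs_le (hf : ∀ x, |f x| ≤ B) (x z : Fin n) : |f x * f z| ≤ B ^ 2 := by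
  rw [abs_mul, sq]
  exact mul_le_mul (hf x) (hf z) (abs_nonneg _) ((abs_nonneg _).trans (hf x))

lemma abs_exp_esum_sw_sub_le {a v b w : Fin n} (h : Pat ⊥ a v b w G) (hf : ∀ x, |f x| ≤ B)
    (hc : 8 * (|c| * B ^ 2) ≤ 1) :
    |Real.exp (c * esum f (sw a v b w G)) - Real.exp (c * esum f G)|
      ≤ 16 * (|c| * B ^ 2) * Real.exp (c * esum f G) := by
  have e : Real.exp (c * esum f (sw a v b w G)) - Real.exp (c * esum f G)
      = (Real.exp (c * (2 * (f a * f w + f b * f v - f a * f v - f b * f w))) - 1)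
        * Real.exp (c * esum f G) := by
    rw [sub_mul, one_mul, ← Real.exp_add, ← esum_sw h f]
    congr 2
    ring
  have hx : |c * (2 * (f a * f w + f b * f v - f a * f v - f b * f w))| ≤ 8 * (|c| * B ^ 2) := by
    have h1 := abs_le.1 (abs_mul_le_of_abs_le hf a w)
    have h2 := abs_le.1 (abs_mul_le_of_abs_le hf b v)
    have h3 := abs_le.1 (abs_mul_le_of_abs_le hf a v)
    have h4 := abs_le.1 (abs_mul_le_of_abs_le hf b w)
    have : |2 * (f a * f w + f b * f v - f a * f v - f b * f w)| ≤ 8 * B ^ 2 := by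
      rw [abs_le]; constructor <;> linarith [h1.1, h1.2, h2.1, h2.2, h3.1, h3.2, h4.1, h4.2]
    rw [abs_mul]
    calc |c| * _ ≤ |c| * (8 * B ^ 2) := by gcongr
      _ = _ := by ring
  rw [e, abs_mul, abs_of_pos (Real.exp_pos _)]
  gcongr
  refine (Real.abs_exp_sub_one_le (hx.trans hc)).trans ?_
  linarith

lemma sum_adj_eq (hG : ∀ x, deg G x = k) (x : Fin n) : ∑ z, ind (G.Adj x z) = k := by
  rw [← deg_eq_sum, hG]

lemma sum_adj_eq' (hG : ∀ x, deg G x = k) (z : Fin n) : ∑ x, ind (G.Adj x z) = k := by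
  simp_rw [ind_adj_comm G _ z, sum_adj_eq hG]

lemma ind_pat_le (a v b w : Fin n) (G : SimpleGraph (Fin n)) :
    ind (Pat ⊥ a v b w G) ≤ ind (G.Adj a v) * ind (G.Adj b w) := by
  rw [← ind_and]
  exact ind_le_ind fun h => ⟨h.1.1, h.2.1.1⟩

lemma le_ind_pat (a v b w : Fin n) (G : SimpleGraph (Fin n)) :
    ind (G.Adj a v) * ind (G.Adj b w) - ind (Pat ⊥ a v b w G)
      ≤ ind (G.Adj a v) * ind (G.Adj b w) * ind (G.Adj a w)
        + ind (G.Adj a v) * ind (G.Adj b v) * ind (G.Adj b w)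
        + ind (G.Adj a v) * (ind (w = a) * ind (G.Adj b w))
        + ind (G.Adj a v) * ind (b = v) * ind (G.Adj b w) := by
  have hp := ind_nonneg (Pat ⊥ a v b w G)
  by_cases h1 : G.Adj a v
  · by_cases h2 : G.Adj b w
    · rw [ind_true h1, ind_true h2]
      have h3 := ind_nonneg (G.Adj a w)
      have h4 := ind_nonneg (G.Adj b v)
      have h5 := ind_nonneg (w = a)
      have h6 := ind_nonneg (b = v)
      by_cases c3 : G.Adj a w
      · rw [ind_true c3]; linarith
      by_cases c4 : G.Adj b v
      · rw [ind_true c4]; linarith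
      by_cases c5 : w = a
      · rw [ind_true c5]; linarith
      by_cases c6 : b = v
      · rw [ind_true c6]; linarith
      have : Pat ⊥ a v b w G :=
        ⟨⟨h1, not_false⟩, ⟨h2, not_false⟩, c3, c4, Ne.symm c5, c6⟩
      rw [ind_true this]
      linarith
    · rw [ind_false h2]; linarith
  · rw [ind_false h1]; linarith

lemma sum_sum_sum_swap (F : Fin n → Fin n → Fin n → ℝ) :
    ∑ x, ∑ y, ∑ z, F x y z = ∑ z, ∑ y, ∑ x, F x y z := by
  rw [sum_comm, sum_congr rfl fun y _ => sum_comm, sum_comm]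

lemma sum_bad_le (hG : ∀ x, deg G x = k) :
    ∑ a, ∑ v, ∑ b, ∑ w, (ind (G.Adj a v) * ind (G.Adj b w) - ind (Pat ⊥ a v b w G))
      ≤ 4 * (n * k ^ 3) := by
  have hs := sum_adj_eq hG
  have hs' := sum_adj_eq' hG
  have t1 : ∑ a, ∑ v, ∑ b, ∑ w, ind (G.Adj a v) * ind (G.Adj b w) * ind (G.Adj a w)
      = (n : ℝ) * k ^ 3 := by
    calc _ = ∑ a, ∑ v, ind (G.Adj a v) * ∑ w, ind (G.Adj a w) * ∑ b, ind (G.Adj b w) := by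
          refine sum_congr rfl fun a _ => sum_congr rfl fun v _ => ?_
          rw [sum_comm, mul_sum]
          refine sum_congr rfl fun w _ => ?_
          rw [mul_sum, mul_sum]
          exact sum_congr rfl fun b _ => by ring
      _ = _ := by
          simp only [hs, hs', ← sum_mul]
          simp; ring
  have t2 : ∑ a, ∑ v, ∑ b, ∑ w, ind (G.Adj a v) * ind (G.Adj b v) * ind (G.Adj b w)
      = (n : ℝ) * k ^ 3 := by
    simp only [hs, hs', ← sum_mul, ← mul_sum]
    simp; ring
  have t3 : ∑ a, ∑ v, ∑ b, ∑ w, ind (G.Adj a v) * (ind (w = a) * ind (G.Adj b w))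
      = (n : ℝ) * k ^ 2 := by
    simp only [hs, hs', sum_ind_eq_mul, ← sum_mul, ← mul_sum]
    simp; ring
  have t4 : ∑ a, ∑ v, ∑ b, ∑ w, ind (G.Adj a v) * ind (b = v) * ind (G.Adj b w)
      = (n : ℝ) * k ^ 2 := by
    simp only [hs, sum_ind_eq, ← sum_mul, ← mul_sum]
    simp; ring
  have hk : (n : ℝ) * k ^ 2 ≤ n * k ^ 3 := by
    rcases Nat.eq_zero_or_pos k with rfl | hk
    · simp
    · have : (1 : ℝ) ≤ k := by exact_mod_cast hk
      gcongr
      norm_num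
  calc _ ≤ ∑ a, ∑ v, ∑ b, ∑ w, (ind (G.Adj a v) * ind (G.Adj b w) * ind (G.Adj a w)
        + ind (G.Adj a v) * ind (G.Adj b v) * ind (G.Adj b w)
        + ind (G.Adj a v) * (ind (w = a) * ind (G.Adj b w))
        + ind (G.Adj a v) * ind (b = v) * ind (G.Adj b w)) := by
        gcongr; exact le_ind_pat _ _ _ _ G
    _ ≤ _ := by
        simp_rw [sum_add_distrib]
        rw [t1, t2, t3, t4]
        linarith

lemma sum_bad_mul_le (hG : ∀ x, deg G x = k) (hf : ∀ x, |f x| ≤ B) :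
    |∑ a, ∑ v, ∑ b, ∑ w,
        (ind (G.Adj a v) * ind (G.Adj b w) - ind (Pat ⊥ a v b w G)) * (f a * f v)|
      ≤ 4 * (n * k ^ 3) * B ^ 2 := by
  calc _ ≤ ∑ a, ∑ v, ∑ b, ∑ w,
        (ind (G.Adj a v) * ind (G.Adj b w) - ind (Pat ⊥ a v b w G)) * B ^ 2 := by
        refine (abs_sum_le_sum_abs _ _).trans (sum_le_sum fun a _ => ?_)
        refine (abs_sum_le_sum_abs _ _).trans (sum_le_sum fun v _ => ?_)
        refine (abs_sum_le_sum_abs _ _).trans (sum_le_sum fun b _ => ?_)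
        refine (abs_sum_le_sum_abs _ _).trans (sum_le_sum fun w _ => ?_)
        have := sub_nonneg.2 (ind_pat_le a v b w G)
        rw [abs_mul, abs_of_nonneg this]
        gcongr
        exact abs_mul_le_of_abs_le hf a v
    _ = (∑ a, ∑ v, ∑ b, ∑ w,
        (ind (G.Adj a v) * ind (G.Adj b w) - ind (Pat ⊥ a v b w G))) * B ^ 2 := by
        simp_rw [sum_mul]
    _ ≤ _ := by gcongr; exact sum_bad_le hG

lemma sum_bad_mul_le' (hG : ∀ x, deg G x = k) (hf : ∀ x, |f x| ≤ B) :
    |∑ a, ∑ v, ∑ b, ∑ w,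
        (ind (G.Adj a w) * ind (G.Adj b v) - ind (Pat ⊥ a w b v G)) * (f a * f v)|
      ≤ 4 * (n * k ^ 3) * B ^ 2 := by
  calc _ ≤ ∑ a, ∑ v, ∑ b, ∑ w,
        (ind (G.Adj a w) * ind (G.Adj b v) - ind (Pat ⊥ a w b v G)) * B ^ 2 := by
        refine (abs_sum_le_sum_abs _ _).trans (sum_le_sum fun a _ => ?_)
        refine (abs_sum_le_sum_abs _ _).trans (sum_le_sum fun v _ => ?_)
        refine (abs_sum_le_sum_abs _ _).trans (sum_le_sum fun b _ => ?_)
        refine (abs_sum_le_sum_abs _ _).trans (sum_le_sum fun w _ => ?_)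
        have := sub_nonneg.2 (ind_pat_le a w b v G)
        rw [abs_mul, abs_of_nonneg this]
        gcongr
        exact abs_mul_le_of_abs_le hf a v
    _ = (∑ a, ∑ v, ∑ b, ∑ w,
        (ind (G.Adj a v) * ind (G.Adj b w) - ind (Pat ⊥ a v b w G))) * B ^ 2 := by
        simp_rw [sum_mul]
        exact sum_congr rfl fun a _ => sum_sum_sum_swap _
    _ ≤ _ := by gcongr; exact sum_bad_le hG

lemma abs_sum_pat_sw_sub_le (hG : ∀ x, deg G x = k) (hf : ∀ x, |f x| ≤ B)
    (hc : 8 * (|c| * B ^ 2) ≤ 1) :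
    |∑ a, ∑ v, ∑ b, ∑ w,
        ind (Pat ⊥ a v b w G) * Real.exp (c * esum f (sw a v b w G)) * (f a * f v)
      - n * k * (Real.exp (c * esum f G) * esum f G)|
      ≤ (4 * (n * k ^ 3) * B ^ 2 + 16 * (|c| * B ^ 2) * (n * k) ^ 2 * B ^ 2)
        * Real.exp (c * esum f G) := by
  set E := Real.exp (c * esum f G) with hE
  have hE0 : 0 < E := Real.exp_pos _
  have h1 : ∑ a, ∑ v, ∑ b, ∑ w, ind (G.Adj a v) * ind (G.Adj b w) * (f a * f v)
      = n * k * esum f G := by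
    calc _ = ∑ a, ∑ v, ∑ b, ∑ w, (ind (G.Adj a v) * (f a * f v)) * ind (G.Adj b w) := by
          refine sum_congr rfl fun a _ => sum_congr rfl fun v _ => sum_congr rfl fun b _ =>
            sum_congr rfl fun w _ => by ring
      _ = _ := by
          rw [esum, mul_sum]
          refine sum_congr rfl fun a _ => ?_
          rw [mul_sum]
          refine sum_congr rfl fun v _ => ?_
          simp only [← mul_sum, sum_adj_eq hG, sum_const, card_univ, Fintype.card_fin,
            nsmul_eq_mul]
          ring
  have h2 : ∑ a, ∑ v, ∑ b, ∑ w, ind (G.Adj a v) * ind (G.Adj b w) = ((n : ℝ) * k) ^ 2 := by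
    simp only [← sum_mul, ← mul_sum, sum_adj_eq hG, sum_const, card_univ, Fintype.card_fin,
      nsmul_eq_mul]
    ring
  have e : ∑ a, ∑ v, ∑ b, ∑ w,
        ind (Pat ⊥ a v b w G) * Real.exp (c * esum f (sw a v b w G)) * (f a * f v)
      - n * k * (E * esum f G)
      = ∑ a, ∑ v, ∑ b, ∑ w,
          ind (Pat ⊥ a v b w G) * (Real.exp (c * esum f (sw a v b w G)) - E) * (f a * f v)
        - (∑ a, ∑ v, ∑ b, ∑ w,
          (ind (G.Adj a v) * ind (G.Adj b w) - ind (Pat ⊥ a v b w G)) * (f a * f v)) * E := by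
    rw [show n * k * (E * esum f G) = (n * k * esum f G) * E by ring, ← h1]
    simp_rw [sum_mul, ← sum_sub_distrib]
    refine sum_congr rfl fun a _ => sum_congr rfl fun v _ => sum_congr rfl fun b _ =>
      sum_congr rfl fun w _ => by ring
  have h3 : |∑ a, ∑ v, ∑ b, ∑ w,
      ind (Pat ⊥ a v b w G) * (Real.exp (c * esum f (sw a v b w G)) - E) * (f a * f v)|
      ≤ 16 * (|c| * B ^ 2) * (n * k) ^ 2 * B ^ 2 * E := by
    calc _ ≤ ∑ a, ∑ v, ∑ b, ∑ w,
          ind (G.Adj a v) * ind (G.Adj b w) * (16 * (|c| * B ^ 2) * E * B ^ 2) := by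
          refine (abs_sum_le_sum_abs _ _).trans (sum_le_sum fun a _ => ?_)
          refine (abs_sum_le_sum_abs _ _).trans (sum_le_sum fun v _ => ?_)
          refine (abs_sum_le_sum_abs _ _).trans (sum_le_sum fun b _ => ?_)
          refine (abs_sum_le_sum_abs _ _).trans (sum_le_sum fun w _ => ?_)
          have hnn : 0 ≤ ind (G.Adj a v) * ind (G.Adj b w) :=
            mul_nonneg (ind_nonneg _) (ind_nonneg _)
          by_cases hp : Pat ⊥ a v b w G
          · have := ind_pat_le a v b w G
            rw [abs_mul, abs_mul, abs_of_nonneg (ind_nonneg _), mul_assoc]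
            exact mul_le_mul this (mul_le_mul (abs_exp_esum_sw_sub_le hp hf hc)
              (abs_mul_le_of_abs_le hf a v) (abs_nonneg _) (by positivity))
              (mul_nonneg (abs_nonneg _) (abs_nonneg _)) hnn
          · rw [ind_false hp, zero_mul, zero_mul, abs_zero]
            positivity
      _ = _ := by
          simp_rw [← sum_mul]
          rw [h2]
          ring
  rw [e]
  refine (abs_sub _ _).trans ?_
  rw [abs_mul _ E, abs_of_pos hE0]
  have := mul_le_mul_of_nonneg_right (sum_bad_mul_le hG hf) hE0.le
  linarith

lemma abs_sum_pat_le (hG : ∀ x, deg G x = k) (hf : ∀ x, |f x| ≤ B) (hf0 : ∑ x, f x = 0) (e : ℝ)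
    (he : 0 ≤ e) :
    |∑ a, ∑ v, ∑ b, ∑ w, ind (Pat ⊥ a w b v G) * e * (f a * f v)|
      ≤ 4 * (n * k ^ 3) * B ^ 2 * e := by
  have h1 : ∑ a, ∑ v, ∑ b, ∑ w, ind (G.Adj a w) * ind (G.Adj b v) * (f a * f v) = 0 := by
    calc _ = ∑ a, ∑ v, ∑ b, ∑ w, (f a * f v) * ind (G.Adj b v) * ind (G.Adj a w) := by
          refine sum_congr rfl fun a _ => sum_congr rfl fun v _ => sum_congr rfl fun b _ =>
            sum_congr rfl fun w _ => by ring
      _ = _ := by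
          simp only [← sum_mul, ← mul_sum, sum_adj_eq hG, sum_adj_eq' hG, hf0]
          simp
  have e : ∑ a, ∑ v, ∑ b, ∑ w, ind (Pat ⊥ a w b v G) * e * (f a * f v)
      = - ((∑ a, ∑ v, ∑ b, ∑ w,
        (ind (G.Adj a w) * ind (G.Adj b v) - ind (Pat ⊥ a w b v G)) * (f a * f v)) * e) := by
    rw [← zero_sub, ← zero_mul e, ← h1, ← sub_mul]
    simp_rw [← sum_sub_distrib, sum_mul]
    refine sum_congr rfl fun a _ => sum_congr rfl fun v _ => sum_congr rfl fun b _ =>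
      sum_congr rfl fun w _ => by ring
  rw [e, abs_neg, abs_mul, abs_of_nonneg he]
  exact mul_le_mul_of_nonneg_right (sum_bad_mul_le' hG hf) he

lemma abs_sum_exp_mul_esum_le (n k : ℕ) {f : Fin n → ℝ} (hf : ∀ x, |f x| ≤ B)
    (hf0 : ∑ x, f x = 0) (hc : 8 * (|c| * B ^ 2) ≤ 1) (hn : 0 < n) (hk : 0 < k) :
    |∑ G ∈ fam (fun _ : Fin n => k) ⊥, Real.exp (c * esum f G) * esum f G|
      ≤ (8 * k ^ 2 + 16 * (|c| * B ^ 2) * (n * k)) * B ^ 2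
        * ∑ G ∈ fam (fun _ : Fin n => k) ⊥, Real.exp (c * esum f G) := by
  have hdeg : ∀ G ∈ fam (fun _ : Fin n => k) ⊥, ∀ x, deg G x = k := fun G hG => (mem_fam.1 hG).1
  set F := fam (fun _ : Fin n => k) ⊥
  have hsw : ∑ G ∈ F, ∑ a, ∑ v, ∑ b, ∑ w,
        ind (Pat ⊥ a v b w G) * Real.exp (c * esum f (sw a v b w G)) * (f a * f v)
      = ∑ G ∈ F, ∑ a, ∑ v, ∑ b, ∑ w,
        ind (Pat ⊥ a w b v G) * Real.exp (c * esum f G) * (f a * f v) := by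
    simp_rw [sum_comm (s := F), ← sum_mul]
    refine sum_congr rfl fun a _ => sum_congr rfl fun v _ => congrArg (· * (f a * f v)) <|
      sum_congr rfl fun b _ => sum_congr rfl fun w _ => ?_
    rw [sum_sw _ _ a v b w fun G => Real.exp (c * esum f G)]
  have hnk : (0 : ℝ) < n * k := by positivity
  have h1 := (abs_sum_le_sum_abs _ _).trans (sum_le_sum fun G hG =>
    abs_sum_pat_sw_sub_le (c := c) (hdeg G hG) hf hc)
  have h2 := (abs_sum_le_sum_abs _ _).trans (sum_le_sum fun G hG =>
    abs_sum_pat_le (hdeg G hG) hf hf0 (Real.exp (c * esum f G)) (Real.exp_pos _).le)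
  rw [sum_sub_distrib, ← mul_sum, ← mul_sum, hsw] at h1
  rw [← mul_sum] at h2
  refine le_of_mul_le_mul_left ?_ hnk
  rw [← abs_of_pos hnk, ← abs_mul, abs_of_pos hnk]
  set S := ∑ G ∈ F, Real.exp (c * esum f G)
  have h3 := abs_sub_abs_le_abs_sub
    (n * k * ∑ G ∈ F, Real.exp (c * esum f G) * esum f G) (∑ G ∈ F, ∑ a, ∑ v, ∑ b, ∑ w,
        ind (Pat ⊥ a w b v G) * Real.exp (c * esum f G) * (f a * f v))
  rw [abs_sub_comm] at h1
  have e : (n : ℝ) * k * ((8 * k ^ 2 + 16 * (|c| * B ^ 2) * (n * k)) * B ^ 2 * S)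
      = (4 * (n * k ^ 3) * B ^ 2 + 16 * (|c| * B ^ 2) * (n * k) ^ 2 * B ^ 2) * S
        + 4 * (n * k ^ 3) * B ^ 2 * S := by ring
  rw [e]
  linarith

/-- The exponential sum over regular graphs is close to the number of regular graphs. -/
lemma abs_log_sum_exp_le (n k : ℕ) {f : Fin n → ℝ} (hf : ∀ x, |f x| ≤ B)
    (hf0 : ∑ x, f x = 0) (hc : 8 * (|c| * B ^ 2) ≤ 1) (hn : 0 < n) (hk : 0 < k)
    (hne : (fam (fun _ : Fin n => k) ⊥).Nonempty) :
    |Real.log (∑ G ∈ fam (fun _ : Fin n => k) ⊥, Real.exp (c * esum f G))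
        - Real.log (fam (fun _ : Fin n => k) ⊥).card|
      ≤ |c| * B ^ 2 * (8 * k ^ 2 + 16 * (|c| * B ^ 2) * (n * k)) := by
  set F := fam (fun _ : Fin n => k) ⊥ with hF
  set φ : ℝ → ℝ := fun s => ∑ G ∈ F, Real.exp (s * esum f G) with hφ
  have hpos : ∀ s, 0 < φ s := fun s => sum_pos (fun G _ => Real.exp_pos _) hne
  have hder : ∀ s, HasDerivAt φ (∑ G ∈ F, Real.exp (s * esum f G) * esum f G) s := fun s => by
    refine HasDerivAt.fun_sum fun G _ => ?_
    exact ((hasDerivAt_id s).mul_const (esum f G)).exp.congr_deriv (by simp)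
  have hder' : ∀ s ∈ Set.uIcc 0 c, HasDerivWithinAt (fun s => Real.log (φ s))
      ((∑ G ∈ F, Real.exp (s * esum f G) * esum f G) / φ s) (Set.uIcc 0 c) s := fun s _ =>
    ((hder s).log (hpos s).ne').hasDerivWithinAt
  have hbd : ∀ s ∈ Set.uIcc 0 c, ‖(∑ G ∈ F, Real.exp (s * esum f G) * esum f G) / φ s‖
      ≤ (8 * k ^ 2 + 16 * (|c| * B ^ 2) * (n * k)) * B ^ 2 := fun s hs => by
    have hsc : |s| ≤ |c| := by
      have := Set.abs_sub_left_of_mem_uIcc hs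
      simpa using this
    have hs' : |s| * B ^ 2 ≤ |c| * B ^ 2 := by gcongr
    rw [Real.norm_eq_abs, abs_div, abs_of_pos (hpos s), div_le_iff₀ (hpos s)]
    refine (abs_sum_exp_mul_esum_le n k hf hf0 (by linarith) hn hk).trans ?_
    have := hpos s
    gcongr
  have := (convex_uIcc (0 : ℝ) c).norm_image_sub_le_of_norm_hasDerivWithin_le hder' hbd
    Set.left_mem_uIcc Set.right_mem_uIcc
  have e0 : φ 0 = F.card := by simp [hφ]
  rw [Real.norm_eq_abs, Real.norm_eq_abs, e0, sub_zero] at this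
  refine this.trans (le_of_eq ?_)
  ring

end ExponentialSum

section Words

open Finset

variable {n m k : ℕ} {g : Fin m × Bool → Fin n} {q p p' r x y : Fin m × Bool}

/-- The other half of the edge to which a half-edge belongs. -/
def bar (p : Fin m × Bool) : Fin m × Bool := (p.1, !p.2)

@[simp] lemma bar_bar (p : Fin m × Bool) : bar (bar p) = p := by simp [bar]

@[simp] lemma bar_fst (p : Fin m × Bool) : (bar p).1 = p.1 := rfl

lemma bar_ne (p : Fin m × Bool) : bar p ≠ p := by
  intro h
  have := congrArg Prod.snd h
  simp [bar] at this

lemma bar_injective : Function.Injective (bar (m := m)) :=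
  Function.LeftInverse.injective bar_bar

lemma eq_or_eq_bar (h : x.1 = y.1) : x = y ∨ x = bar y := by
  obtain ⟨i, b⟩ := x
  obtain ⟨j, c⟩ := y
  obtain rfl : i = j := h
  cases b <;> cases c <;> simp [bar]

/-- Sequences of `m` edges, given by their half-edges, using every vertex exactly `k` times. -/
noncomputable def words (n m k : ℕ) : Finset (Fin m × Bool → Fin n) :=
  univ.filter fun g => ∀ v, (univ.filter fun p => g p = v).card = k

lemma sum_word (hg : g ∈ words n m k) (v : Fin n) : ∑ p, ind (g p = v) = k := by
  rw [sum_ind, ← (mem_filter.1 hg).2 v]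
  congr!

lemma sum_word' (hg : g ∈ words n m k) (v : Fin n) : ∑ p, ind (v = g p) = k := by
  rw [← sum_word hg v]
  exact sum_congr rfl fun p _ => ind_congr eq_comm

lemma sum_comp_bar (f : Fin m × Bool → ℝ) : ∑ p, f (bar p) = ∑ p, f p :=
  Equiv.sum_comp (Function.Involutive.toPerm bar bar_bar) f

lemma comp_mem_words (τ : Equiv.Perm (Fin m × Bool)) : g ∘ τ ∈ words n m k ↔ g ∈ words n m k := by
  simp only [words, mem_filter, mem_univ, true_and]
  refine forall_congr' fun v => ?_
  have : (univ.filter fun p => (g ∘ τ) p = v).card = (univ.filter fun p => g p = v).card :=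
    card_equiv τ (by simp)
  rw [this]

lemma sum_words_comp (τ : Equiv.Perm (Fin m × Bool)) (F : (Fin m × Bool → Fin n) → ℝ) :
    ∑ g ∈ words n m k, F (g ∘ τ) = ∑ g ∈ words n m k, F g :=
  sum_equiv (Equiv.arrowCongr τ.symm (Equiv.refl _))
    (fun g => (comp_mem_words (g := g) τ).symm) fun _ _ => rfl

/-- Two half-edges point along the same pair of vertices. -/
def Conf (g : Fin m × Bool → Fin n) (x y : Fin m × Bool) : Prop :=
  g x = g y ∧ g (bar x) = g (bar y)

lemma Conf.symm (h : Conf g x y) : Conf g y x := ⟨h.1.symm, h.2.symm⟩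

lemma Conf.bar (h : Conf g x y) : Conf g (bar x) (bar y) := ⟨h.2, by simpa using h.1⟩

/-- The conflicts of a word: they are absent exactly if the word comes from a simple graph. -/
noncomputable def confs (g : Fin m × Bool → Fin n) : Finset ((Fin m × Bool) × (Fin m × Bool)) :=
  univ.filter fun e => e.1 ≠ e.2 ∧ Conf g e.1 e.2

lemma card_confs (g : Fin m × Bool → Fin n) :
    ((confs g).card : ℝ) = ∑ x, ∑ y, ind (x ≠ y ∧ Conf g x y) := by
  rw [← sum_product', univ_product_univ, sum_ind (univ : Finset ((Fin m × Bool) × (Fin m × Bool)))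
    fun e => e.1 ≠ e.2 ∧ Conf g e.1 e.2, confs]
  congr!

/-- Two half-edges start at equal or adjacent vertices. -/
def Near (g : Fin m × Bool → Fin n) (x y : Fin m × Bool) : Prop :=
  g x = g y ∨ ∃ z, g z = g x ∧ g (bar z) = g y

lemma Near.symm (h : Near g x y) : Near g y x := by
  obtain h | ⟨z, h1, h2⟩ := h
  · exact Or.inl h.symm
  · exact Or.inr ⟨bar z, h2, by simpa using h1⟩

lemma ind_exists_le {α : Type*} [Fintype α] (P : α → Prop) : ind (∃ z, P z) ≤ ∑ z, ind (P z) := by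
  by_cases h : ∃ z, P z
  · obtain ⟨z, hz⟩ := h
    rw [ind_true ⟨z, hz⟩, ← ind_true hz]
    exact single_le_sum (f := fun z => ind (P z)) (fun z _ => ind_nonneg _) (mem_univ z)
  · rw [ind_false h]
    exact sum_nonneg fun z _ => ind_nonneg _

lemma sum_near_le (hg : g ∈ words n m k) (x : Fin m × Bool) :
    ∑ y, ind (Near g x y) ≤ k + k ^ 2 := by
  calc _ ≤ ∑ y, (ind (g x = g y) + ∑ z, ind (g z = g x) * ind (g (bar z) = g y)) := by
        refine sum_le_sum fun y _ => (ind_or_le _ _).trans ?_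
        gcongr
        simp_rw [← ind_and]
        exact ind_exists_le _
    _ = _ := by
        rw [sum_add_distrib, sum_comm]
        simp_rw [← mul_sum, sum_word' hg, ← sum_mul, sum_word hg]
        ring

lemma sum_near_le' (hg : g ∈ words n m k) (x : Fin m × Bool) :
    ∑ y, ind (Near g y x) ≤ k + k ^ 2 := by
  rw [sum_congr rfl fun y _ => ind_congr ⟨Near.symm, Near.symm⟩]
  exact sum_near_le hg x

/-- Exchange the content of `q` with that of `p` and the content of `bar q` with that of `p'`. -/
def move (g : Fin m × Bool → Fin n) (q p p' : Fin m × Bool) : Fin m × Bool → Fin n :=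
  g ∘ (Equiv.swap q p * Equiv.swap (bar q) p' : Equiv.Perm (Fin m × Bool))

lemma sum_words_move (q p p' : Fin m × Bool) (F : (Fin m × Bool → Fin n) → ℝ) :
    ∑ g ∈ words n m k, F (move g q p p') = ∑ g ∈ words n m k, F g :=
  sum_words_comp _ F

/-- Three half-edges belong to different edges. -/
structure Spread (q p p' : Fin m × Bool) : Prop where
  pq : p.1 ≠ q.1
  pq' : p'.1 ≠ q.1
  pp : p.1 ≠ p'.1

lemma ne_of_fst_ne (h : x.1 ≠ y.1) : x ≠ y := fun e => h (congrArg _ e)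

namespace Spread

lemma move_left (h : Spread q p p') : move g q p p' q = g p := by
  simp only [move, Function.comp, Equiv.Perm.mul_apply]
  rw [Equiv.swap_apply_of_ne_of_ne (bar_ne q).symm (ne_of_fst_ne h.pq'.symm),
    Equiv.swap_apply_left]

lemma move_bar_left (h : Spread q p p') : move g q p p' (bar q) = g p' := by
  simp only [move, Function.comp, Equiv.Perm.mul_apply]
  rw [Equiv.swap_apply_left, Equiv.swap_apply_of_ne_of_ne (ne_of_fst_ne h.pq')
    (ne_of_fst_ne h.pp.symm)]

lemma move_mid (h : Spread q p p') : move g q p p' p = g q := by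
  simp only [move, Function.comp, Equiv.Perm.mul_apply]
  rw [Equiv.swap_apply_of_ne_of_ne (ne_of_fst_ne (by simpa using h.pq)) (ne_of_fst_ne h.pp),
    Equiv.swap_apply_right]

lemma move_right (h : Spread q p p') : move g q p p' p' = g (bar q) := by
  simp only [move, Function.comp, Equiv.Perm.mul_apply]
  rw [Equiv.swap_apply_right, Equiv.swap_apply_of_ne_of_ne (bar_ne q)
    (ne_of_fst_ne (by simpa using h.pq.symm))]

lemma move_bar_mid (h : Spread q p p') : move g q p p' (bar p) = g (bar p) := by
  simp only [move, Function.comp, Equiv.Perm.mul_apply]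
  rw [Equiv.swap_apply_of_ne_of_ne (x := bar p) (a := bar q) (b := p')
    (ne_of_fst_ne (by simpa using h.pq)) (ne_of_fst_ne (by simpa using h.pp)),
    Equiv.swap_apply_of_ne_of_ne (ne_of_fst_ne (by simpa using h.pq)) (bar_ne p)]

lemma move_bar_right (h : Spread q p p') : move g q p p' (bar p') = g (bar p') := by
  simp only [move, Function.comp, Equiv.Perm.mul_apply]
  rw [Equiv.swap_apply_of_ne_of_ne (ne_of_fst_ne (by simpa using h.pq')) (bar_ne p'),
    Equiv.swap_apply_of_ne_of_ne (ne_of_fst_ne (by simpa using h.pq'))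
    (ne_of_fst_ne (by simpa using h.pp.symm))]

end Spread

lemma move_other (h1 : x.1 ≠ q.1) (h2 : x.1 ≠ p.1) (h3 : x.1 ≠ p'.1) :
    move g q p p' x = g x := by
  simp only [move, Function.comp, Equiv.Perm.mul_apply]
  rw [Equiv.swap_apply_of_ne_of_ne (ne_of_fst_ne (by simpa using h1)) (ne_of_fst_ne h3),
    Equiv.swap_apply_of_ne_of_ne (ne_of_fst_ne h1) (ne_of_fst_ne h2)]

/-- The move does not create conflicts at the edges of `p` and `p'`. -/
structure Safe (g : Fin m × Bool → Fin n) (q p p' : Fin m × Bool) : Prop extends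
    Spread q p p' where
  n1 : ¬ Near g q (bar p)
  n2 : ¬ Near g (bar q) (bar p')
  e1 : g p ≠ g q
  e2 : g p' ≠ g q
  e3 : g p ≠ g (bar q)
  e4 : g p' ≠ g (bar q)
  e5 : g q ≠ g (bar p')
  e6 : ¬ (g q = g (bar q) ∧ g (bar p) = g (bar p'))

lemma Safe.not_conf (h : Safe g q p p') (hxy : x ≠ y) (hx : x.1 = p.1 ∨ x.1 = p'.1) :
    ¬ Conf (move g q p p') x y := by
  have hs := h.toSpread
  have main : ∀ y, (y ≠ p → ¬ Conf (move g q p p') p y) ∧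
      (y ≠ p' → ¬ Conf (move g q p p') p' y) := by
    intro y
    rw [Conf, Conf, hs.move_mid, hs.move_right, hs.move_bar_mid, hs.move_bar_right]
    by_cases c1 : y.1 = q.1
    · obtain rfl | rfl := eq_or_eq_bar c1
      · rw [hs.move_left]
        exact ⟨fun _ c => h.e1 c.1.symm, fun _ c => h.e3 c.1.symm⟩
      · rw [hs.move_bar_left]
        exact ⟨fun _ c => h.e2 c.1.symm, fun _ c => h.e4 c.1.symm⟩
    by_cases c2 : y.1 = p.1
    · obtain rfl | rfl := eq_or_eq_bar c2
      · rw [hs.move_mid, hs.move_bar_mid]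
        exact ⟨fun c => absurd rfl c, fun _ c => h.e6 ⟨c.1.symm, c.2.symm⟩⟩
      · rw [hs.move_bar_mid, bar_bar, hs.move_mid]
        exact ⟨fun _ c => h.n1 (Or.inl c.1), fun _ c => h.e5 c.2.symm⟩
    by_cases c3 : y.1 = p'.1
    · obtain rfl | rfl := eq_or_eq_bar c3
      · rw [hs.move_right, hs.move_bar_right]
        exact ⟨fun _ c => h.e6 c, fun c => absurd rfl c⟩
      · rw [hs.move_bar_right, bar_bar, hs.move_right]
        exact ⟨fun _ c => h.e5 c.1, fun _ c => h.n2 (Or.inl c.1)⟩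
    rw [move_other c1 c2 c3, move_other (x := bar y) c1 c2 c3]
    exact ⟨fun _ c => h.n1 (Or.inr ⟨y, c.1.symm, c.2.symm⟩),
      fun _ c => h.n2 (Or.inr ⟨y, c.1.symm, c.2.symm⟩)⟩
  intro c
  rcases hx with hx | hx <;> obtain rfl | rfl := eq_or_eq_bar hx
  · exact (main y).1 hxy.symm c
  · exact (main (bar y)).1 (fun e => hxy (by rw [← e, bar_bar])) (by simpa using c.bar)
  · exact (main y).2 hxy.symm c
  · exact (main (bar y)).2 (fun e => hxy (by rw [← e, bar_bar])) (by simpa using c.bar)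

/-- The conflicts involving one of three edges. -/
noncomputable def touch (g : Fin m × Bool → Fin n) (q p p' : Fin m × Bool) :
    Finset ((Fin m × Bool) × (Fin m × Bool)) :=
  (confs g).filter fun e => (e.1.1 = q.1 ∨ e.1.1 = p.1 ∨ e.1.1 = p'.1) ∨
    (e.2.1 = q.1 ∨ e.2.1 = p.1 ∨ e.2.1 = p'.1)

lemma card_confs_move (g : Fin m × Bool → Fin n) (q p p' : Fin m × Bool) :
    (confs (move g q p p')).card + (touch g q p p').card
      = (confs g).card + (touch (move g q p p') q p p').card := by
  have e : (confs (move g q p p')).filter (fun e => ¬ ((e.1.1 = q.1 ∨ e.1.1 = p.1 ∨ e.1.1 = p'.1) ∨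
    (e.2.1 = q.1 ∨ e.2.1 = p.1 ∨ e.2.1 = p'.1)))
      = (confs g).filter (fun e => ¬ ((e.1.1 = q.1 ∨ e.1.1 = p.1 ∨ e.1.1 = p'.1) ∨
    (e.2.1 = q.1 ∨ e.2.1 = p.1 ∨ e.2.1 = p'.1))) := by
    ext ⟨x, y⟩
    simp only [confs, mem_filter, mem_univ, true_and]
    refine and_congr_left fun h => and_congr_right fun _ => ?_
    push Not at h
    obtain ⟨⟨h1, h2, h3⟩, h4, h5, h6⟩ := h
    rw [Conf, Conf, move_other h1 h2 h3, move_other h4 h5 h6,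
      move_other (x := bar x) h1 h2 h3, move_other (x := bar y) h4 h5 h6]
  rw [← card_filter_add_card_filter_not (s := confs (move g q p p')) (fun e =>
    ((e.1.1 = q.1 ∨ e.1.1 = p.1 ∨ e.1.1 = p'.1) ∨ (e.2.1 = q.1 ∨ e.2.1 = p.1 ∨ e.2.1 = p'.1))),
    ← card_filter_add_card_filter_not (s := confs g) (fun e =>
    ((e.1.1 = q.1 ∨ e.1.1 = p.1 ∨ e.1.1 = p'.1) ∨ (e.2.1 = q.1 ∨ e.2.1 = p.1 ∨ e.2.1 = p'.1))), e]
  simp only [touch]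
  ring

end Words

section Words

open Finset

variable {n m k : ℕ} {g : Fin m × Bool → Fin n} {q p p' r x y : Fin m × Bool}

lemma sum_fst (q : Fin m × Bool) : ∑ p : Fin m × Bool, ind (p.1 = q.1) = 2 := by
  rw [Fintype.sum_prod_type]
  simp only [Fintype.sum_bool, sum_add_distrib, sum_ind_eq]
  norm_num

lemma sum_const_half (c : ℝ) : ∑ _p : Fin m × Bool, c = 2 * m * c := by
  rw [sum_const, card_univ, nsmul_eq_mul, Fintype.card_prod, Fintype.card_fin, Fintype.card_bool]
  push_cast
  ring

/-- Few pairs of half-edges are bad for a given half-edge. -/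
lemma sum_bad_pairs_le (hg : g ∈ words n m k) (hk : 0 < k) (q r : Fin m × Bool) :
    ∑ p, ∑ p', ind (¬ (Safe g q p p' ∧ ¬ Near g p p' ∧ r.1 ≠ p.1 ∧ r.1 ≠ p'.1))
      ≤ 22 * k ^ 2 * (2 * m) := by
  have pt : ∀ p p', ind (¬ (Safe g q p p' ∧ ¬ Near g p p' ∧ r.1 ≠ p.1 ∧ r.1 ≠ p'.1))
      ≤ (ind (p.1 = q.1) + (ind (Near g q (bar p)) + (ind (g p = g q) + (ind (g p = g (bar q))
        + ind (p.1 = r.1))))) + ((ind (p'.1 = q.1) + (ind (Near g (bar q) (bar p'))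
        + (ind (g p' = g q) + (ind (g p' = g (bar q)) + (ind (g (bar p') = g q)
        + ind (p'.1 = r.1)))))) + (ind (p'.1 = p.1) + (ind (g (bar p') = g (bar p))
        + ind (Near g p p')))) := by
    intro p p'
    have : ¬ (Safe g q p p' ∧ ¬ Near g p p' ∧ r.1 ≠ p.1 ∧ r.1 ≠ p'.1) →
      (p.1 = q.1 ∨ Near g q (bar p) ∨ g p = g q ∨ g p = g (bar q) ∨ p.1 = r.1) ∨
      (p'.1 = q.1 ∨ Near g (bar q) (bar p') ∨ g p' = g q ∨ g p' = g (bar q) ∨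
        g (bar p') = g q ∨ p'.1 = r.1) ∨ p'.1 = p.1 ∨ g (bar p') = g (bar p) ∨ Near g p p' := by
      intro h
      by_contra c
      push Not at c
      obtain ⟨⟨c1, c2, c3, c4, c5⟩, ⟨c6, c7, c8, c9, c10, c11⟩, c12, c13, c14⟩ := c
      exact h ⟨⟨⟨c1, c6, c12.symm⟩, c2, c7, c3, c8, c4, c9, c10.symm, fun e => c13 e.2.symm⟩,
        c14, c5.symm, c11.symm⟩
    refine (ind_le_ind this).trans ?_
    refine (ind_or_le _ _).trans (add_le_add ?_ ((ind_or_le _ _).trans (add_le_add ?_ ?_)))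
    · exact (ind_or_le _ _).trans (add_le_add le_rfl <| (ind_or_le _ _).trans
        (add_le_add le_rfl <| (ind_or_le _ _).trans (add_le_add le_rfl <| ind_or_le _ _)))
    · exact (ind_or_le _ _).trans (add_le_add le_rfl <| (ind_or_le _ _).trans
        (add_le_add le_rfl <| (ind_or_le _ _).trans (add_le_add le_rfl <| (ind_or_le _ _).trans
        (add_le_add le_rfl <| ind_or_le _ _))))
    · exact (ind_or_le _ _).trans (add_le_add le_rfl <| ind_or_le _ _)
  refine (sum_le_sum fun p _ => sum_le_sum fun p' _ => pt p p').trans ?_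
  have b : ∀ f : Fin m × Bool → ℝ, ∑ p, f (bar p) = ∑ p, f p := sum_comp_bar
  have nq := sum_near_le hg q
  have nq' := sum_near_le hg (bar q)
  have np : ∑ p, ∑ p', ind (Near g p p') ≤ 2 * m * (k + k ^ 2) := by
    rw [← sum_const_half]
    exact sum_le_sum fun p _ => sum_near_le hg p
  simp only [sum_add_distrib, sum_const_half, ← mul_sum, sum_fst, b fun p => ind (Near g q p),
    b fun p => ind (Near g (bar q) p), sum_word hg, b fun p => ind (g p = g q)]
  have e : ∀ p, ∑ p', ind (g (bar p') = g (bar p)) = k := fun p => by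
    rw [b fun p' => ind (g p' = g (bar p)), sum_word hg]
  simp only [e, sum_const_half]
  have hk1 : (1 : ℝ) ≤ k := by exact_mod_cast hk
  have hm : (0 : ℝ) ≤ m := m.cast_nonneg
  nlinarith [mul_le_mul_of_nonneg_left nq hm, mul_le_mul_of_nonneg_left nq' hm,
    mul_nonneg hm (sub_nonneg.2 hk1), mul_nonneg hm (mul_nonneg (sub_nonneg.2 hk1) (sub_nonneg.2 hk1)),
    mul_nonneg hm (mul_nonneg (sub_nonneg.2 hk1) (k.cast_nonneg : (0:ℝ) ≤ k))]

lemma conf_bar_iff : Conf g q (bar q) ↔ g q = g (bar q) := by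
  simp only [Conf, bar_bar]
  exact ⟨fun h => h.1, fun h => ⟨h, h.symm⟩⟩

lemma sum_loops_le (g : Fin m × Bool → Fin n) :
    ∑ q, ind (g q = g (bar q)) ≤ (confs g).card := by
  rw [card_confs]
  refine sum_le_sum fun q _ => ?_
  rw [ind_congr (show g q = g (bar q) ↔ q ≠ bar q ∧ Conf g q (bar q) by
    rw [conf_bar_iff]; exact ⟨fun h => ⟨(bar_ne q).symm, h⟩, fun h => h.2⟩)]
  exact single_le_sum (f := fun y => ind (q ≠ y ∧ Conf g q y)) (fun y _ => ind_nonneg _)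
    (mem_univ (bar q))

/-- For a fixed pair of half-edges, few half-edges violate `Safe`. -/
lemma sum_not_safe_le (hg : g ∈ words n m k) (hk : 0 < k) (hp : p.1 ≠ p'.1) :
    ∑ q, ind (¬ Safe g q p p') ≤ 13 * k ^ 2 + (confs g).card := by
  have pt : ∀ q, ind (¬ Safe g q p p') ≤ ind (q.1 = p.1) + (ind (q.1 = p'.1)
      + (ind (Near g q (bar p)) + (ind (Near g (bar q) (bar p')) + (ind (g q = g p)
      + (ind (g q = g p') + (ind (g (bar q) = g p) + (ind (g (bar q) = g p')
      + (ind (g q = g (bar p')) + ind (g q = g (bar q)))))))))) := by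
    intro q
    have : ¬ Safe g q p p' → q.1 = p.1 ∨ q.1 = p'.1 ∨ Near g q (bar p) ∨ Near g (bar q) (bar p') ∨
        g q = g p ∨ g q = g p' ∨ g (bar q) = g p ∨ g (bar q) = g p' ∨ g q = g (bar p') ∨
        g q = g (bar q) := by
      intro h
      by_contra c
      push Not at c
      obtain ⟨c1, c2, c3, c4, c5, c6, c7, c8, c9, c10⟩ := c
      exact h ⟨⟨c1.symm, c2.symm, hp⟩, c3, c4, c5.symm, c6.symm, c7.symm, c8.symm, c9,
        fun e => c10 e.1⟩
    refine (ind_le_ind this).trans ?_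
    exact (ind_or_le _ _).trans (add_le_add le_rfl <| (ind_or_le _ _).trans
        (add_le_add le_rfl <| (ind_or_le _ _).trans (add_le_add le_rfl <| (ind_or_le _ _).trans
        (add_le_add le_rfl <| (ind_or_le _ _).trans (add_le_add le_rfl <| (ind_or_le _ _).trans
        (add_le_add le_rfl <| (ind_or_le _ _).trans (add_le_add le_rfl <| (ind_or_le _ _).trans
        (add_le_add le_rfl <| ind_or_le _ _))))))))
  refine (sum_le_sum fun q _ => pt q).trans ?_
  have b : ∀ f : Fin m × Bool → ℝ, ∑ p, f (bar p) = ∑ p, f p := sum_comp_bar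
  have hl := sum_loops_le g
  have n1 := sum_near_le' hg (bar p)
  have n2 := sum_near_le' hg (bar p')
  simp only [sum_add_distrib, sum_fst, sum_word hg, b fun q => ind (Near g q (bar p')),
    b fun q => ind (g q = g p), b fun q => ind (g q = g p')]
  have hk1 : (1 : ℝ) ≤ k := by exact_mod_cast hk
  nlinarith

end Words

section Words

open Finset

variable {n m k : ℕ} {g : Fin m × Bool → Fin n} {q p p' r x y : Fin m × Bool}

lemma mem_touch {e : (Fin m × Bool) × (Fin m × Bool)} : e ∈ touch g q p p' ↔
    (e.1 ≠ e.2 ∧ Conf g e.1 e.2) ∧ ((e.1.1 = q.1 ∨ e.1.1 = p.1 ∨ e.1.1 = p'.1) ∨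
    (e.2.1 = q.1 ∨ e.2.1 = p.1 ∨ e.2.1 = p'.1)) := by
  simp [touch, confs]

lemma two_le_card_touch (h : g q = g (bar q)) : 2 ≤ (touch g q p p').card := by
  have hne : q ≠ bar q := (bar_ne q).symm
  rw [← card_pair (a := (q, bar q)) (b := (bar q, q)) (by simp [hne])]
  refine card_le_card fun e he => ?_
  have hc := conf_bar_iff.2 h
  simp only [mem_insert, mem_singleton] at he
  rw [mem_touch]
  rcases he with rfl | rfl
  · exact ⟨⟨hne, hc⟩, Or.inl (Or.inl rfl)⟩
  · exact ⟨⟨hne.symm, hc.symm⟩, Or.inl (Or.inl rfl)⟩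

lemma four_le_card_touch (hr : r.1 ≠ q.1) (h : Conf g q r) : 4 ≤ (touch g q p p').card := by
  have h1 : q ≠ r := ne_of_fst_ne hr.symm
  have h2 : q ≠ bar q := (bar_ne q).symm
  have h3 : q ≠ bar r := ne_of_fst_ne (by simpa using hr.symm)
  have h4 : r ≠ bar q := ne_of_fst_ne (by simpa using hr)
  have h5 : bar q ≠ bar r := fun e => h1 (bar_injective e)
  have : ({(q, r), (r, q), (bar q, bar r), (bar r, bar q)} :
      Finset ((Fin m × Bool) × (Fin m × Bool))).card = 4 := by
    rw [card_insert_of_notMem, card_insert_of_notMem, card_pair] <;>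
      simp [h1, h2, h3, h4, h5, h1.symm]
  rw [← this]
  refine card_le_card fun e he => ?_
  simp only [mem_insert, mem_singleton] at he
  rw [mem_touch]
  rcases he with rfl | rfl | rfl | rfl
  · exact ⟨⟨h1, h⟩, Or.inl (Or.inl rfl)⟩
  · exact ⟨⟨h1.symm, h.symm⟩, Or.inr (Or.inl rfl)⟩
  · exact ⟨⟨h5, h.bar⟩, Or.inl (Or.inl rfl)⟩
  · exact ⟨⟨h5.symm, h.bar.symm⟩, Or.inr (Or.inl rfl)⟩

/-- All conflicts of a moved word at the three edges involve the edge of `q`. -/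
lemma Safe.touch_cases (h : Safe g q p p') {e : (Fin m × Bool) × (Fin m × Bool)}
    (he : e ∈ touch (move g q p p') q p p') :
    ∃ z, ((z = bar q ∧ g p = g p') ∨ (z.1 ≠ q.1 ∧ g z = g p ∧ g (bar z) = g p')) ∧
      (e = (q, z) ∨ e = (z, q) ∨ e = (bar q, bar z) ∨ e = (bar z, bar q)) := by
  have hs := h.toSpread
  have key : ∀ z, z ≠ q → Conf (move g q p p') q z →
      ((z = bar q ∧ g p = g p') ∨ (z.1 ≠ q.1 ∧ g z = g p ∧ g (bar z) = g p')) := by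
    intro z hz hc
    have c1 : z.1 ≠ p.1 := fun e => h.not_conf hz (Or.inl e) hc.symm
    have c2 : z.1 ≠ p'.1 := fun e => h.not_conf hz (Or.inr e) hc.symm
    by_cases c3 : z.1 = q.1
    · obtain rfl | rfl := eq_or_eq_bar c3
      · exact absurd rfl hz
      · refine Or.inl ⟨rfl, ?_⟩
        have := hc.1
        rwa [hs.move_left, hs.move_bar_left] at this
    · refine Or.inr ⟨c3, ?_⟩
      rw [Conf, hs.move_left, hs.move_bar_left, move_other c3 c1 c2,
        move_other (x := bar z) c3 c1 c2] at hc
      exact ⟨hc.1.symm, hc.2.symm⟩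
  obtain ⟨x, y⟩ := e
  obtain ⟨⟨hxy, hc⟩, ht⟩ := mem_touch.1 he
  simp only at hxy hc ht
  have hx : x.1 ≠ p.1 ∧ x.1 ≠ p'.1 :=
    ⟨fun e => h.not_conf hxy (Or.inl e) hc, fun e => h.not_conf hxy (Or.inr e) hc⟩
  have hy : y.1 ≠ p.1 ∧ y.1 ≠ p'.1 :=
    ⟨fun e => h.not_conf hxy.symm (Or.inl e) hc.symm,
      fun e => h.not_conf hxy.symm (Or.inr e) hc.symm⟩
  have ht' : x.1 = q.1 ∨ y.1 = q.1 := by tauto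
  rcases ht' with e | e
  · obtain rfl | rfl := eq_or_eq_bar e
    · exact ⟨y, key y hxy.symm hc, Or.inl rfl⟩
    · refine ⟨bar y, key _ (fun e => hxy (by rw [← e, bar_bar])) (by simpa using hc.bar), ?_⟩
      simp
  · obtain rfl | rfl := eq_or_eq_bar e
    · exact ⟨x, key x hxy hc.symm, Or.inr (Or.inl rfl)⟩
    · refine ⟨bar x, key _ (fun e => hxy (by rw [← e, bar_bar])) (by simpa using hc.symm.bar), ?_⟩
      simp

lemma Safe.touch_eq_empty (h : Safe g q p p') (hp : ¬ Near g p p') :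
    touch (move g q p p') q p p' = ∅ := by
  refine eq_empty_of_forall_notMem fun e he => hp ?_
  obtain ⟨z, ⟨-, hz⟩ | ⟨-, hz⟩, -⟩ := h.touch_cases he
  · exact Or.inl hz
  · exact Or.inr ⟨z, hz⟩

lemma Safe.card_touch_le_two (h : Safe g q p p') (hp : g p = g p')
    (hl : ∀ y, g y = g p → g (bar y) ≠ g p) : (touch (move g q p p') q p p').card ≤ 2 := by
  refine (card_le_card (t := {(q, bar q), (bar q, q)}) fun e he => ?_).trans card_le_two
  obtain ⟨z, ⟨rfl, -⟩ | ⟨-, hz⟩, he⟩ := h.touch_cases he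
  · simp only [bar_bar] at he
    rw [mem_insert, mem_singleton]
    tauto
  · exact absurd (hz.2.trans hp.symm) (hl z hz.1)

lemma Safe.card_touch_le_four (h : Safe g q p p') (hp : g p = g r) (hp' : g p' = g (bar r))
    (hl : ∀ y, y ≠ r → ¬ Conf g r y) : (touch (move g q p p') q p p').card ≤ 4 := by
  refine (card_le_card (t := {(q, r), (r, q), (bar q, bar r), (bar r, bar q)})
    fun e he => ?_).trans card_le_four
  obtain ⟨z, ⟨rfl, hz⟩ | ⟨-, hz⟩, he⟩ := h.touch_cases he
  · exact absurd (conf_bar_iff.2 (by rw [← hp, hz, hp'])) (hl _ (bar_ne r))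
  · have : z = r := by
      by_contra c
      exact hl z c ⟨hp.symm.trans hz.1.symm, hp'.symm.trans hz.2.symm⟩
    subst this
    simpa using he

/-- The generating function of the number of conflicts. -/
noncomputable def confGen (n m k : ℕ) (s : ℝ) : ℝ := ∑ g ∈ words n m k, s ^ (confs g).card

/-- The part of the derivative of `confGen` that stems from loops. -/
noncomputable def loopGen (n m k : ℕ) (s : ℝ) : ℝ :=
  ∑ g ∈ words n m k, ∑ q, ind (g q = g (bar q)) * s ^ ((confs g).card - 2)

/-- The part of the derivative of `confGen` that stems from multiple edges. -/
noncomputable def multiGen (n m k : ℕ) (s : ℝ) : ℝ :=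
  ∑ g ∈ words n m k, ∑ q : Fin m × Bool, ∑ r,
    ind (r.1 ≠ q.1 ∧ Conf g q r) * s ^ ((confs g).card - 4)

variable {s : ℝ}

lemma confGen_nonneg (hs : 0 ≤ s) : 0 ≤ confGen n m k s := sum_nonneg fun _ _ => pow_nonneg hs _

lemma loopGen_nonneg (hs : 0 ≤ s) : 0 ≤ loopGen n m k s :=
  sum_nonneg fun _ _ => sum_nonneg fun _ _ => mul_nonneg (ind_nonneg _) (pow_nonneg hs _)

lemma multiGen_nonneg (hs : 0 ≤ s) : 0 ≤ multiGen n m k s :=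
  sum_nonneg fun _ _ => sum_nonneg fun _ _ => sum_nonneg fun _ _ =>
    mul_nonneg (ind_nonneg _) (pow_nonneg hs _)

lemma sum_ind_ne_and (hg : g ∈ words n m k) (p : Fin m × Bool) :
    ∑ p', ind (p' ≠ p ∧ g p' = g p) = k - 1 := by
  rw [← sum_word hg (g p), ← sum_ind_eq p, ← sum_sub_distrib]
  refine sum_congr rfl fun p' _ => ?_
  by_cases h : p' = p
  · subst h; simp [ind]
  · simp [ind, h]

lemma loopGen_le_aux (hk : 0 < k) (hs : 0 ≤ s) (hs1 : s ≤ 1) :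
    (2 * m) * (2 * m) * loopGen n m k s
      ≤ (2 * m) * (2 * m) * ((k - 1) * confGen n m k s)
        + 22 * k ^ 2 * (2 * m) * loopGen n m k s := by
  set ok : (Fin m × Bool → Fin n) → Fin m × Bool → Fin m × Bool → Fin m × Bool → Prop :=
    fun g q p p' => Safe g q p p' ∧ ¬ Near g p p' ∧ q.1 ≠ p.1 ∧ q.1 ≠ p'.1
  have pt : ∀ (g : Fin m × Bool → Fin n) q p p', ind (g q = g (bar q)) * s ^ ((confs g).card - 2)
      ≤ ind (p' ≠ p ∧ move g q p p' p' = move g q p p' p) * s ^ (confs (move g q p p')).card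
        + ind (¬ ok g q p p') * (ind (g q = g (bar q)) * s ^ ((confs g).card - 2)) := by
    intro g q p p'
    have n1 := mul_nonneg (ind_nonneg (p' ≠ p ∧ move g q p p' p' = move g q p p' p))
      (pow_nonneg hs (confs (move g q p p')).card)
    by_cases h1 : g q = g (bar q)
    · by_cases h : ok g q p p'
      · have hs := h.1.toSpread
        have e := card_confs_move g q p p'
        rw [h.1.touch_eq_empty h.2.1, card_empty] at e
        have := two_le_card_touch (p := p) (p' := p') h1
        rw [ind_true h1, ind_true ⟨(ne_of_fst_ne hs.pp).symm, by
          rw [hs.move_mid, hs.move_right, h1]⟩, ind_false (not_not.2 h)]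
        simp only [one_mul, zero_mul, add_zero]
        exact pow_le_pow_of_le_one ‹_› hs1 (by omega)
      · rw [ind_true h]; linarith
    · rw [ind_false h1]; simpa using n1
  have e1 : (2 * m) * (2 * m) * loopGen n m k s = ∑ g ∈ words n m k, ∑ q : Fin m × Bool,
      ∑ p : Fin m × Bool, ∑ p' : Fin m × Bool,
        ind (g q = g (bar q)) * s ^ ((confs g).card - 2) := by
    simp only [sum_const_half, loopGen, mul_sum, mul_assoc]
  rw [e1]
  refine (sum_le_sum fun g _ => sum_le_sum fun q _ => sum_le_sum fun p _ => sum_le_sum fun p' _ =>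
    pt g q p p').trans ?_
  simp only [sum_add_distrib]
  refine add_le_add (le_of_eq ?_) ?_
  · rw [sum_comm]
    have : ∀ q : Fin m × Bool, ∑ g ∈ words n m k, ∑ p, ∑ p',
        ind (p' ≠ p ∧ move g q p p' p' = move g q p p' p) * s ^ (confs (move g q p p')).card
        = 2 * m * ((k - 1) * confGen n m k s) := by
      intro q
      rw [sum_comm, ← sum_const_half]
      refine sum_congr rfl fun p _ => ?_
      rw [sum_comm, confGen, mul_sum]
      rw [sum_congr rfl fun p' _ => sum_words_move q p p'
        fun g => ind (p' ≠ p ∧ g p' = g p) * s ^ (confs g).card, sum_comm]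
      refine sum_congr rfl fun g hg => ?_
      rw [← sum_mul, sum_ind_ne_and hg]
    rw [sum_congr rfl fun q _ => this q, sum_const_half]
    ring
  · rw [loopGen, mul_sum]
    refine sum_le_sum fun g hg => ?_
    rw [mul_sum]
    refine sum_le_sum fun q _ => ?_
    simp_rw [← sum_mul]
    exact mul_le_mul_of_nonneg_right (sum_bad_pairs_le hg hk q q)
      (mul_nonneg (ind_nonneg _) (pow_nonneg hs _))

lemma multiGen_le_aux (hk : 0 < k) (hs : 0 ≤ s) (hs1 : s ≤ 1) :
    (2 * m) * (2 * m) * multiGen n m k s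
      ≤ (2 * m) * (2 * m) * ((k - 1) ^ 2 * confGen n m k s)
        + 22 * k ^ 2 * (2 * m) * multiGen n m k s := by
  set ok : (Fin m × Bool → Fin n) → Fin m × Bool → Fin m × Bool → Fin m × Bool →
      Fin m × Bool → Prop :=
    fun g q r p p' => Safe g q p p' ∧ ¬ Near g p p' ∧ r.1 ≠ p.1 ∧ r.1 ≠ p'.1
  have pt : ∀ (g : Fin m × Bool → Fin n) q r p p',
      ind (r.1 ≠ q.1 ∧ Conf g q r) * s ^ ((confs g).card - 4)
      ≤ ind (p ≠ r ∧ move g q p p' p = move g q p p' r) *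
          ind (p' ≠ bar r ∧ move g q p p' p' = move g q p p' (bar r)) *
          s ^ (confs (move g q p p')).card
        + ind (¬ ok g q r p p') * (ind (r.1 ≠ q.1 ∧ Conf g q r) * s ^ ((confs g).card - 4)) := by
    intro g q r p p'
    have n1 := mul_nonneg (mul_nonneg (ind_nonneg (p ≠ r ∧ move g q p p' p = move g q p p' r))
      (ind_nonneg (p' ≠ bar r ∧ move g q p p' p' = move g q p p' (bar r))))
      (pow_nonneg hs (confs (move g q p p')).card)
    by_cases h1 : r.1 ≠ q.1 ∧ Conf g q r
    · by_cases h : ok g q r p p'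
      · have hs := h.1.toSpread
        have e := card_confs_move g q p p'
        rw [h.1.touch_eq_empty h.2.1, card_empty] at e
        have := four_le_card_touch (p := p) (p' := p') h1.1 h1.2
        rw [ind_true h1, ind_true ⟨ne_of_fst_ne h.2.2.1.symm, by
          rw [hs.move_mid, move_other h1.1 h.2.2.1 h.2.2.2, h1.2.1]⟩,
          ind_true ⟨ne_of_fst_ne (by simpa using h.2.2.2.symm), by
          rw [hs.move_right, move_other (x := bar r) h1.1 h.2.2.1 h.2.2.2, h1.2.2]⟩,
          ind_false (not_not.2 h)]
        simp only [one_mul, zero_mul, add_zero]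
        exact pow_le_pow_of_le_one ‹_› hs1 (by omega)
      · rw [ind_true h]; linarith
    · rw [ind_false h1]; simpa using n1
  have e1 : (2 * m) * (2 * m) * multiGen n m k s = ∑ g ∈ words n m k, ∑ q : Fin m × Bool,
      ∑ r : Fin m × Bool, ∑ p : Fin m × Bool, ∑ p' : Fin m × Bool,
        ind (r.1 ≠ q.1 ∧ Conf g q r) * s ^ ((confs g).card - 4) := by
    simp only [sum_const_half, multiGen, mul_sum, mul_assoc]
  rw [e1]
  refine (sum_le_sum fun g _ => sum_le_sum fun q _ => sum_le_sum fun r _ => sum_le_sum fun p _ =>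
    sum_le_sum fun p' _ => pt g q r p p').trans ?_
  simp only [sum_add_distrib]
  refine add_le_add (le_of_eq ?_) ?_
  · rw [sum_comm]
    have : ∀ q : Fin m × Bool, ∑ g ∈ words n m k, ∑ r, ∑ p, ∑ p',
        ind (p ≠ r ∧ move g q p p' p = move g q p p' r) *
          ind (p' ≠ bar r ∧ move g q p p' p' = move g q p p' (bar r)) *
          s ^ (confs (move g q p p')).card
        = 2 * m * ((k - 1) ^ 2 * confGen n m k s) := by
      intro q
      rw [sum_comm, ← sum_const_half]
      refine sum_congr rfl fun r _ => ?_
      rw [sum_comm]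
      have e2 : ∀ p, ∑ g ∈ words n m k, ∑ p',
          ind (p ≠ r ∧ move g q p p' p = move g q p p' r) *
          ind (p' ≠ bar r ∧ move g q p p' p' = move g q p p' (bar r)) *
          s ^ (confs (move g q p p')).card
          = ∑ g ∈ words n m k, ∑ p', ind (p ≠ r ∧ g p = g r) *
            ind (p' ≠ bar r ∧ g p' = g (bar r)) * s ^ (confs g).card := by
        intro p
        rw [sum_comm, sum_congr rfl fun p' _ => sum_words_move q p p'
          fun g => ind (p ≠ r ∧ g p = g r) *
            ind (p' ≠ bar r ∧ g p' = g (bar r)) * s ^ (confs g).card, sum_comm]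
      rw [sum_congr rfl fun p _ => e2 p, sum_comm, confGen, mul_sum]
      refine sum_congr rfl fun g hg => ?_
      simp_rw [← sum_mul, ← mul_sum, sum_ind_ne_and hg, ← sum_mul, sum_ind_ne_and hg]
      ring
    rw [sum_congr rfl fun q _ => this q, sum_const_half]
    ring
  · rw [multiGen, mul_sum]
    refine sum_le_sum fun g hg => ?_
    rw [mul_sum]
    refine sum_le_sum fun q _ => ?_
    rw [mul_sum]
    refine sum_le_sum fun r _ => ?_
    simp_rw [← sum_mul]
    exact mul_le_mul_of_nonneg_right (sum_bad_pairs_le hg hk q r)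
      (mul_nonneg (ind_nonneg _) (pow_nonneg hs _))

end Words

section Words

open Finset

variable {n m k : ℕ} {g : Fin m × Bool → Fin n} {q p p' r x y : Fin m × Bool} {s : ℝ}

lemma sum_move (F : (Fin m × Bool → Fin n) → Fin m × Bool → ℝ) :
    ∑ g ∈ words n m k, ∑ p, ∑ p', ∑ q, F (move g q p p') q
      = (2 * m) * (2 * m) * ∑ g ∈ words n m k, ∑ q, F g q := by
  rw [sum_comm, mul_assoc, ← sum_const_half]
  refine sum_congr rfl fun p _ => ?_
  rw [sum_comm, ← sum_const_half]
  refine sum_congr rfl fun p' _ => ?_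
  rw [sum_comm, sum_congr rfl fun q _ => sum_words_move q p p' fun g => F g q, sum_comm]

lemma sum_sum_sum_comm {α β γ : Type*} [Fintype α] [Fintype β] [Fintype γ]
    (f : α → β → γ → ℝ) : ∑ a, ∑ b, ∑ c, f a b c = ∑ c, ∑ a, ∑ b, f a b c := by
  rw [sum_congr rfl fun a _ => sum_comm]
  exact sum_comm

lemma sum_loop_exception_le (hg : g ∈ words n m k) (hk : 0 < k) :
    ∑ p, ∑ p', ∑ q, ind (p' ≠ p ∧ g p' = g p) *
        ind (¬ (Safe g q p p' ∧ ∀ y, g y = g p → g (bar y) ≠ g p))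
      ≤ 2 * m * (13 * k ^ 3 + 2 * k ^ 2 * (confs g).card) := by
  have hk1 : (1 : ℝ) ≤ k := by exact_mod_cast hk
  have hm : (0 : ℝ) ≤ m := m.cast_nonneg
  have pt : ∀ p p' q, ind (p' ≠ p ∧ g p' = g p) *
        ind (¬ (Safe g q p p' ∧ ∀ y, g y = g p → g (bar y) ≠ g p))
      ≤ ind (g p' = g p) * (ind (p.1 ≠ p'.1) * ind (¬ Safe g q p p'))
        + ind (g p' = g p) * ∑ y, ind (g y = g p) * ind (g y = g (bar y)) := by
    intro p p' q
    have e : ∑ y, ind (g y = g p) * ind (g y = g (bar y))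
        = ∑ y, ind (g y = g p ∧ g y = g (bar y)) := sum_congr rfl fun y _ => (ind_and _ _).symm
    rw [← mul_add, ← ind_and (p.1 ≠ p'.1), e]
    by_cases h : p' ≠ p ∧ g p' = g p
    · rw [ind_true h, ind_true h.2, one_mul, one_mul]
      refine (ind_le_ind (r := (p.1 ≠ p'.1 ∧ ¬ Safe g q p p') ∨
        ∃ y, g y = g p ∧ g y = g (bar y)) fun c => ?_).trans ((ind_or_le _ _).trans
          (add_le_add le_rfl (ind_exists_le _)))
      by_contra c'
      push Not at c'
      refine c ⟨?_, fun y h1 h2 => c'.2 y h1 (h1.trans h2.symm)⟩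
      refine c'.1 fun e => ?_
      obtain rfl | rfl := eq_or_eq_bar e
      · exact h.1 rfl
      · exact c'.2 _ rfl (by rw [bar_bar, h.2])
    · rw [ind_false h, zero_mul]
      exact mul_nonneg (ind_nonneg _) (add_nonneg (ind_nonneg _)
        (sum_nonneg fun _ _ => ind_nonneg _))
  refine (sum_le_sum fun p _ => sum_le_sum fun p' _ => sum_le_sum fun q _ => pt p p' q).trans ?_
  simp only [sum_add_distrib]
  have h1 : ∑ p, ∑ p', ∑ q, ind (g p' = g p) * (ind (p.1 ≠ p'.1) * ind (¬ Safe g q p p'))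
      ≤ 2 * m * (k * (13 * k ^ 2 + (confs g).card)) := by
    rw [← sum_const_half]
    refine sum_le_sum fun p _ => ?_
    rw [← sum_word hg (g p), sum_mul]
    refine sum_le_sum fun p' _ => ?_
    rw [← mul_sum, ← mul_sum]
    refine mul_le_mul_of_nonneg_left ?_ (ind_nonneg _)
    by_cases h : p.1 ≠ p'.1
    · rw [ind_true h, one_mul, sum_word hg]
      exact sum_not_safe_le hg hk h
    · rw [ind_false h, zero_mul]; positivity
  have h2 : ∑ p, ∑ p', ∑ _q : Fin m × Bool,
      ind (g p' = g p) * ∑ y, ind (g y = g p) * ind (g y = g (bar y))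
      ≤ 2 * m * (k ^ 2 * (confs g).card) := by
    simp only [sum_const_half, ← mul_sum, ← sum_mul, sum_word hg]
    rw [sum_comm]
    simp only [← sum_mul, sum_word' hg, ← mul_sum]
    have := mul_le_mul_of_nonneg_left (sum_loops_le g) (by positivity : (0 : ℝ) ≤ 2 * m * (k * k))
    linarith
  have : 0 ≤ 2 * m * (((k : ℝ) - 1) * k * (confs g).card) := by
    have := sub_nonneg.2 hk1
    positivity
  linarith

lemma sum_multi_exception_le (hg : g ∈ words n m k) (hk : 0 < k) :
    ∑ p, ∑ p', ∑ q, ∑ r : Fin m × Bool,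
      ind (p ≠ r ∧ g p = g r) * ind (p' ≠ bar r ∧ g p' = g (bar r)) *
        ind (¬ (Safe g q p p' ∧ r.1 ≠ q.1 ∧ ∀ y, y ≠ r → ¬ Conf g r y))
      ≤ 2 * m * (15 * k ^ 4 + 2 * k ^ 2 * (confs g).card) := by
  have hk1 : (1 : ℝ) ≤ k := by exact_mod_cast hk
  have hm : (0 : ℝ) ≤ m := m.cast_nonneg
  have pt : ∀ p p' q r : Fin m × Bool,
      ind (p ≠ r ∧ g p = g r) * ind (p' ≠ bar r ∧ g p' = g (bar r)) *
        ind (¬ (Safe g q p p' ∧ r.1 ≠ q.1 ∧ ∀ y, y ≠ r → ¬ Conf g r y))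
      ≤ ind (g p = g r) * ind (g p' = g (bar r)) * (ind (p.1 ≠ p'.1) * ind (¬ Safe g q p p'))
        + ind (g p = g r) * ind (g p' = g (bar r)) * (ind (q.1 = r.1)
          + ∑ y, ind (r ≠ y ∧ Conf g r y)) := by
    intro p p' q r
    rw [← mul_add, ← ind_and (p ≠ r ∧ _), ← ind_and (g p = g r), ← ind_and (p.1 ≠ p'.1)]
    by_cases h : (p ≠ r ∧ g p = g r) ∧ p' ≠ bar r ∧ g p' = g (bar r)
    · rw [ind_true h, ind_true (p := g p = g r ∧ _) ⟨h.1.2, h.2.2⟩, one_mul, one_mul]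
      refine (ind_le_ind (r := (p.1 ≠ p'.1 ∧ ¬ Safe g q p p') ∨ q.1 = r.1 ∨
        ∃ y, r ≠ y ∧ Conf g r y) fun c => ?_).trans ((ind_or_le _ _).trans
          (add_le_add le_rfl ((ind_or_le _ _).trans (add_le_add le_rfl (ind_exists_le _)))))
      by_contra c'
      push Not at c'
      obtain ⟨c1, c2, c3⟩ := c'
      refine c ⟨c1 fun e => ?_, c2.symm, fun y hy => c3 y hy.symm⟩
      obtain rfl | rfl := eq_or_eq_bar e
      · exact c3 (bar r) (bar_ne r).symm (conf_bar_iff.2 (h.1.2.symm.trans h.2.2))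
      · exact c3 (bar p') h.1.1.symm ⟨h.1.2.symm, by rw [bar_bar, h.2.2]⟩
    · rw [ind_false h, zero_mul]
      exact mul_nonneg (ind_nonneg _) (add_nonneg (ind_nonneg _) (add_nonneg (ind_nonneg _)
        (sum_nonneg fun _ _ => ind_nonneg _)))
  refine (sum_le_sum fun p _ => sum_le_sum fun p' _ => sum_le_sum fun q _ =>
    sum_le_sum fun r _ => pt p p' q r).trans ?_
  have reorder : ∀ f : Fin m × Bool → Fin m × Bool → Fin m × Bool → Fin m × Bool → ℝ,
      ∑ p, ∑ p', ∑ q, ∑ r, f p p' q r = ∑ r, ∑ p, ∑ p', ∑ q, f p p' q r := by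
    intro f
    rw [sum_congr rfl fun p _ => sum_sum_sum_comm _]
    exact sum_comm
  rw [reorder]
  simp only [sum_add_distrib]
  have h1 : ∑ r, ∑ p, ∑ p', ∑ q, ind (g p = g r) * ind (g p' = g (bar r)) *
      (ind (p.1 ≠ p'.1) * ind (¬ Safe g q p p'))
      ≤ 2 * m * (k * (k * (13 * k ^ 2 + (confs g).card))) := by
    rw [← sum_const_half]
    refine sum_le_sum fun r _ => ?_
    calc _ ≤ ∑ p, ∑ p', ind (g p = g r) * ind (g p' = g (bar r)) *
          (13 * k ^ 2 + (confs g).card : ℝ) := by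
          refine sum_le_sum fun p _ => sum_le_sum fun p' _ => ?_
          rw [← mul_sum, ← mul_sum]
          refine mul_le_mul_of_nonneg_left ?_ (mul_nonneg (ind_nonneg _) (ind_nonneg _))
          by_cases h : p.1 ≠ p'.1
          · rw [ind_true h, one_mul]
            exact sum_not_safe_le hg hk h
          · rw [ind_false h, zero_mul]; positivity
      _ = _ := by
        simp only [← sum_mul, ← mul_sum, sum_word hg]
        ring
  have h2 : ∑ r, ∑ p, ∑ p', ∑ q : Fin m × Bool, ind (g p = g r) * ind (g p' = g (bar r)) *
      (ind (q.1 = r.1) + ∑ y, ind (r ≠ y ∧ Conf g r y))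
      = 2 * m * (2 * k ^ 2 + k ^ 2 * (confs g).card) := by
    simp only [← mul_sum, ← sum_mul, sum_add_distrib, sum_fst, sum_const_half, sum_word hg,
      card_confs, mul_add]
    ring
  simp only [mul_add, sum_add_distrib] at h1 h2 ⊢
  have h3 : (k : ℝ) ^ 2 ≤ k ^ 4 := pow_le_pow_right₀ hk1 (by norm_num)
  have := mul_le_mul_of_nonneg_left h3 hm
  linarith

lemma le_loopGen_aux (hk : 0 < k) (hs : 0 ≤ s) (hs1 : s ≤ 1) :
    (2 * m) * (2 * m) * ((k - 1) * confGen n m k s)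
      ≤ (2 * m) * (2 * m) * loopGen n m k s + 2 * m * (13 * k ^ 3 * confGen n m k s
        + 2 * k ^ 2 * ∑ g ∈ words n m k, (confs g).card * s ^ (confs g).card) := by
  have pt : ∀ (g : Fin m × Bool → Fin n) (p p' q : Fin m × Bool),
      ind (p' ≠ p ∧ g p' = g p) * s ^ (confs g).card
      ≤ ind (move g q p p' q = move g q p p' (bar q)) * s ^ ((confs (move g q p p')).card - 2)
        + ind (p' ≠ p ∧ g p' = g p) *
          ind (¬ (Safe g q p p' ∧ ∀ y, g y = g p → g (bar y) ≠ g p)) * s ^ (confs g).card := by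
    intro g p p' q
    have n1 := mul_nonneg (ind_nonneg (move g q p p' q = move g q p p' (bar q)))
      (pow_nonneg hs ((confs (move g q p p')).card - 2))
    by_cases h1 : p' ≠ p ∧ g p' = g p
    · by_cases h : Safe g q p p' ∧ ∀ y, g y = g p → g (bar y) ≠ g p
      · have hs' := h.1.toSpread
        have e := card_confs_move g q p p'
        have := h.1.card_touch_le_two h1.2.symm h.2
        rw [ind_true h1, ind_true (p := move g q p p' q = move g q p p' (bar q)) (by
          rw [hs'.move_left, hs'.move_bar_left, h1.2]), ind_false (not_not.2 h)]
        simp only [one_mul, zero_mul, add_zero]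
        exact pow_le_pow_of_le_one hs hs1 (by omega)
      · rw [ind_true h]; linarith
    · rw [ind_false h1]; simpa using n1
  have e1 : (2 * m) * (2 * m) * ((k - 1) * confGen n m k s) = ∑ g ∈ words n m k,
      ∑ p : Fin m × Bool, ∑ p' : Fin m × Bool, ∑ _q : Fin m × Bool,
        ind (p' ≠ p ∧ g p' = g p) * s ^ (confs g).card := by
    rw [confGen, mul_sum, mul_sum]
    refine sum_congr rfl fun g hg => ?_
    simp only [sum_const_half, ← mul_sum, ← sum_mul, sum_ind_ne_and hg]
    ring
  rw [e1]
  refine (sum_le_sum fun g _ => sum_le_sum fun p _ => sum_le_sum fun p' _ => sum_le_sum fun q _ =>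
    pt g p p' q).trans ?_
  simp only [sum_add_distrib]
  refine add_le_add (le_of_eq ?_) ?_
  · exact sum_move fun g q => ind (g q = g (bar q)) * s ^ ((confs g).card - 2)
  · simp only [← sum_mul]
    calc _ ≤ ∑ g ∈ words n m k, 2 * m * (13 * k ^ 3 + 2 * k ^ 2 * (confs g).card)
            * s ^ (confs g).card :=
          sum_le_sum fun g hg => mul_le_mul_of_nonneg_right (sum_loop_exception_le hg hk)
            (pow_nonneg hs _)
      _ = _ := by
        rw [confGen, mul_sum, mul_sum, ← sum_add_distrib, mul_sum]
        exact sum_congr rfl fun g _ => by ring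

lemma le_multiGen_aux (hk : 0 < k) (hs : 0 ≤ s) (hs1 : s ≤ 1) :
    (2 * m) * (2 * m) * ((k - 1) ^ 2 * confGen n m k s)
      ≤ (2 * m) * (2 * m) * multiGen n m k s + 2 * m * (15 * k ^ 4 * confGen n m k s
        + 2 * k ^ 2 * ∑ g ∈ words n m k, (confs g).card * s ^ (confs g).card) := by
  have pt : ∀ (g : Fin m × Bool → Fin n) (p p' q r : Fin m × Bool),
      ind (p ≠ r ∧ g p = g r) * ind (p' ≠ bar r ∧ g p' = g (bar r)) * s ^ (confs g).card
      ≤ ind (r.1 ≠ q.1 ∧ Conf (move g q p p') q r) * s ^ ((confs (move g q p p')).card - 4)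
        + ind (p ≠ r ∧ g p = g r) * ind (p' ≠ bar r ∧ g p' = g (bar r)) *
          ind (¬ (Safe g q p p' ∧ r.1 ≠ q.1 ∧ ∀ y, y ≠ r → ¬ Conf g r y))
            * s ^ (confs g).card := by
    intro g p p' q r
    have n1 := mul_nonneg (ind_nonneg (r.1 ≠ q.1 ∧ Conf (move g q p p') q r))
      (pow_nonneg hs ((confs (move g q p p')).card - 4))
    simp_rw [← ind_and (p ≠ r ∧ g p = g r)]
    by_cases h1 : (p ≠ r ∧ g p = g r) ∧ p' ≠ bar r ∧ g p' = g (bar r)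
    · by_cases h : Safe g q p p' ∧ r.1 ≠ q.1 ∧ ∀ y, y ≠ r → ¬ Conf g r y
      · have hs' := h.1.toSpread
        have e := card_confs_move g q p p'
        have := h.1.card_touch_le_four h1.1.2 h1.2.2 h.2.2
        have c1 : r.1 ≠ p.1 := by
          intro c
          obtain rfl | rfl := eq_or_eq_bar c
          · exact h1.1.1 rfl
          · exact h.2.2 p (bar_ne p).symm (by
              simpa using (conf_bar_iff.2 h1.1.2).symm)
        have c2 : r.1 ≠ p'.1 := by
          intro c
          obtain rfl | rfl := eq_or_eq_bar c
          · exact h.2.2 _ (bar_ne r) (conf_bar_iff.2 h1.2.2)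
          · exact h1.2.1 (bar_bar p').symm
        rw [ind_true h1, ind_true (p := r.1 ≠ q.1 ∧ Conf (move g q p p') q r) ⟨h.2.1, by
          rw [Conf, hs'.move_left, hs'.move_bar_left, move_other h.2.1 c1 c2,
            move_other (x := bar r) h.2.1 c1 c2]
          exact ⟨h1.1.2, h1.2.2⟩⟩, ind_false (not_not.2 h)]
        simp only [one_mul, zero_mul, mul_zero, add_zero]
        exact pow_le_pow_of_le_one hs hs1 (by omega)
      · rw [ind_true h]; linarith
    · rw [ind_false h1]; simpa using n1
  have e1 : (2 * m) * (2 * m) * ((k - 1) ^ 2 * confGen n m k s) = ∑ g ∈ words n m k,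
      ∑ p : Fin m × Bool, ∑ p' : Fin m × Bool, ∑ _q : Fin m × Bool, ∑ r : Fin m × Bool,
        ind (p ≠ r ∧ g p = g r) * ind (p' ≠ bar r ∧ g p' = g (bar r))
          * s ^ (confs g).card := by
    rw [confGen, mul_sum, mul_sum]
    refine sum_congr rfl fun g hg => ?_
    rw [sum_congr rfl fun p _ => sum_sum_sum_comm _, sum_comm]
    simp only [sum_const_half, ← mul_sum, ← sum_mul, sum_ind_ne_and hg]
    ring
  rw [e1]
  refine (sum_le_sum fun g _ => sum_le_sum fun p _ => sum_le_sum fun p' _ => sum_le_sum fun q _ =>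
    sum_le_sum fun r _ => pt g p p' q r).trans ?_
  simp only [sum_add_distrib]
  refine add_le_add (le_of_eq ?_) ?_
  · exact sum_move fun g q => ∑ r : Fin m × Bool,
      ind (r.1 ≠ q.1 ∧ Conf g q r) * s ^ ((confs g).card - 4)
  · simp only [← sum_mul]
    calc _ ≤ ∑ g ∈ words n m k, 2 * m * (15 * k ^ 4 + 2 * k ^ 2 * (confs g).card)
            * s ^ (confs g).card :=
          sum_le_sum fun g hg => mul_le_mul_of_nonneg_right (sum_multi_exception_le hg hk)
            (pow_nonneg hs _)
      _ = _ := by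
        rw [confGen, mul_sum, mul_sum, ← sum_add_distrib, mul_sum]
        exact sum_congr rfl fun g _ => by ring

end Words

section Words

open Finset

variable {n m k : ℕ} {g : Fin m × Bool → Fin n} {q r : Fin m × Bool} {s : ℝ}

lemma card_confs_eq_add (g : Fin m × Bool → Fin n) : ((confs g).card : ℝ)
    = ∑ q, ind (g q = g (bar q)) + ∑ q : Fin m × Bool, ∑ r, ind (r.1 ≠ q.1 ∧ Conf g q r) := by
  rw [card_confs, ← sum_add_distrib]
  refine sum_congr rfl fun q _ => ?_
  rw [← sum_ind_eq_mul (bar q) fun _ => ind (g q = g (bar q)), ← sum_add_distrib]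
  refine sum_congr rfl fun r _ => ?_
  by_cases h : r.1 = q.1
  · obtain rfl | rfl := eq_or_eq_bar h
    · simp [ind, (bar_ne r).symm]
    · simp [ind, (bar_ne q).symm, conf_bar_iff]
  · have h1 : q ≠ r := ne_of_fst_ne (Ne.symm h)
    have h2 : r ≠ bar q := ne_of_fst_ne h
    simp [ind, h, h1, h2]

lemma touch_subset (g : Fin m × Bool → Fin n) (q p p' : Fin m × Bool) : touch g q p p' ⊆ confs g :=
  filter_subset _ _

lemma card_mul_pow_eq (g : Fin m × Bool → Fin n) (s : ℝ) :
    ((confs g).card : ℝ) * s ^ ((confs g).card - 1)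
      = s * ∑ q, ind (g q = g (bar q)) * s ^ ((confs g).card - 2)
        + s ^ 3 * ∑ q : Fin m × Bool, ∑ r,
          ind (r.1 ≠ q.1 ∧ Conf g q r) * s ^ ((confs g).card - 4) := by
  conv_lhs => rw [card_confs_eq_add]
  simp only [add_mul, sum_mul, mul_sum]
  congr 1
  · refine sum_congr rfl fun q _ => ?_
    by_cases h : g q = g (bar q)
    · have := (two_le_card_touch (p := q) (p' := q) h).trans (card_le_card (touch_subset _ _ _ _))
      rw [ind_true h, one_mul, one_mul, ← pow_succ']
      congr 1
      omega
    · simp [ind_false h]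
  · refine sum_congr rfl fun q _ => sum_congr rfl fun r _ => ?_
    by_cases h : r.1 ≠ q.1 ∧ Conf g q r
    · have := (four_le_card_touch (p := q) (p' := q) h.1 h.2).trans
        (card_le_card (touch_subset _ _ _ _))
      rw [ind_true h, one_mul, one_mul, ← pow_add]
      congr 1
      omega
    · simp [ind_false h]

lemma sum_card_mul_pow_eq (n m k : ℕ) (s : ℝ) :
    ∑ g ∈ words n m k, ((confs g).card : ℝ) * s ^ ((confs g).card - 1)
      = s * loopGen n m k s + s ^ 3 * multiGen n m k s := by
  rw [loopGen, multiGen, mul_sum, mul_sum, ← sum_add_distrib]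
  exact sum_congr rfl fun g _ => card_mul_pow_eq g s

lemma hasDerivAt_confGen (n m k : ℕ) (s : ℝ) :
    HasDerivAt (confGen n m k) (s * loopGen n m k s + s ^ 3 * multiGen n m k s) s := by
  rw [← sum_card_mul_pow_eq]
  exact HasDerivAt.fun_sum fun g _ => hasDerivAt_pow _ s

lemma abs_gen_sub_le (hk : 0 < k) (hm : 44 * k ^ 2 ≤ 2 * m) (hs : 0 ≤ s) (hs1 : s ≤ 1) :
    |loopGen n m k s - (k - 1) * confGen n m k s| ≤ 22 * k ^ 4 / m * confGen n m k s ∧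
    |multiGen n m k s - (k - 1) ^ 2 * confGen n m k s| ≤ 22 * k ^ 4 / m * confGen n m k s := by
  have hk1 : (1 : ℝ) ≤ k := by exact_mod_cast hk
  have hmk : (44 : ℝ) * k ^ 2 ≤ 2 * m := by exact_mod_cast hm
  have hm0 : (0 : ℝ) < 2 * m := lt_of_lt_of_le (by positivity) hmk
  have u1 := loopGen_le_aux (n := n) (m := m) hk hs hs1
  have u2 := multiGen_le_aux (n := n) (m := m) hk hs hs1
  have l1 := le_loopGen_aux (n := n) (m := m) hk hs hs1
  have l2 := le_multiGen_aux (n := n) (m := m) hk hs hs1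
  have hW : ∑ g ∈ words n m k, ((confs g).card : ℝ) * s ^ (confs g).card
      = s ^ 2 * loopGen n m k s + s ^ 4 * multiGen n m k s := by
    calc _ = s * ∑ g ∈ words n m k, ((confs g).card : ℝ) * s ^ ((confs g).card - 1) := by
          rw [mul_sum]
          refine sum_congr rfl fun g _ => ?_
          rcases Nat.eq_zero_or_pos (confs g).card with h | h
          · simp [h]
          · rw [mul_left_comm, ← pow_succ', Nat.sub_add_cancel h]
      _ = _ := by rw [sum_card_mul_pow_eq]; ring
  rw [hW] at l1 l2
  have hZ := confGen_nonneg (n := n) (m := m) (k := k) hs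
  have hA := loopGen_nonneg (n := n) (m := m) (k := k) hs
  have hB := multiGen_nonneg (n := n) (m := m) (k := k) hs
  generalize confGen n m k s = Z at *
  generalize loopGen n m k s = A at *
  generalize multiGen n m k s = B at *
  replace u1 : 2 * m * A ≤ 2 * m * ((k - 1) * Z) + 22 * k ^ 2 * A :=
    le_of_mul_le_mul_left (by linarith) hm0
  replace u2 : 2 * m * B ≤ 2 * m * ((k - 1) ^ 2 * Z) + 22 * k ^ 2 * B :=
    le_of_mul_le_mul_left (by linarith) hm0
  replace l1 : 2 * m * ((k - 1) * Z)
      ≤ 2 * m * A + (13 * k ^ 3 * Z + 2 * k ^ 2 * (s ^ 2 * A + s ^ 4 * B)) :=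
    le_of_mul_le_mul_left (by linarith) hm0
  replace l2 : 2 * m * ((k - 1) ^ 2 * Z)
      ≤ 2 * m * B + (15 * k ^ 4 * Z + 2 * k ^ 2 * (s ^ 2 * A + s ^ 4 * B)) :=
    le_of_mul_le_mul_left (by linarith) hm0
  have k0 : (0 : ℝ) ≤ k - 1 := by linarith
  have a1 : A ≤ 2 * ((k - 1) * Z) := by
    have := mul_le_mul_of_nonneg_right hmk hA
    refine le_of_mul_le_mul_left ?_ hm0
    linarith
  have b1 : B ≤ 2 * ((k - 1) ^ 2 * Z) := by
    have := mul_le_mul_of_nonneg_right hmk hB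
    refine le_of_mul_le_mul_left ?_ hm0
    linarith
  have w1 : s ^ 2 * A + s ^ 4 * B ≤ 2 * k ^ 2 * Z := by
    have i1 : s ^ 2 * A ≤ A := mul_le_of_le_one_left hA (pow_le_one₀ hs hs1)
    have i2 : s ^ 4 * B ≤ B := mul_le_of_le_one_left hB (pow_le_one₀ hs hs1)
    have : 0 ≤ 2 * (k * Z) := by positivity
    nlinarith
  have p1 : (k : ℝ) ^ 2 ≤ k ^ 4 := pow_le_pow_right₀ hk1 (by norm_num)
  have p2 : (k : ℝ) ^ 3 ≤ k ^ 4 := pow_le_pow_right₀ hk1 (by norm_num)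
  have q1 := mul_le_mul_of_nonneg_right p1 hZ
  have q2 := mul_le_mul_of_nonneg_right p2 hZ
  have hm1 : (0 : ℝ) < m := by linarith
  have r1 : 22 * k ^ 2 * A ≤ 44 * k ^ 4 * Z := by
    have := mul_le_mul_of_nonneg_left a1 (by positivity : (0 : ℝ) ≤ 22 * k ^ 2)
    have h0 : 0 ≤ 44 * (k : ℝ) ^ 2 * Z := by positivity
    nlinarith
  have r2 : 22 * k ^ 2 * B ≤ 44 * k ^ 4 * Z := by
    have h1 : ((k : ℝ) - 1) ^ 2 ≤ k ^ 2 := by nlinarith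
    have h2 := mul_le_mul_of_nonneg_right h1 hZ
    have := mul_le_mul_of_nonneg_left (b1.trans (mul_le_mul_of_nonneg_left h2 zero_le_two))
      (by positivity : (0 : ℝ) ≤ 22 * k ^ 2)
    linarith
  have r3 : 2 * k ^ 2 * (s ^ 2 * A + s ^ 4 * B) ≤ 4 * k ^ 4 * Z := by
    have := mul_le_mul_of_nonneg_left w1 (by positivity : (0 : ℝ) ≤ 2 * k ^ 2)
    linarith
  have key : ∀ x : ℝ, |2 * m * x| ≤ 44 * k ^ 4 * Z → |x| ≤ 22 * k ^ 4 / m * Z := by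
    intro x hx
    rw [abs_mul, abs_of_pos hm0] at hx
    rw [div_mul_eq_mul_div, le_div_iff₀ hm1]
    linarith
  have z4 : 0 ≤ (k : ℝ) ^ 4 * Z := by positivity
  constructor <;> refine key _ (abs_le.2 ⟨?_, ?_⟩) <;> linarith

lemma confGen_one (n m k : ℕ) : confGen n m k 1 = (words n m k).card := by
  simp [confGen]

lemma confGen_zero (n m k : ℕ) :
    confGen n m k 0 = ((words n m k).filter fun g => confs g = ∅).card := by
  trans ∑ g ∈ words n m k, ind (confs g = ∅)
  swap
  · rw [sum_ind]
    congr!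
  refine sum_congr rfl fun g _ => ?_
  by_cases h : confs g = ∅
  · simp [h, ind]
  · simp [h, ind, card_ne_zero.2 (nonempty_iff_ne_empty.2 h)]

/-- The proportion of words without conflicts. -/
lemma card_simple_words_bounds (n : ℕ) (hk : 0 < k) (hm : 44 * k ^ 2 ≤ 2 * m) :
    (((words n m k).filter fun g => confs g = ∅).card : ℝ)
        ≤ Real.exp (-(((k : ℝ) ^ 2 - 1) / 4) + 44 * k ^ 4 / m) * (words n m k).card ∧
    Real.exp (-(((k : ℝ) ^ 2 - 1) / 4) - 44 * k ^ 4 / m) * (words n m k).card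
        ≤ ((words n m k).filter fun g => confs g = ∅).card := by
  rw [← confGen_zero, ← confGen_one]
  set η : ℝ := 44 * k ^ 4 / m with hη
  set φ : ℝ → ℝ := fun s => (k - 1) * s ^ 2 / 2 + (k - 1) ^ 2 * s ^ 4 / 4 with hφ
  have dφ : ∀ s, HasDerivAt φ ((k - 1) * s + (k - 1) ^ 2 * s ^ 3) s := by
    intro s
    have h1 := ((hasDerivAt_pow 2 s).const_mul ((k : ℝ) - 1)).div_const 2
    have h2 := ((hasDerivAt_pow 4 s).const_mul (((k : ℝ) - 1) ^ 2)).div_const 4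
    exact (h1.add h2).congr_deriv (by push_cast; ring)
  have dF : ∀ c s : ℝ, HasDerivAt (fun s => Real.exp (-φ s + c * s) * confGen n m k s)
      (Real.exp (-φ s + c * s) * ((s * loopGen n m k s + s ^ 3 * multiGen n m k s)
        - ((k - 1) * s + (k - 1) ^ 2 * s ^ 3) * confGen n m k s + c * confGen n m k s)) s := by
    intro c s
    have h := (((dφ s).neg.add ((hasDerivAt_id s).const_mul c)).exp).mul
      (hasDerivAt_confGen n m k s)
    refine h.congr_deriv ?_
    simp only [Pi.add_apply, Pi.neg_apply, id]
    ring
  have bound : ∀ s ∈ Set.Ioo (0 : ℝ) 1, |(s * loopGen n m k s + s ^ 3 * multiGen n m k s)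
      - ((k - 1) * s + (k - 1) ^ 2 * s ^ 3) * confGen n m k s| ≤ η * confGen n m k s := by
    intro s hs
    obtain ⟨h1, h2⟩ := abs_gen_sub_le (n := n) hk hm hs.1.le hs.2.le
    have e : (s * loopGen n m k s + s ^ 3 * multiGen n m k s)
      - ((k - 1) * s + (k - 1) ^ 2 * s ^ 3) * confGen n m k s
      = s * (loopGen n m k s - (k - 1) * confGen n m k s)
        + s ^ 3 * (multiGen n m k s - (k - 1) ^ 2 * confGen n m k s) := by ring
    rw [e]
    refine (abs_add_le _ _).trans ?_
    rw [abs_mul, abs_mul, abs_of_pos hs.1, abs_of_pos (pow_pos hs.1 3)]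
    have i1 := mul_le_of_le_one_left (abs_nonneg (loopGen n m k s - (k - 1) * confGen n m k s))
      hs.2.le
    have i2 := mul_le_of_le_one_left
      (abs_nonneg (multiGen n m k s - (k - 1) ^ 2 * confGen n m k s))
      (pow_le_one₀ (n := 3) hs.1.le hs.2.le)
    calc _ ≤ 22 * k ^ 4 / m * confGen n m k s + 22 * k ^ 4 / m * confGen n m k s := by linarith
      _ = _ := by rw [hη]; ring
  have φ0 : φ 0 = 0 := by simp [hφ]
  have φ1 : φ 1 = ((k : ℝ) ^ 2 - 1) / 4 := by simp only [hφ]; ring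
  constructor
  · have mono : MonotoneOn (fun s => Real.exp (-φ s + η * s) * confGen n m k s)
        (Set.Icc 0 1) := by
      refine monotoneOn_of_deriv_nonneg (convex_Icc 0 1)
        (fun s _ => (dF η s).continuousAt.continuousWithinAt)
        (fun s _ => (dF η s).differentiableAt.differentiableWithinAt) fun s hs => ?_
      rw [interior_Icc] at hs
      rw [(dF η s).deriv]
      exact mul_nonneg (Real.exp_pos _).le (by linarith [(abs_le.1 (bound s hs)).1])
    have := mono (Set.left_mem_Icc.2 zero_le_one) (Set.right_mem_Icc.2 zero_le_one) zero_le_one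
    simpa [φ0, φ1] using this
  · have anti : AntitoneOn (fun s => Real.exp (-φ s + -η * s) * confGen n m k s)
        (Set.Icc 0 1) := by
      refine antitoneOn_of_deriv_nonpos (convex_Icc 0 1)
        (fun s _ => (dF (-η) s).continuousAt.continuousWithinAt)
        (fun s _ => (dF (-η) s).differentiableAt.differentiableWithinAt) fun s hs => ?_
      rw [interior_Icc] at hs
      rw [(dF (-η) s).deriv]
      exact mul_nonpos_of_nonneg_of_nonpos (Real.exp_pos _).le
        (by linarith [(abs_le.1 (bound s hs)).2])
    have := anti (Set.left_mem_Icc.2 zero_le_one) (Set.right_mem_Icc.2 zero_le_one) zero_le_one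
    simpa [φ0, φ1, sub_eq_add_neg] using this

end Words

section Words

open Finset

variable {n m k : ℕ} {g : Fin m × Bool → Fin n}

lemma exists_mem_words (hm : n * k = 2 * m) : ∃ g, g ∈ words n m k := by
  have e : Fin m × Bool ≃ Fin n × Fin k := Fintype.equivOfCardEq (by simp; omega)
  refine ⟨fun p => (e p).1, ?_⟩
  simp only [words, mem_filter, mem_univ, true_and]
  intro v
  rw [card_equiv e (t := univ.filter fun x => x.1 = v) (by simp)]
  have : (univ.filter fun x : Fin n × Fin k => x.1 = v) = {v} ×ˢ univ := by
    ext ⟨a, b⟩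
    simp [eq_comm]
  rw [this, card_product]
  simp

lemma exists_comp_eq {g₀ : Fin m × Bool → Fin n} (h₀ : g₀ ∈ words n m k) (hg : g ∈ words n m k) :
    ∃ σ : Equiv.Perm (Fin m × Bool), g₀ ∘ σ = g := by
  have e : ∀ v, {p // g p = v} ≃ {p // g₀ p = v} := fun v => Fintype.equivOfCardEq (by
    rw [Fintype.card_subtype, Fintype.card_subtype]
    have h1 := (mem_filter.1 h₀).2 v
    have h2 := (mem_filter.1 hg).2 v
    exact (by convert h2 : _ = k).trans (by convert h1.symm))
  refine ⟨(Equiv.sigmaFiberEquiv g).symm.trans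
    ((Equiv.sigmaCongrRight e).trans (Equiv.sigmaFiberEquiv g₀)), ?_⟩
  funext p
  exact (e (g p) ⟨p, rfl⟩).2

lemma card_words (hm : n * k = 2 * m) :
    (words n m k).card * k.factorial ^ n = (2 * m).factorial := by
  obtain ⟨g₀, h₀⟩ := exists_mem_words hm
  have hs : Fintype.card {σ : Equiv.Perm (Fin m × Bool) // g₀ ∘ σ = g₀} = k.factorial ^ n := by
    rw [DomMulAct.stabilizer_card g₀]
    have : ∀ v, Fintype.card {p // g₀ p = v} = k := fun v => by
      rw [Fintype.card_subtype, ← (mem_filter.1 h₀).2 v]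
    simp [this]
  have hc : (univ : Finset (Equiv.Perm (Fin m × Bool))).card = (2 * m).factorial := by
    rw [card_univ, Fintype.card_perm]
    simp [mul_comm]
  rw [← hc, card_eq_sum_card_fiberwise (f := fun σ : Equiv.Perm (Fin m × Bool) => g₀ ∘ σ)
    (t := words n m k) fun σ _ => (comp_mem_words σ).2 h₀, ← smul_eq_mul, ← sum_const]
  refine sum_congr rfl fun g hg => ?_
  obtain ⟨σ₀, hσ⟩ := exists_comp_eq h₀ hg
  rw [← hs, Fintype.card_subtype]
  refine card_equiv (Equiv.mulRight σ₀) fun σ => ?_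
  simp only [mem_filter, mem_univ, true_and, Equiv.coe_mulRight]
  rw [← hσ]
  constructor
  · intro h
    rw [Equiv.Perm.coe_mul, ← Function.comp_assoc, h]
  · intro h
    rw [Equiv.Perm.coe_mul, ← Function.comp_assoc] at h
    exact σ₀.surjective.injective_comp_right h

lemma confs_eq_empty : confs g = ∅ ↔ ∀ x y, Conf g x y → x = y := by
  simp only [confs, filter_eq_empty_iff, mem_univ, true_implies]
  constructor
  · intro h x y c
    by_contra e
    exact h (x := (x, y)) ⟨e, c⟩
  · rintro h ⟨x, y⟩ ⟨e, c⟩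
    exact e (h x y c)

lemma ne_of_confs (h : confs g = ∅) (x : Fin m × Bool) : g x ≠ g (bar x) := fun c =>
  bar_ne x (confs_eq_empty.1 h _ _ (conf_bar_iff.2 c)).symm

/-- The simple graph underlying a word. -/
def wordGraph (g : Fin m × Bool → Fin n) : SimpleGraph (Fin n) where
  Adj u v := u ≠ v ∧ ∃ p, g p = u ∧ g (bar p) = v
  symm := ⟨fun u v h => by
    obtain ⟨h, p, h1, h2⟩ := h
    exact ⟨h.symm, bar p, h2, by rw [bar_bar, h1]⟩⟩
  loopless := ⟨fun u h => h.1 rfl⟩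

lemma wordGraph_adj (h : confs g = ∅) {u v : Fin n} :
    (wordGraph g).Adj u v ↔ ∃ p, g p = u ∧ g (bar p) = v := by
  refine ⟨fun c => c.2, fun ⟨p, h1, h2⟩ => ⟨?_, p, h1, h2⟩⟩
  rw [← h1, ← h2]
  exact ne_of_confs h p

lemma deg_wordGraph (h : confs g = ∅) (v : Fin n) :
    deg (wordGraph g) v = (univ.filter fun p => g p = v).card := by
  symm
  refine card_bij (fun p _ => g (bar p)) (fun p hp => ?_) (fun p hp p' hp' e => ?_) fun w hw => ?_
  · rw [mem_filter, wordGraph_adj h]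
    exact ⟨mem_univ _, p, (mem_filter.1 hp).2, rfl⟩
  · exact confs_eq_empty.1 h _ _ ⟨(mem_filter.1 hp).2.trans (mem_filter.1 hp').2.symm, e⟩
  · rw [mem_filter, wordGraph_adj h] at hw
    obtain ⟨-, p, h1, h2⟩ := hw
    exact ⟨p, mem_filter.2 ⟨mem_univ _, h1⟩, h2⟩

lemma wordGraph_of_equiv {H : SimpleGraph (Fin n)} (e : Fin m ≃ H.edgeSet)
    (he : ∀ x, s(g x, g (bar x)) = (e x.1 : Sym2 (Fin n))) :
    confs g = ∅ ∧ wordGraph g = H := by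
  have hne : ∀ x, g x ≠ g (bar x) := fun x => by
    have := (e x.1).2
    rw [← he, SimpleGraph.mem_edgeSet] at this
    exact this.ne
  have hc : confs g = ∅ := by
    refine confs_eq_empty.2 fun x y h => ?_
    have : x.1 = y.1 := e.injective (Subtype.ext (by rw [← he, ← he, h.1, h.2]))
    obtain rfl | rfl := eq_or_eq_bar this
    · rfl
    · exact absurd h.1.symm (hne y)
  refine ⟨hc, ?_⟩
  ext u v
  rw [wordGraph_adj hc]
  constructor
  · rintro ⟨p, rfl, rfl⟩
    rw [← SimpleGraph.mem_edgeSet, he]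
    exact (e p.1).2
  · intro h
    obtain ⟨i, hi⟩ := e.surjective ⟨s(u, v), h⟩
    have := he (i, true)
    rw [hi, Sym2.eq_iff] at this
    obtain h | h := this
    · exact ⟨_, h⟩
    · exact ⟨bar (i, true), h.2, by rw [bar_bar, h.1]⟩

lemma card_wordGraph_eq {H : SimpleGraph (Fin n)} (hH : Fintype.card H.edgeSet = m) :
    (univ.filter fun g : Fin m × Bool → Fin n => confs g = ∅ ∧ wordGraph g = H).card
      = m.factorial * 2 ^ m := by
  have hc : (univ : Finset ((Fin m ≃ H.edgeSet) × (Fin m → Bool))).card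
      = m.factorial * 2 ^ m := by
    rw [card_univ, Fintype.card_prod, Fintype.card_equiv (Fintype.equivFinOfCardEq hH).symm]
    simp
  rw [← hc]
  symm
  let Φ : (Fin m ≃ H.edgeSet) × (Fin m → Bool) → Fin m × Bool → Fin n := fun x p =>
    if p.2 = x.2 p.1 then (Quot.out (x.1 p.1 : Sym2 (Fin n))).1
      else (Quot.out (x.1 p.1 : Sym2 (Fin n))).2
  have hout : ∀ z : Sym2 (Fin n), s((Quot.out z).1, (Quot.out z).2) = z := fun z => Quot.out_eq z
  have hΦ : ∀ x p, s(Φ x p, Φ x (bar p)) = (x.1 p.1 : Sym2 (Fin n)) := by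
    intro x p
    by_cases h : p.2 = x.2 p.1
    · have h' : ¬ (bar p).2 = x.2 (bar p).1 := by simp [bar, h]
      simp only [Φ, if_pos h, if_neg h', bar_fst, hout]
    · have h' : (bar p).2 = x.2 (bar p).1 := by
        revert h
        simp only [bar]
        cases p.2 <;> cases x.2 p.1 <;> simp
      simp only [Φ, if_neg h, if_pos h', bar_fst]
      rw [Sym2.eq_swap, hout]
  refine card_bij (fun x _ => Φ x) (fun x _ => ?_) (fun x _ y _ hxy => ?_) fun g hg => ?_
  · exact mem_filter.2 ⟨mem_univ _, wordGraph_of_equiv x.1 (hΦ x)⟩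
  · have h1 : x.1 = y.1 := by
      ext1 i
      exact Subtype.ext (by rw [← hΦ x (i, true), ← hΦ y (i, true), hxy])
    refine Prod.ext h1 (funext fun i => ?_)
    by_contra c
    have h2 := congrFun hxy (i, x.2 i)
    have h3 : (Quot.out (x.1 i : Sym2 (Fin n))).1 ≠ (Quot.out (x.1 i : Sym2 (Fin n))).2 := by
      have := (x.1 i).2
      rw [← hout (x.1 i), SimpleGraph.mem_edgeSet] at this
      exact this.ne
    simp only [Φ, if_true, ← h1, if_neg c] at h2
    exact h3 h2
  · obtain ⟨-, hg', rfl⟩ := mem_filter.1 hg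
    have hadj : ∀ i, (wordGraph g).Adj (g (i, true)) (g (bar (i, true))) := fun i =>
      (wordGraph_adj hg').2 ⟨_, rfl, rfl⟩
    let f : Fin m → (wordGraph g).edgeSet := fun i => ⟨s(g (i, true), g (bar (i, true))), hadj i⟩
    have hf : Function.Bijective f := by
      constructor
      · intro i j hij
        have := Subtype.ext_iff.1 hij
        rw [Sym2.eq_iff] at this
        obtain h | h := this
        · exact congrArg Prod.fst (confs_eq_empty.1 hg' _ _ h)
        · exact congrArg Prod.fst (confs_eq_empty.1 hg' (i, true) (bar (j, true))
            ⟨h.1, by rw [bar_bar, h.2]⟩)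
      · rintro ⟨z, hz⟩
        induction z using Sym2.ind with
        | _ u v =>
          obtain ⟨p, rfl, rfl⟩ := (wordGraph_adj hg').1 hz
          refine ⟨p.1, Subtype.ext ?_⟩
          obtain ⟨i, b⟩ := p
          cases b
          · exact Sym2.eq_swap
          · rfl
    refine ⟨(Equiv.ofBijective f hf, fun i =>
      if g (i, true) = (Quot.out (f i : Sym2 (Fin n))).1 then true else false), mem_univ _, ?_⟩
    have key : ∀ i, g (i, true) = (Quot.out (f i : Sym2 (Fin n))).1 ∧
        g (i, false) = (Quot.out (f i : Sym2 (Fin n))).2 ∨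
        g (i, true) = (Quot.out (f i : Sym2 (Fin n))).2 ∧
        g (i, false) = (Quot.out (f i : Sym2 (Fin n))).1 := fun i =>
      Sym2.eq_iff.1 (hout (f i)).symm
    funext ⟨i, b⟩
    have hne : g (i, true) ≠ g (i, false) := ne_of_confs hg' (i, true)
    simp only [Φ, Equiv.ofBijective_apply]
    obtain ⟨h1, h2⟩ | ⟨h1, h2⟩ := key i
    · rw [if_pos h1]
      cases b
      · simp [h2]
      · simp [h1]
    · have h3 : g (i, true) ≠ (Quot.out (f i : Sym2 (Fin n))).1 := by rwa [← h2]
      rw [if_neg h3]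
      cases b
      · simp [h2]
      · simp [h1]

lemma two_mul_card_edgeSet {H : SimpleGraph (Fin n)} (hH : ∀ v, deg H v = k) :
    2 * Fintype.card H.edgeSet = n * k := by
  have h := H.sum_degrees_eq_twice_card_edges
  rw [SimpleGraph.edgeFinset_card] at h
  rw [← h]
  have : ∀ v, H.degree v = k := fun v => by
    rw [← hH v, ← SimpleGraph.card_neighborFinset_eq_degree, SimpleGraph.neighborFinset_eq_filter]
    rfl
  simp [this]

lemma card_simple_words (hm : n * k = 2 * m) :
    ((words n m k).filter fun g => confs g = ∅).card
      = (fam (fun _ : Fin n => k) ⊥).card * (m.factorial * 2 ^ m) := by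
  have hfam : ∀ g : Fin m × Bool → Fin n, confs g = ∅ →
      (g ∈ words n m k ↔ wordGraph g ∈ fam (fun _ : Fin n => k) ⊥) := by
    intro g hg
    rw [mem_fam]
    simp only [words, mem_filter, mem_univ, true_and, bot_le, and_true, deg_wordGraph hg]
  rw [card_eq_sum_card_fiberwise (f := wordGraph) (t := fam (fun _ : Fin n => k) ⊥)
    fun g hg => (hfam g (mem_filter.1 hg).2).1 (mem_filter.1 hg).1, ← smul_eq_mul, ← sum_const]
  refine sum_congr rfl fun H hH => ?_
  rw [← card_wordGraph_eq (H := H) (by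
    have := two_mul_card_edgeSet (mem_fam.1 hH).1
    omega)]
  congr 1
  ext g
  simp only [mem_filter, mem_univ, true_and]
  constructor
  · rintro ⟨⟨-, h1⟩, h2⟩
    exact ⟨h1, h2⟩
  · rintro ⟨h1, h2⟩
    exact ⟨⟨(hfam g h1).2 (h2 ▸ hH), h1⟩, h2⟩

end Words

section Stirling

open Finset

variable {n m k : ℕ}

lemma log_stirlingSeq_sub_le (hm : 0 < m) (j : ℕ) :
    Real.log (Stirling.stirlingSeq m) - Real.log (Stirling.stirlingSeq (m + j))
      ≤ j / (4 * (m : ℝ) ^ 2) := by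
  induction j with
  | zero => simp
  | succ j ih =>
    have hm' : (0 : ℝ) < m := by exact_mod_cast hm
    have h := Stirling.log_stirlingSeq_sdiff_le (m + j)
    have h2 : 1 / (12 * ((m + j : ℕ) : ℝ) * ((m + j : ℕ) + 1)) ≤ 1 / (4 * (m : ℝ) ^ 2) := by
      apply one_div_le_one_div_of_le (by positivity)
      push_cast
      nlinarith [mul_nonneg hm'.le (Nat.cast_nonneg (α := ℝ) j), sq_nonneg (j : ℝ), hm'.le,
        Nat.cast_nonneg (α := ℝ) j]
    rw [add_assoc] at h
    push_cast at h h2 ⊢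
    rw [add_div]
    linarith

lemma abs_log_factorial_sub_le (hm : 0 < m) :
    |Real.log ((2 * m).factorial) - Real.log (m.factorial) - m * Real.log 2
      - (Real.log 2 / 2 + m * Real.log (2 * m / Real.exp 1))| ≤ 1 / (4 * m) := by
  have hm' : (0 : ℝ) < m := by exact_mod_cast hm
  have h1 := log_stirlingSeq_sub_le hm m
  have h2 : Real.log (Stirling.stirlingSeq (2 * m)) ≤ Real.log (Stirling.stirlingSeq m) := by
    have := Stirling.log_stirlingSeq'_antitone (show m - 1 ≤ 2 * m - 1 by omega)
    simpa [Function.comp, show (m - 1).succ = m by omega,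
      show (2 * m - 1).succ = 2 * m by omega, show 2 * m - 1 + 1 = 2 * m by omega,
      show m - 1 + 1 = m by omega] using this
  rw [← two_mul] at h1
  have h3 : (m : ℝ) / (4 * (m : ℝ) ^ 2) = 1 / (4 * m) := by field_simp
  rw [h3] at h1
  have e1 := Stirling.log_stirlingSeq_formula m
  have e2 := Stirling.log_stirlingSeq_formula (2 * m)
  have l1 : Real.log (2 * m) = Real.log 2 + Real.log m := Real.log_mul (by norm_num) hm'.ne'
  have l2 : Real.log (2 * m / Real.exp 1) = Real.log 2 + Real.log m - 1 := by
    rw [Real.log_div (by positivity) (by positivity), l1, Real.log_exp]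
  have l3 : Real.log (m / Real.exp 1) = Real.log m - 1 := by
    rw [Real.log_div (by positivity) (by positivity), Real.log_exp]
  push_cast at e2
  rw [Real.log_mul (by norm_num) (by positivity), l1, l2] at e2
  rw [l1, l3] at e1
  rw [l2, abs_le]
  constructor <;> linarith

lemma card_fam_regular (hm : n * k = 2 * m) (hk : 0 < k) (hm0 : 0 < m) (hm1 : 44 * k ^ 2 ≤ 2 * m) :
    (fam (fun _ : Fin n => k) ⊥).Nonempty ∧
    |Real.log ((fam (fun _ : Fin n => k) ⊥).card)
      - (Real.log 2 / 2 - n * Real.log k.factorial + m * Real.log (2 * m / Real.exp 1)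
        - ((k : ℝ) ^ 2 - 1) / 4)| ≤ 45 * (k : ℝ) ^ 4 / m := by
  obtain ⟨hu, hl⟩ := card_simple_words_bounds n hk hm1
  have hm' : (0 : ℝ) < m := by exact_mod_cast hm0
  have hw : (0 : ℝ) < (words n m k).card := by
    obtain ⟨g, hg⟩ := exists_mem_words hm
    exact_mod_cast card_pos.2 ⟨g, hg⟩
  rw [card_simple_words hm] at hu hl
  push_cast at hu hl
  have hc : (0 : ℝ) < (fam (fun _ : Fin n => k) ⊥).card := by
    by_contra c
    have : ((fam (fun _ : Fin n => k) ⊥).card : ℝ) = 0 := le_antisymm (not_lt.1 c) (by positivity)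
    rw [this, zero_mul] at hl
    exact absurd hl (not_le.2 (by positivity))
  refine ⟨card_pos.1 (by exact_mod_cast hc), ?_⟩
  have hf : (0 : ℝ) < m.factorial := by positivity
  have e1 : Real.log ((fam (fun _ : Fin n => k) ⊥).card * (m.factorial * 2 ^ m))
      = Real.log ((fam (fun _ : Fin n => k) ⊥).card) + (Real.log m.factorial + m * Real.log 2) := by
    rw [Real.log_mul hc.ne' (by positivity), Real.log_mul (by positivity) (by positivity),
      Real.log_pow]
  have hu' := Real.log_le_log (by positivity) hu
  have hl' := Real.log_le_log (by positivity) hl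
  rw [Real.log_mul (by positivity) hw.ne', Real.log_exp, e1] at hu' hl'
  have e2 : Real.log ((words n m k).card) + n * Real.log k.factorial
      = Real.log ((2 * m).factorial) := by
    rw [← card_words hm]
    push_cast
    rw [Real.log_mul hw.ne' (by positivity), Real.log_pow]
  have h4 := abs_le.1 (abs_log_factorial_sub_le hm0)
  have hk4 : (1 : ℝ) / (4 * m) ≤ (k : ℝ) ^ 4 / m := by
    rw [div_le_div_iff₀ (by positivity) hm']
    have : (1 : ℝ) ≤ (k : ℝ) ^ 4 := one_le_pow₀ (by exact_mod_cast hk)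
    nlinarith
  have e3 : 45 * (k : ℝ) ^ 4 / m = 44 * (k : ℝ) ^ 4 / m + (k : ℝ) ^ 4 / m := by ring
  rw [e3, abs_le]
  constructor <;> linarith [h4.1, h4.2]

end Stirling

section Assembly

open Finset

variable {n k m : ℕ} {L lm q : ℝ} {d : Fin n → ℕ}

lemma sum_card_fam_eq (d : Fin n → ℕ) (k : ℕ) :
    ∑ H ∈ fam (fun _ : Fin n => k) ⊥, ((fam d H).card : ℝ) = ∑ G ∈ fam d ⊥, (regCount k G : ℝ) := by
  have h1 : ∀ H : SimpleGraph (Fin n),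
      ((fam d H).card : ℝ) = ∑ G ∈ fam d ⊥, if H ≤ G then 1 else 0 := by
    intro H
    rw [sum_boole]
    congr 2
    ext G
    simp [mem_fam]
  have h2 : ∀ G : SimpleGraph (Fin n),
      (regCount k G : ℝ) = ∑ H ∈ fam (fun _ : Fin n => k) ⊥, if H ≤ G then 1 else 0 := by
    intro G
    rw [sum_boole, regCount]
    congr 2
    ext H
    simp [mem_fam, and_comm]
  simp only [h1, h2]
  exact sum_comm

lemma fam_bot_eq (d : Fin n → ℕ) : fam d ⊥ = degFinset n d := by
  ext G
  simp [mem_fam, degFinset]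

lemma expReg_eq (d : Fin n → ℕ) (k : ℕ) :
    expReg n d k
      = ∑ H ∈ fam (fun _ : Fin n => k) ⊥, ((fam d H).card : ℝ) / ((fam d ⊥).card : ℝ) := by
  rw [expReg, ← fam_bot_eq, ← sum_card_fam_eq, sum_div]

lemma xsum_eq_esum (lm : ℝ) (d : Fin n → ℕ) (Y : SimpleGraph (Fin n)) :
    -xsum lm d Y = -(1 / (2 * (lm * (1 - lm) * n ^ 2))) * esum (dev lm d) Y := by
  rw [xsum, esum]
  ring

/-- If every term of a sum is close to `exp (A + u)` on the logarithmic scale, so is the sum. -/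
lemma abs_log_sum_sub_le {α : Type*} {s : Finset α} (hs : s.Nonempty) {p u : α → ℝ} {A η : ℝ}
    (hp : ∀ x ∈ s, 0 < p x) (h : ∀ x ∈ s, |Real.log (p x) - (A + u x)| ≤ η) :
    |Real.log (∑ x ∈ s, p x) - (A + Real.log (∑ x ∈ s, Real.exp (u x)))| ≤ η := by
  have hS : 0 < ∑ x ∈ s, Real.exp (u x) := sum_pos (fun x _ => Real.exp_pos _) hs
  have hP : 0 < ∑ x ∈ s, p x := sum_pos hp hs
  have h1 : ∑ x ∈ s, p x ≤ Real.exp (A + η) * ∑ x ∈ s, Real.exp (u x) := by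
    rw [mul_sum]
    refine sum_le_sum fun x hx => ?_
    rw [← Real.exp_add, ← Real.log_le_iff_le_exp (hp x hx)]
    linarith [(abs_le.1 (h x hx)).2]
  have h2 : Real.exp (A - η) * ∑ x ∈ s, Real.exp (u x) ≤ ∑ x ∈ s, p x := by
    rw [mul_sum]
    refine sum_le_sum fun x hx => ?_
    rw [← Real.exp_add, ← Real.le_log_iff_exp_le (hp x hx)]
    linarith [(abs_le.1 (h x hx)).1]
  have h3 := Real.log_le_log hP h1
  have h4 := Real.log_le_log (by positivity) h2
  rw [Real.log_mul (Real.exp_ne_zero _) hS.ne', Real.log_exp] at h3 h4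
  rw [abs_le]
  constructor <;> linarith

lemma log_sum_exp_xsum (h : Dense n L lm q d) (hk : (k : ℝ) ≤ L) (hk0 : 0 < k)
    (hne : (fam (fun _ : Fin n => k) ⊥).Nonempty) :
    |Real.log (∑ G ∈ fam (fun _ : Fin n => k) ⊥, Real.exp (-xsum lm d G))
        - Real.log (fam (fun _ : Fin n => k) ⊥).card| ≤ L ^ 10 / n := by
  have hn := h.n_pos
  have hl0 := h.lm_pos
  have hl1 : 0 < 1 - lm := by linarith [h.lm_lt]
  have hL0 := h.L_pos
  have hL := h.hL
  set c : ℝ := -(1 / (2 * (lm * (1 - lm) * n ^ 2))) with hc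
  have hcB : |c| * (L * q) ^ 2 ≤ L ^ 4 / (2 * n) := by
    rw [hc, abs_neg, abs_of_pos (by positivity), mul_pow, h.hq]
    have e1 : 1 ≤ lm * L := by
      have := h.hlm
      rwa [div_le_iff₀ hL0] at this
    have e2 : 1 ≤ (1 - lm) * L := by
      have := h.hlm'
      rwa [div_le_iff₀ hL0] at this
    have e3 : 1 ≤ (lm * L) * ((1 - lm) * L) := one_le_mul_of_one_le_of_one_le e1 e2
    rw [show 1 / (2 * (lm * (1 - lm) * (n : ℝ) ^ 2)) * (L ^ 2 * n)
      = L ^ 2 / (lm * (1 - lm) * (2 * n)) by field_simp,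
      div_le_div_iff₀ (by positivity) (by positivity)]
    calc L ^ 2 * (2 * n) = L ^ 2 * (2 * n) * 1 := by ring
      _ ≤ L ^ 2 * (2 * n) * ((lm * L) * ((1 - lm) * L)) := by gcongr
      _ = _ := by ring
  have hLn : L ^ 5 ≤ n := by
    have := h.pow_le (k := 5) (by norm_num)
    rw [← h.hq]
    nlinarith [h.q_large]
  have hc0 : 0 ≤ |c| * (L * q) ^ 2 := by positivity
  have hsmall : 8 * (|c| * (L * q) ^ 2) ≤ 1 := by
    have : L ^ 4 / (2 * n) ≤ 1 / 8 := by
      rw [div_le_div_iff₀ (by positivity) (by norm_num)]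
      have : L ^ 4 * 1000 ≤ L ^ 4 * L := by gcongr
      nlinarith
    linarith
  simp only [xsum_eq_esum]
  refine (abs_log_sum_exp_le n k h.abs_dev_le h.sum_dev hsmall (by exact_mod_cast hn) hk0
    hne).trans ?_
  calc |c| * (L * q) ^ 2 * (8 * k ^ 2 + 16 * (|c| * (L * q) ^ 2) * (n * k))
      ≤ L ^ 4 / (2 * n) * (8 * L ^ 2 + 16 * (L ^ 4 / (2 * n)) * (n * L)) := by gcongr
    _ = (4 * L ^ 6 + 4 * L ^ 9) / n := by field_simp; ring
    _ ≤ L ^ 10 / n := by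
      gcongr
      have e1 : L ^ 6 ≤ L ^ 9 := pow_le_pow_right₀ (by linarith) (by norm_num)
      have e2 : L ^ 9 * 1000 ≤ L ^ 9 * L := by gcongr
      have e3 : 0 < L ^ 9 := by positivity
      nlinarith

lemma log_expReg (h : Dense n L lm q d) (hk : (k : ℝ) ≤ L - 8) (hk0 : 0 < k)
    (hm : n * k = 2 * m) :
    0 < expReg n d k ∧
    |Real.log (expReg n d k)
      - (Real.log 2 / 2 - n * Real.log k.factorial + m * Real.log (2 * m / Real.exp 1)
        + m * Real.log lm - ((k : ℝ) ^ 2 - 1) / 4 - (1 - lm) / (4 * lm) * (k * (k - 2))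
        - k * (∑ x, dev lm d x ^ 2) / (2 * lm ^ 2 * n ^ 2))| ≤ L ^ 35 / q := by
  have hn := h.n_pos
  have hL0 := h.L_pos
  have hL := h.hL
  have hq0 := h.hq0
  have hkL : (k : ℝ) ≤ L := by linarith
  have hk1 : (1 : ℝ) ≤ k := by exact_mod_cast hk0
  have hmR : (n : ℝ) * k = 2 * m := by exact_mod_cast hm
  have hm0' : (0 : ℝ) < m := by
    have : (0 : ℝ) < n * k := by positivity
    linarith
  have hm0 : 0 < m := by exact_mod_cast hm0'
  have hLn : L ^ 5 ≤ n := by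
    have := h.pow_le (k := 5) (by norm_num)
    rw [← h.hq]
    nlinarith [h.q_large]
  have hm1 : 44 * k ^ 2 ≤ 2 * m := by
    have e1 : 44 * (k : ℝ) ≤ n := by
      have : (1000 : ℝ) ^ 4 * L ≤ L ^ 4 * L := by gcongr
      nlinarith
    have : 44 * (k : ℝ) ^ 2 ≤ 2 * m := by
      rw [← hmR]
      nlinarith
    exact_mod_cast this
  obtain ⟨hne, hRG⟩ := card_fam_regular hm hk0 hm0 hm1
  have hX := log_sum_exp_xsum h hkL hk0 hne
  have hcard0 : (0 : ℝ) < (fam d ⊥).card := by exact_mod_cast card_pos.2 h.hne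
  have hdeg : ∀ H ∈ fam (fun _ : Fin n => k) ⊥, DegLE H (L - 8) := fun H hH j => by
    rw [(mem_fam.1 hH).1 j]
    exact hk
  have hpos : ∀ H ∈ fam (fun _ : Fin n => k) ⊥,
      0 < ((fam d H).card : ℝ) / ((fam d ⊥).card : ℝ) := fun H hH => by
    have : 0 < ((fam d H).card : ℝ) := by
      exact_mod_cast card_pos.2 (fam_nonempty h H fun j => (hdeg H hH j).trans (by linarith))
    positivity
  have hlog : ∀ H ∈ fam (fun _ : Fin n => k) ⊥,
      |Real.log ((fam d H).card / (fam d ⊥).card)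
        - ((m * Real.log lm - (1 - lm) / (4 * lm) * (k * (k - 2))
        - k * (∑ x, dev lm d x ^ 2) / (2 * lm ^ 2 * n ^ 2)) + -xsum lm d H)|
      ≤ L ^ 34 / q + L ^ 2 / n := fun H hH => by
    have e1 := log_card_fam h H (hdeg H hH)
    have e2 := lprob_regular h hkL (mem_fam.1 hH).1
    have e3 : (∑ x, (deg H x : ℝ)) / 2 * (L ^ 33 / q ^ 3) ≤ L ^ 34 / q := by
      simp only [(mem_fam.1 hH).1, sum_const, card_univ, Fintype.card_fin, nsmul_eq_mul]
      rw [← h.hq]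
      calc q ^ 2 * k / 2 * (L ^ 33 / q ^ 3) ≤ q ^ 2 * L * (L ^ 33 / q ^ 3) := by
            gcongr
            nlinarith [mul_nonneg (sq_nonneg q) (hk1.trans' zero_le_one),
              mul_le_mul_of_nonneg_left hkL (sq_nonneg q)]
        _ = L ^ 34 / q := by field_simp
    rw [hmR, mul_div_cancel_left₀ _ (two_ne_zero)] at e2
    have e4 := abs_le.1 (e1.trans e3)
    have e5 := abs_le.1 e2
    rw [abs_le]
    constructor <;> linarith [e4.1, e4.2, e5.1, e5.2]
  have hsum := abs_log_sum_sub_le hne hpos hlog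
  rw [← expReg_eq] at hsum
  refine ⟨by rw [expReg_eq]; exact sum_pos hpos hne, ?_⟩
  have hk4 : 45 * (k : ℝ) ^ 4 / m ≤ L ^ 4 / n := by
    rw [show (m : ℝ) = n * k / 2 by linarith,
      show 45 * (k : ℝ) ^ 4 / (n * k / 2) = 90 * (k : ℝ) ^ 3 / n by field_simp; ring]
    have e1 : 90 * (k : ℝ) ^ 3 ≤ L * L ^ 3 := by gcongr; linarith
    gcongr
    linarith
  have hall : L ^ 34 / q + L ^ 2 / n + L ^ 4 / n + L ^ 10 / n ≤ L ^ 35 / q := by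
    have hqn : q ≤ n := by
      rw [← h.hq]
      nlinarith [h.q_large]
    have e1 : ∀ i ≤ 34, L ^ i / (n : ℝ) ≤ L ^ 34 / q := fun i hi => by
      gcongr
      linarith
    have e2 : 1000 * L ^ 34 / q ≤ L ^ 35 / q := by
      rw [show L ^ 35 = L * L ^ 34 by ring]
      gcongr
    have e3 : 0 < L ^ 34 / q := by positivity
    rw [mul_div_assoc] at e2
    linarith [e1 2 (by norm_num), e1 4 (by norm_num), e1 10 (by norm_num)]
  have h1 := abs_le.1 hsum
  have h2 := abs_le.1 hRG
  have h3 := abs_le.1 hX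
  rw [abs_le]
  constructor <;> linarith [h1.1, h1.2, h2.1, h2.2, h3.1, h3.2]

end Assembly

section Final

open Finset Filter

variable {n : ℕ} {d : Fin n → ℕ}

lemma lam_mul (hn : 1 < n) (d : Fin n → ℕ) : lam n d * ((n : ℝ) - 1) = dbar n d := by
  have : (0 : ℝ) < (n : ℝ) - 1 := by
    have : (1 : ℝ) < n := by exact_mod_cast hn
    linarith
  rw [lam, div_mul_cancel₀ _ this.ne']

lemma abs_sub_dbar_le (d : Fin n → ℕ) (j : Fin n) : |(d j : ℝ) - dbar n d| ≤ deltaPar n d :=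
  le_ciSup (f := fun j : Fin n => |(d j : ℝ) - dbar n d|) (Set.finite_range _).bddAbove j

lemma eventually_mul_log_le (a : ℝ) {κ : ℝ} (hκ : 0 < κ) :
    ∀ᶠ n : ℕ in atTop, a * Real.log n ≤ (n : ℝ) ^ κ := by
  have h := ((isLittleO_log_rpow_atTop hκ).const_mul_left a).comp_tendsto tendsto_natCast_atTop_atTop
  filter_upwards [h.bound one_pos] with n hn
  have h0 : (0 : ℝ) ≤ (n : ℝ) ^ κ := by positivity
  simp only [Function.comp_apply, one_mul, Real.norm_of_nonneg h0] at hn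
  exact (le_abs_self _).trans hn

lemma eventually_le_rpow (c : ℝ) {κ : ℝ} (hκ : 0 < κ) : ∀ᶠ n : ℕ in atTop, c ≤ (n : ℝ) ^ κ :=
  ((tendsto_rpow_atTop hκ).comp tendsto_natCast_atTop_atTop).eventually_ge_atTop c

lemma one_div_rpow_le {a κ y : ℝ} (ha : 0 < a) (hn : 1 < n)
    (hlog : 3 * a * Real.log n ≤ (n : ℝ) ^ κ) (hy : (n : ℝ) / (3 * a * Real.log n) ≤ y) :
    1 / (n : ℝ) ^ κ ≤ y / ((n : ℝ) - 1) := by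
  have hn' : (1 : ℝ) < n := by exact_mod_cast hn
  have hl : 0 < Real.log n := Real.log_pos hn'
  have hl' : 0 < 3 * a * Real.log n := by positivity
  calc 1 / (n : ℝ) ^ κ ≤ 1 / (3 * a * Real.log n) := by gcongr
    _ = n / (3 * a * Real.log n) / n := by field_simp
    _ ≤ y / ((n : ℝ) - 1) := by
      have : 0 ≤ (n : ℝ) / (3 * a * Real.log n) := by positivity
      apply div_le_div₀ (this.trans hy) hy <;> linarith

lemma dense_lam {a κ δ : ℝ} (ha : 0 < a) (hn : 1 < n) (hne : (degFinset n d).Nonempty)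
    (hL : 1000 ≤ (n : ℝ) ^ κ) (hκ : 100 * κ ≤ 1 / 2)
    (hlog : 3 * a * Real.log n ≤ (n : ℝ) ^ κ) (hδ : deltaPar n d ≤ δ)
    (hδ' : δ ≤ (n : ℝ) ^ κ * (n : ℝ) ^ (1 / 2 : ℝ))
    (hd : min (dbar n d) ((n : ℝ) - dbar n d - 1) ≥ (n : ℝ) / (3 * a * Real.log n)) :
    Dense n ((n : ℝ) ^ κ) (lam n d) ((n : ℝ) ^ (1 / 2 : ℝ)) d where
  hL := hL
  hq0 := by positivity
  hq := by
    rw [← Real.rpow_natCast, ← Real.rpow_mul (by positivity)]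
    norm_num
  hLq := by
    rw [← Real.rpow_natCast, ← Real.rpow_mul (by positivity)]
    refine Real.rpow_le_rpow_of_exponent_le (by exact_mod_cast hn.le) ?_
    push_cast
    linarith
  hlm := one_div_rpow_le ha hn hlog (hd.le.trans (min_le_left _ _))
  hlm' := by
    have h1 := one_div_rpow_le ha hn hlog (hd.le.trans (min_le_right _ _))
    have : (n : ℝ) - 1 ≠ 0 := by
      have : (1 : ℝ) < n := by exact_mod_cast hn
      linarith
    rwa [show (n : ℝ) - dbar n d - 1 = (1 - lam n d) * ((n : ℝ) - 1) by
      rw [sub_mul, lam_mul hn]; ring, mul_div_cancel_right₀ _ this] at h1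
  hd := fun j => by
    rw [lam_mul hn]
    exact (abs_sub_dbar_le d j).trans (hδ.trans hδ')
  hsum := by
    have : (n : ℝ) ≠ 0 := by
      have : (1 : ℝ) < n := by exact_mod_cast hn
      linarith
    rw [mul_right_comm, lam_mul hn, dbar, div_mul_cancel₀ _ this]
  hne := by rwa [fam_bot_eq]

end Final

theorem statement13 (a b C₀ : ℝ) (ha : 0 < a) (hb : 0 < b) (hab : a + b < 1 / 2)
    (hC₀ : 0 < C₀) :
    ∃ ε : ℝ, 0 < ε ∧ ∃ C : ℝ, 0 < C ∧ ∃ N : ℕ, ∀ n : ℕ, N ≤ n →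
      ∀ d : Fin n → ℕ, (degFinset n d).Nonempty →
        deltaPar n d ≤ C₀ * (n : ℝ) ^ ((1 : ℝ) / 2 + ε) →
        min (dbar n d) ((n : ℝ) - dbar n d - 1) ≥ (n : ℝ) / (3 * a * Real.log n) →
        ∀ h : ℕ, 0 < h → (h : ℝ) ≤ C₀ * (n : ℝ) ^ (2 * ε) →
          ∀ m : ℕ, n * h = 2 * m →
            ∃ E : ℝ, |E| ≤ C * (n : ℝ) ^ (-b) ∧
              expReg n d h =
                (Real.sqrt 2 / ((Nat.factorial h : ℝ)) ^ n) *
                  (2 * lam n d * m / Real.exp 1) ^ m *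
                  Real.exp (
                    -(((h : ℝ) ^ 2 - 1) / 4)
                    - ((1 - lam n d) / (4 * lam n d)) * (h * ((h : ℝ) - 2))
                    - Rpar n d * h / (2 * (lam n d) ^ 2 * n)
                    + E) := by
  obtain ⟨κ, hκ0, hκ, hκb⟩ : ∃ κ : ℝ, 0 < κ ∧ 100 * κ ≤ 1 / 2 ∧ 35 * κ - 1 / 2 ≤ -b :=
    ⟨(1 / 2 - b) / 100, by linarith, by linarith, by linarith⟩
  refine ⟨κ / 4, by linarith, 1, one_pos, ?_⟩
  have hev := (eventually_le_rpow 1000 hκ0).and <|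
    (eventually_le_rpow (C₀ + 8) (show 0 < κ / 2 by linarith)).and <|
    (eventually_le_rpow C₀ (show 0 < 3 * κ / 4 by linarith)).and <|
    (eventually_mul_log_le (3 * a) hκ0).and <| Filter.eventually_gt_atTop 1
  obtain ⟨N, hN⟩ := Filter.eventually_atTop.1 hev
  refine ⟨N, fun n hn d hne hδ hd h hh0 hh m hm => ?_⟩
  obtain ⟨hL, hL2, hL3, hlog, hn1⟩ := hN n hn
  have hn0 : (0 : ℝ) < n := by exact_mod_cast hn1.trans' zero_lt_one
  have hδ' : C₀ * (n : ℝ) ^ ((1 : ℝ) / 2 + κ / 4) ≤ (n : ℝ) ^ κ * (n : ℝ) ^ (1 / 2 : ℝ) := by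
    calc C₀ * (n : ℝ) ^ ((1 : ℝ) / 2 + κ / 4)
        ≤ (n : ℝ) ^ (3 * κ / 4) * (n : ℝ) ^ ((1 : ℝ) / 2 + κ / 4) := by gcongr
      _ = _ := by
        rw [← Real.rpow_add hn0, ← Real.rpow_add hn0]
        ring_nf
  have hdense := dense_lam ha hn1 hne hL hκ hlog hδ hδ' hd
  have hk : (h : ℝ) ≤ (n : ℝ) ^ κ - 8 := by
    rw [show 2 * (κ / 4) = κ / 2 by ring] at hh
    have e1 : (n : ℝ) ^ κ = (n : ℝ) ^ (κ / 2) * (n : ℝ) ^ (κ / 2) := by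
      rw [← Real.rpow_add hn0]
      ring_nf
    nlinarith [mul_le_mul_of_nonneg_right hL2 ((by linarith : 0 ≤ C₀ + 8).trans hL2)]
  obtain ⟨hpos, hE⟩ := log_expReg hdense hk hh0 hm
  have hlm := hdense.lm_pos
  have hm0 : (0 : ℝ) < m := by
    have : 0 < n * h := Nat.mul_pos (by omega) hh0
    exact_mod_cast (by omega : 0 < m)
  refine ⟨_, hE.trans ?_, ?_⟩
  · rw [← Real.rpow_natCast, ← Real.rpow_mul hn0.le, ← Real.rpow_sub hn0, one_mul]
    refine Real.rpow_le_rpow_of_exponent_le (by exact_mod_cast hn1.le) ?_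
    push_cast
    linarith
  · have hR : h * (∑ x, dev (lam n d) d x ^ 2) / (2 * lam n d ^ 2 * n ^ 2)
        = Rpar n d * h / (2 * (lam n d) ^ 2 * n) := by
      simp only [dev, lam_mul hn1, Rpar]
      field_simp
    refine Real.log_injOn_pos hpos (show (0 : ℝ) < _ by positivity) ?_
    rw [Real.log_mul (by positivity) (by positivity), Real.log_mul (by positivity) (by positivity),
      Real.log_div (by positivity) (by positivity), Real.log_sqrt (by norm_num), Real.log_pow,
      Real.log_pow, Real.log_exp, hR,
      show 2 * lam n d * m / Real.exp 1 = 2 * m / Real.exp 1 * lam n d by ring,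
      Real.log_mul (by positivity) (by positivity)]
    ring

end Stmt13
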